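/- Let 0 < α₁ < α₂ ≤ 1 and let φ be a smooth function supported in [α₁, α₂]. There is a constant C depending only on φ such that the following holds. Let D > 3 be a prime with D ≡ 3 (mod 4), h the class number of ℚ(√−D), let x ≥ 3 with θ := log D/log x < 2α₁ − α₂, let χ be a nontrivial character of the ideal class group of K = ℚ(√−D), and let F : ℂ → ℂ be an entire function with F(s) = Σ_{n≥1} λ_χ(n) n^{−s} for Re s > 1. Then the sum Σ_ρ m_ρ Φ̃(ρ) over the zeros ρ of F with 0 < Re ρ < 1, each counted with its multiplicity m_ρ, converges absolutely, and | Σ_p (λ_χ(p)/p) φ(log p/log x) + Σ_ρ m_ρ Φ̃(ρ) | ≤ C/(h log x), where the first sum is over rational primes p, Φ(t) = φ(log t/log x)/(t log t), and Φ̃(s) = ∫₀^∞ Φ(t) t^{s−1} dt is the Mellin transform of Φ. -/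

import Mathlib

open NumberField
open scoped Classical

/-- The ideal class of a nonzero integral ideal (junk value `1` for the zero ideal). -/
noncomputable def idealClass (K : Type) [Field K] [NumberField K] (I : Ideal (𝓞 K)) :
    ClassGroup (𝓞 K) :=
  if h : I ∈ nonZeroDivisors (Ideal (𝓞 K)) then ClassGroup.mk0 ⟨I, h⟩ else 1

/-- `lambdaChi K χ n = Σ_{N𝔞 = n} χ(𝔞)`, the sum over integral ideals of norm `n`. -/
noncomputable def lambdaChi (K : Type) [Field K] [NumberField K]
    (χ : ClassGroup (𝓞 K) →* ℂ) (n : ℕ) : ℂ :=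
  ∑ᶠ I ∈ {I : Ideal (𝓞 K) | Ideal.absNorm I = n ∧ I ≠ 0}, χ (idealClass K I)

/-- The test function `Φ(t) = φ(log t / log x) / (t log t)` as a complex-valued function. -/
noncomputable def PhiLog (φ : ℝ → ℝ) (x t : ℝ) : ℂ :=
  ((φ (Real.log t / Real.log x) / (t * Real.log t) : ℝ) : ℂ)

theorem log_norm_le_circleAverage_log_norm {f : ℂ → ℂ} {c : ℂ} {r : ℝ} (hr : 0 < r)
    (hf : Differentiable ℂ f) (hc : f c ≠ 0) :
    Real.log ‖f c‖ ≤ Real.circleAverage (fun z => Real.log ‖f z‖) c r := by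
  have hA : AnalyticOnNhd ℂ f (Metric.closedBall c |r|) := fun z _ => hf.analyticAt z
  have h := hA.circleAverage_log_norm hr.ne' hc
  rw [h]
  have : 0 ≤ ∑ᶠ u, MeromorphicOn.divisor f (Metric.closedBall c |r|) u *
      Real.log (r * ‖c - u‖⁻¹) := by
    refine finsum_nonneg fun u => ?_
    by_cases hu : u ∈ Metric.closedBall c |r|
    · refine mul_nonneg ?_ ?_
      · have := MeromorphicOn.AnalyticOnNhd.divisor_nonneg hA
        exact_mod_cast this u
      · rcases eq_or_ne u c with rfl | huc
        · simp
        · apply Real.log_nonneg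
          rw [← div_eq_mul_inv, le_div_iff₀ (norm_pos_iff.2 (sub_ne_zero.2 huc.symm)), one_mul]
          rw [Metric.mem_closedBall, abs_of_pos hr, dist_comm, dist_eq_norm] at hu
          exact hu
    · simp [Function.locallyFinsuppWithin.apply_eq_zero_of_notMem _ hu]
  linarith

theorem circleAverage_abs_log_norm_le {f : ℂ → ℂ} {c : ℂ} {r M : ℝ} (hr : 0 < r)
    (hf : Differentiable ℂ f) (hc : f c ≠ 0) (hM0 : 0 ≤ M)
    (hM : ∀ z ∈ Metric.sphere c r, Real.log ‖f z‖ ≤ M) :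
    Real.circleAverage (fun z => |Real.log ‖f z‖|) c r ≤ 2 * M - Real.log ‖f c‖ := by
  have hci : CircleIntegrable (fun z => Real.log ‖f z‖) c r :=
    MeromorphicOn.circleIntegrable_log_norm fun z _ => (hf.analyticAt z).meromorphicAt
  have h2 : CircleIntegrable ((fun _ => 2 * M) - fun z => Real.log ‖f z‖) c r :=
    (circleIntegrable_const (2 * M) c r).sub hci
  have h1 := Real.circleAverage_mono hci.abs h2 (fun z hz => by
    rw [abs_of_pos hr] at hz
    have := hM z hz
    simp only [Pi.sub_apply, Pi.abs_apply]
    rcases abs_cases (Real.log ‖f z‖) with h | h <;> linarith)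
  refine h1.trans ?_
  rw [Real.circleAverage_sub (circleIntegrable_const (2 * M) c r) hci,
    Real.circleAverage_const]
  have := log_norm_le_circleAverage_log_norm hr hf hc
  linarith

theorem measurable_log_norm {f : ℂ → ℂ} (hf : Differentiable ℂ f) :
    Measurable fun z => Real.log ‖f z‖ :=
  Real.measurable_log.comp hf.continuous.norm.measurable

theorem lintegral_ball_log_norm_le {f : ℂ → ℂ} {c : ℂ} {R M : ℝ} (hR : 0 < R)
    (hf : Differentiable ℂ f) (hc : f c ≠ 0) (hM0 : 0 ≤ M)
    (hM : ∀ z ∈ Metric.ball c R, Real.log ‖f z‖ ≤ M) :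
    ∫⁻ z in Metric.ball c R, ‖Real.log ‖f z‖‖ₑ ≤
      ENNReal.ofReal (R * R * (2 * Real.pi) * (2 * M - Real.log ‖f c‖)) := by
  set B := 2 * M - Real.log ‖f c‖ with hB
  have hB0 : 0 ≤ B := by
    have := hM c (Metric.mem_ball_self hR)
    simp only [hB]; linarith
  have htr : ∫⁻ z in Metric.ball c R, ‖Real.log ‖f z‖‖ₑ =
      ∫⁻ z, (Metric.ball 0 R).indicator (fun z => ‖Real.log ‖f (z + c)‖‖ₑ) z := by
    rw [← MeasureTheory.lintegral_indicator Metric.isOpen_ball.measurableSet,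
      ← MeasureTheory.lintegral_add_right_eq_self _ c]
    congr 1
    ext z
    simp only [Set.indicator, Metric.mem_ball, dist_eq_norm, add_sub_cancel_right, sub_zero]
  rw [htr, ← Complex.lintegral_comp_polarCoord_symm, polarCoord_target,
    MeasureTheory.Measure.volume_eq_prod, MeasureTheory.setLIntegral_prod]
  swap
  · apply Measurable.aemeasurable
    have h1 : Measurable ((Metric.ball (0:ℂ) R).indicator
        (fun z => ‖Real.log ‖f (z + c)‖‖ₑ)) := by
      apply Measurable.indicator _ Metric.isOpen_ball.measurableSet
      exact ((measurable_log_norm hf).comp (measurable_id.add_const c)).enorm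
    have h2 : Measurable fun p : ℝ × ℝ => Complex.polarCoord.symm p := by
      have : Continuous fun p : ℝ × ℝ =>
          (p.1 : ℂ) * ((Real.cos p.2 : ℂ) + (Real.sin p.2 : ℂ) * Complex.I) := by fun_prop
      simpa only [Complex.polarCoord_symm_apply] using this.measurable
    simp only [smul_eq_mul]
    exact (ENNReal.measurable_ofReal.comp measurable_fst).mul (h1.comp h2)
  calc _ ≤ ∫⁻ r in Set.Ioi (0:ℝ), (Set.Ioo 0 R).indicator
        (fun _ => ENNReal.ofReal (R * (2 * Real.pi * B))) r := by
        refine MeasureTheory.setLIntegral_mono' measurableSet_Ioi fun r hr => ?_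
        rw [Set.mem_Ioi] at hr
        have hpt : ∀ θ : ℝ, Complex.polarCoord.symm (r, θ) + c = circleMap c r θ := by
          intro θ
          rw [Complex.polarCoord_symm_apply, circleMap, Complex.exp_mul_I]
          push_cast
          ring
        have hnorm : ∀ θ : ℝ, ‖Complex.polarCoord.symm (r, θ)‖ = r := by
          intro θ
          have : Complex.polarCoord.symm (r, θ) = circleMap c r θ - c := by rw [← hpt]; ring
          rw [this]
          simp [circleMap, abs_of_pos hr]
        by_cases hrR : r < R
        · have hmem : r ∈ Set.Ioo 0 R := ⟨hr, hrR⟩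
          rw [Set.indicator_of_mem hmem]
          have hci : CircleIntegrable (fun z => |Real.log ‖f z‖|) c r :=
            CircleIntegrable.abs (MeromorphicOn.circleIntegrable_log_norm
              fun z _ => (hf.analyticAt z).meromorphicAt)
          have hav := circleAverage_abs_log_norm_le hr hf hc hM0 (fun z hz => hM z (by
            rw [Metric.mem_sphere] at hz; rw [Metric.mem_ball, hz]; exact hrR))
          rw [Real.circleAverage_eq_integral_add (-Real.pi)] at hav
          rw [intervalIntegral.integral_comp_add_right
            (fun θ => |Real.log ‖f (circleMap c r θ)‖|)] at hav
          have hii : IntervalIntegrable (fun θ => |Real.log ‖f (circleMap c r θ)‖|)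
              MeasureTheory.volume (-Real.pi) Real.pi := by
            have hper : Function.Periodic (fun θ => |Real.log ‖f (circleMap c r θ)‖|)
                (2 * Real.pi) := by
              intro θ
              simp only [periodic_circleMap c r θ]
            refine hper.intervalIntegrable (t := 0) Real.two_pi_pos.ne' ?_ _ _
            rw [zero_add]
            exact hci
          have e1 : (0:ℝ) + -Real.pi = -Real.pi := by ring
          have e2 : 2 * Real.pi + -Real.pi = Real.pi := by ring
          rw [e1, e2, smul_eq_mul, inv_mul_le_iff₀ Real.two_pi_pos,
            intervalIntegral.integral_of_le (by linarith [Real.pi_pos]),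
            MeasureTheory.integral_Ioc_eq_integral_Ioo] at hav
          have hi := (intervalIntegrable_iff_integrableOn_Ioo_of_le
            (by linarith [Real.pi_pos])).1 hii
          have hbd : ∀ θ : ℝ, ENNReal.ofReal (r, θ).1 • (Metric.ball (0:ℂ) R).indicator
              (fun z => ‖Real.log ‖f (z + c)‖‖ₑ) (Complex.polarCoord.symm (r, θ)) =
              ENNReal.ofReal r * ENNReal.ofReal |Real.log ‖f (circleMap c r θ)‖| := by
            intro θ
            rw [Set.indicator_of_mem (by rw [mem_ball_zero_iff, hnorm]; exact hrR), hpt,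
              Real.enorm_eq_ofReal_abs, smul_eq_mul]
          simp_rw [hbd]
          have hm : Measurable fun θ => ENNReal.ofReal |Real.log ‖f (circleMap c r θ)‖| := by
            have := ((measurable_log_norm hf).comp (continuous_circleMap c r).measurable)
            exact (this.norm).ennreal_ofReal
          rw [MeasureTheory.lintegral_const_mul _ hm,
            ← MeasureTheory.ofReal_integral_eq_lintegral_ofReal hi
              (Filter.Eventually.of_forall fun _ => abs_nonneg _),
            ← ENNReal.ofReal_mul hr.le]
          apply ENNReal.ofReal_le_ofReal
          gcongr
        · have h0 : ∀ θ : ℝ, ENNReal.ofReal (r, θ).1 • (Metric.ball (0:ℂ) R).indicator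
              (fun z => ‖Real.log ‖f (z + c)‖‖ₑ) (Complex.polarCoord.symm (r, θ)) = 0 := by
            intro θ
            rw [Set.indicator_of_notMem (by rw [mem_ball_zero_iff, hnorm]; exact hrR), smul_zero]
          simp_rw [h0]
          simp
    _ ≤ _ := by
        rw [MeasureTheory.lintegral_indicator measurableSet_Ioo,
          MeasureTheory.setLIntegral_const]
        calc _ ≤ ENNReal.ofReal (R * (2 * Real.pi * B)) * ENNReal.ofReal R := by
              gcongr
              refine (MeasureTheory.Measure.restrict_apply_le _ _).trans ?_
              rw [Real.volume_Ioo, sub_zero]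
          _ = _ := by
              rw [← ENNReal.ofReal_mul (by positivity)]
              congr 1
              ring

theorem integrable_smul_of_continuousOn_tsupport {U : Set ℂ} (hU : IsOpen U) {u : ℂ → ℝ}
    (hu : ContinuousOn u U) {g : ℂ → ℂ} (hg : Continuous g) (hgc : HasCompactSupport g)
    (hgU : tsupport g ⊆ U) : MeasureTheory.Integrable fun z => u z • g z := by
  have hc : Continuous fun z => u z • g z := by
    apply continuous_of_tsupport
    intro z hz
    have hsub : Function.support (fun z => u z • g z) ⊆ Function.support g :=
      fun w hw hg0 => hw (by simp [hg0])
    have hzU : z ∈ U := hgU (closure_mono hsub hz)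
    exact ((hu z hzU).continuousAt (hU.mem_nhds hzU)).smul hg.continuousAt
  have hcs : HasCompactSupport fun z => u z • g z := hgc.mono fun w hw hg0 => hw (by simp [hg0])
  exact hc.integrable_of_hasCompactSupport hcs

theorem tsupport_lineDeriv_subset {f f' : ℂ → ℂ} {v : ℂ}
    (hf : ∀ z, HasLineDerivAt ℝ f (f' z) z v) : tsupport f' ⊆ tsupport f := by
  apply closure_minimal _ (isClosed_tsupport f)
  intro z hz
  by_contra hzt
  apply hz
  have h0 : f =ᶠ[nhds z] fun _ => 0 := notMem_tsupport_iff_eventuallyEq.1 hzt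
  have h1 : HasLineDerivAt ℝ f 0 z v :=
    HasLineDerivAt.congr_of_eventuallyEq (by simpa [HasLineDerivAt] using hasDerivAt_const _ _) h0
  exact (hf z).unique h1

theorem integral_smul_second_lineDeriv {U : Set ℂ} (hU : IsOpen U) {u u1 u2 : ℂ → ℝ}
    (hu : ContinuousOn u U) (hu1 : ContinuousOn u1 U) (hu2 : ContinuousOn u2 U) {v : ℂ}
    (hd : ∀ z ∈ U, HasLineDerivAt ℝ u (u1 z) z v)
    (hd1 : ∀ z ∈ U, HasLineDerivAt ℝ u1 (u2 z) z v)
    {g g1 g2 : ℂ → ℂ} (hg : Continuous g) (hg1 : Continuous g1) (hg2 : Continuous g2)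
    (hgd : ∀ z, HasLineDerivAt ℝ g (g1 z) z v) (hgd1 : ∀ z, HasLineDerivAt ℝ g1 (g2 z) z v)
    (hc : HasCompactSupport g) (hgU : tsupport g ⊆ U) :
    ∫ z, u z • g2 z = ∫ z, u2 z • g z := by
  have hs1 := tsupport_lineDeriv_subset hgd
  have hs2 := tsupport_lineDeriv_subset hgd1
  have hc1 : HasCompactSupport g1 := hc.of_isClosed_subset (isClosed_tsupport _) hs1
  have hc2 : HasCompactSupport g2 := hc1.of_isClosed_subset (isClosed_tsupport _) hs2
  have e1 := integral_bilinear_hasLineDerivAt_right_eq_neg_left_of_integrable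
    (μ := MeasureTheory.volume) (B := ContinuousLinearMap.lsmul ℝ ℝ) (f := u) (f' := u1)
    (g := g1) (g' := g2) (v := v)
    (integrable_smul_of_continuousOn_tsupport hU hu1 hg1 hc1 (hs1.trans hgU))
    (integrable_smul_of_continuousOn_tsupport hU hu hg2 hc2 (hs2.trans (hs1.trans hgU)))
    (integrable_smul_of_continuousOn_tsupport hU hu hg1 hc1 (hs1.trans hgU))
    (fun z hz => hd z (hgU (hs1 hz))) (fun z _ => hgd1 z)
  have e2 := integral_bilinear_hasLineDerivAt_right_eq_neg_left_of_integrable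
    (μ := MeasureTheory.volume) (B := ContinuousLinearMap.lsmul ℝ ℝ) (f := u1) (f' := u2)
    (g := g) (g' := g1) (v := v)
    (integrable_smul_of_continuousOn_tsupport hU hu2 hg hc hgU)
    (integrable_smul_of_continuousOn_tsupport hU hu1 hg1 hc1 (hs1.trans hgU))
    (integrable_smul_of_continuousOn_tsupport hU hu1 hg hc hgU)
    (fun z hz => hd1 z (hgU hz)) (fun z _ => hgd z)
  simp only [ContinuousLinearMap.lsmul_apply] at e1 e2
  rw [e1, e2, neg_neg]

/-- Continuous functions on `ℂ = ℝ²` that are the iterated partial derivatives of `Ψ`. -/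
structure HasPartials (Ψ Ψx Ψxx Ψy Ψyy : ℂ → ℂ) : Prop where
  cont : Continuous Ψ
  cont_x : Continuous Ψx
  cont_xx : Continuous Ψxx
  cont_y : Continuous Ψy
  cont_yy : Continuous Ψyy
  deriv_x : ∀ z, HasLineDerivAt ℝ Ψ (Ψx z) z 1
  deriv_xx : ∀ z, HasLineDerivAt ℝ Ψx (Ψxx z) z 1
  deriv_y : ∀ z, HasLineDerivAt ℝ Ψ (Ψy z) z Complex.I
  deriv_yy : ∀ z, HasLineDerivAt ℝ Ψy (Ψyy z) z Complex.I

theorem HasPartials.mul {Ψ Ψx Ψxx Ψy Ψyy Θ Θx Θxx Θy Θyy : ℂ → ℂ}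
    (h : HasPartials Ψ Ψx Ψxx Ψy Ψyy) (k : HasPartials Θ Θx Θxx Θy Θyy) :
    HasPartials (fun z => Ψ z * Θ z) (fun z => Ψx z * Θ z + Ψ z * Θx z)
      (fun z => Ψxx z * Θ z + 2 * (Ψx z * Θx z) + Ψ z * Θxx z)
      (fun z => Ψy z * Θ z + Ψ z * Θy z)
      (fun z => Ψyy z * Θ z + 2 * (Ψy z * Θy z) + Ψ z * Θyy z) := by
  obtain ⟨a1, a2, a3, a4, a5, a6, a7, a8, a9⟩ := h
  obtain ⟨b1, b2, b3, b4, b5, b6, b7, b8, b9⟩ := k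
  refine ⟨by fun_prop, by fun_prop, by fun_prop, by fun_prop, by fun_prop, ?_, ?_, ?_, ?_⟩
  · intro z
    have := HasDerivAt.mul (a6 z) (b6 z)
    simpa [HasLineDerivAt, Pi.mul_def] using this
  · intro z
    have := (HasDerivAt.mul (a7 z) (b6 z)).add (HasDerivAt.mul (a6 z) (b7 z))
    simp only [zero_smul, add_zero] at this
    rw [HasLineDerivAt]
    convert! this using 1
    ring
  · intro z
    have := HasDerivAt.mul (a8 z) (b8 z)
    simpa [HasLineDerivAt, Pi.mul_def] using this
  · intro z
    have := (HasDerivAt.mul (a9 z) (b8 z)).add (HasDerivAt.mul (a8 z) (b9 z))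
    simp only [zero_smul, add_zero] at this
    rw [HasLineDerivAt]
    convert! this using 1
    ring

theorem hasPartials_re {f f' f'' : ℝ → ℂ} (h : ∀ t, HasDerivAt f (f' t) t)
    (h' : ∀ t, HasDerivAt f' (f'' t) t) (hc : Continuous f'') :
    HasPartials (fun z => f z.re) (fun z => f' z.re) (fun z => f'' z.re) (fun _ => 0)
      (fun _ => 0) := by
  have c0 : Continuous f := continuous_iff_continuousAt.2 fun t => (h t).continuousAt
  have c1 : Continuous f' := continuous_iff_continuousAt.2 fun t => (h' t).continuousAt
  have key : ∀ z : ℂ, HasDerivAt (fun t : ℝ => (z + t • (1 : ℂ)).re) 1 0 := fun z => by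
    simpa using (hasDerivAt_id (0 : ℝ)).const_add z.re
  refine ⟨by fun_prop, by fun_prop, by fun_prop, by fun_prop, by fun_prop, ?_, ?_, ?_, ?_⟩
  · intro z
    simpa [HasLineDerivAt, Function.comp_def] using (h (z + (0 : ℝ) • (1 : ℂ)).re).scomp (0 : ℝ) (key z)
  · intro z
    simpa [HasLineDerivAt, Function.comp_def] using (h' (z + (0 : ℝ) • (1 : ℂ)).re).scomp (0 : ℝ) (key z)
  · intro z
    simpa [HasLineDerivAt] using hasDerivAt_const (0 : ℝ) (f z.re)
  · intro z
    simpa [HasLineDerivAt] using hasDerivAt_const (0 : ℝ) (0 : ℂ)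

theorem hasPartials_im {f f' f'' : ℝ → ℂ} (h : ∀ t, HasDerivAt f (f' t) t)
    (h' : ∀ t, HasDerivAt f' (f'' t) t) (hc : Continuous f'') :
    HasPartials (fun z => f z.im) (fun _ => 0) (fun _ => 0) (fun z => f' z.im)
      (fun z => f'' z.im) := by
  have c0 : Continuous f := continuous_iff_continuousAt.2 fun t => (h t).continuousAt
  have c1 : Continuous f' := continuous_iff_continuousAt.2 fun t => (h' t).continuousAt
  have key : ∀ z : ℂ, HasDerivAt (fun t : ℝ => (z + t • Complex.I).im) 1 0 := fun z => by
    simpa using (hasDerivAt_id (0 : ℝ)).const_add z.im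
  refine ⟨by fun_prop, by fun_prop, by fun_prop, by fun_prop, by fun_prop, ?_, ?_, ?_, ?_⟩
  · intro z
    simpa [HasLineDerivAt] using hasDerivAt_const (0 : ℝ) (f z.im)
  · intro z
    simpa [HasLineDerivAt] using hasDerivAt_const (0 : ℝ) (0 : ℂ)
  · intro z
    simpa [HasLineDerivAt, Function.comp_def] using (h (z + (0 : ℝ) • Complex.I).im).scomp (0 : ℝ) (key z)
  · intro z
    simpa [HasLineDerivAt, Function.comp_def] using (h' (z + (0 : ℝ) • Complex.I).im).scomp (0 : ℝ) (key z)

theorem hasLineDerivAt_of_hasDerivAt {f : ℂ → ℂ} {f' z : ℂ} (h : HasDerivAt f f' z) (v : ℂ) :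
    HasLineDerivAt ℝ f (v * f') z v := by
  have h1 : HasDerivAt (fun t : ℝ => z + t • v) v 0 := by
    simpa using ((hasDerivAt_id (0 : ℝ)).smul_const v).const_add z
  have h2 : HasDerivAt f f' (z + (0 : ℝ) • v) := by simpa using h
  simpa [HasLineDerivAt, Function.comp_def] using h2.scomp (0 : ℝ) h1

theorem hasPartials_of_hasDerivAt {f f' f'' : ℂ → ℂ} (h : ∀ z, HasDerivAt f (f' z) z)
    (h' : ∀ z, HasDerivAt f' (f'' z) z) (hc : Continuous f'') :
    HasPartials f f' f'' (fun z => Complex.I * f' z) (fun z => -f'' z) := by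
  have c0 : Continuous f := continuous_iff_continuousAt.2 fun t => (h t).continuousAt
  have c1 : Continuous f' := continuous_iff_continuousAt.2 fun t => (h' t).continuousAt
  refine ⟨by fun_prop, by fun_prop, by fun_prop, by fun_prop, by fun_prop, ?_, ?_, ?_, ?_⟩
  · intro z
    simpa using hasLineDerivAt_of_hasDerivAt (h z) 1
  · intro z
    simpa using hasLineDerivAt_of_hasDerivAt (h' z) 1
  · intro z
    exact hasLineDerivAt_of_hasDerivAt (h z) Complex.I
  · intro z
    convert hasLineDerivAt_of_hasDerivAt ((h' z).const_mul Complex.I) Complex.I using 1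
    rw [← mul_assoc, Complex.I_mul_I]
    ring

theorem integral_smul_laplacian {U : Set ℂ} (hU : IsOpen U) {u ux uxx uy uyy : ℂ → ℝ}
    (hu : ContinuousOn u U) (hux : ContinuousOn ux U) (huxx : ContinuousOn uxx U)
    (huy : ContinuousOn uy U) (huyy : ContinuousOn uyy U)
    (hdx : ∀ z ∈ U, HasLineDerivAt ℝ u (ux z) z 1)
    (hdxx : ∀ z ∈ U, HasLineDerivAt ℝ ux (uxx z) z 1)
    (hdy : ∀ z ∈ U, HasLineDerivAt ℝ u (uy z) z Complex.I)
    (hdyy : ∀ z ∈ U, HasLineDerivAt ℝ uy (uyy z) z Complex.I)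
    {Ψ Ψx Ψxx Ψy Ψyy : ℂ → ℂ} (h : HasPartials Ψ Ψx Ψxx Ψy Ψyy)
    (hc : HasCompactSupport Ψ) (hgU : tsupport Ψ ⊆ U) :
    ∫ z, u z • (Ψxx z + Ψyy z) = ∫ z, (uxx z + uyy z) • Ψ z := by
  have hsx := (tsupport_lineDeriv_subset h.deriv_xx).trans (tsupport_lineDeriv_subset h.deriv_x)
  have hsy := (tsupport_lineDeriv_subset h.deriv_yy).trans (tsupport_lineDeriv_subset h.deriv_y)
  have hcx : HasCompactSupport Ψxx := hc.of_isClosed_subset (isClosed_tsupport _) hsx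
  have hcy : HasCompactSupport Ψyy := hc.of_isClosed_subset (isClosed_tsupport _) hsy
  simp only [smul_add, add_smul]
  rw [MeasureTheory.integral_add
    (integrable_smul_of_continuousOn_tsupport hU hu h.cont_xx hcx (hsx.trans hgU))
    (integrable_smul_of_continuousOn_tsupport hU hu h.cont_yy hcy (hsy.trans hgU)),
    MeasureTheory.integral_add
    (integrable_smul_of_continuousOn_tsupport hU huxx h.cont hc hgU)
    (integrable_smul_of_continuousOn_tsupport hU huyy h.cont hc hgU),
    integral_smul_second_lineDeriv hU hu hux huxx hdx hdxx h.cont h.cont_x h.cont_xx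
      h.deriv_x h.deriv_xx hc hgU,
    integral_smul_second_lineDeriv hU hu huy huyy hdy hdyy h.cont h.cont_y h.cont_yy
      h.deriv_y h.deriv_yy hc hgU]

theorem hasLineDerivAt_log_norm {G : ℂ → ℂ} {z : ℂ} (hG : DifferentiableAt ℂ G z)
    (h0 : G z ≠ 0) (v : ℂ) :
    HasLineDerivAt ℝ (fun w => Real.log ‖G w‖) (v * (deriv G z / G z)).re z v := by
  have h1 : HasDerivAt (fun t : ℝ => G (z + t • v)) (v * deriv G z) 0 := by
    have := hasLineDerivAt_of_hasDerivAt hG.hasDerivAt v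
    exact this
  have h2 : HasDerivAt (fun t : ℝ => ‖G (z + t • v)‖ ^ 2)
      (2 * (inner ℝ (G z) (v * deriv G z))) 0 := by
    simpa using h1.norm_sq
  have h3 := (h2.log (by simpa using h0)).const_mul (1 / 2)
  simp only [Real.log_pow, zero_smul, add_zero] at h3
  rw [HasLineDerivAt]
  convert! h3 using 1
  · ext t; push_cast; ring
  · have hn : Complex.normSq (G z) ≠ 0 := by simpa using h0
    rw [← Complex.normSq_eq_norm_sq, Complex.inner, ← mul_div_assoc, Complex.div_re,
      Complex.mul_re]
    simp only [Complex.mul_re, Complex.mul_im, Complex.conj_re, Complex.conj_im]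
    field_simp
    ring

theorem integral_log_norm_laplacian_eq_zero {U : Set ℂ} (hU : IsOpen U) {G : ℂ → ℂ}
    (hG : DifferentiableOn ℂ G U) (h0 : ∀ z ∈ U, G z ≠ 0)
    {Ψ Ψx Ψxx Ψy Ψyy : ℂ → ℂ} (h : HasPartials Ψ Ψx Ψxx Ψy Ψyy)
    (hc : HasCompactSupport Ψ) (hgU : tsupport Ψ ⊆ U) :
    ∫ z, Real.log ‖G z‖ • (Ψxx z + Ψyy z) = 0 := by
  have hG' := hG.deriv hU
  have hq : DifferentiableOn ℂ (fun z => deriv G z / G z) U := hG'.div hG h0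
  have hq' := hq.deriv hU
  have hre : ∀ z ∈ U, ∀ v : ℂ, HasLineDerivAt ℝ (fun z => (v * (deriv G z / G z)).re)
      (v * (v * deriv (fun z => deriv G z / G z) z)).re z v := by
    intro z hz v
    have h1 := hasLineDerivAt_of_hasDerivAt
      (((hq.differentiableAt (hU.mem_nhds hz)).hasDerivAt).const_mul v) v
    have := Complex.reCLM.hasFDerivAt.comp_hasDerivAt (0:ℝ) h1
    simpa [HasLineDerivAt, Function.comp_def] using this
  have hcu : ContinuousOn (fun z => Real.log ‖G z‖) U :=
    hG.continuousOn.norm.log fun z hz => by simpa using h0 z hz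
  have hcre : ∀ v : ℂ, ContinuousOn (fun z => (v * (deriv G z / G z)).re) U := fun v =>
    Complex.continuous_re.comp_continuousOn (continuousOn_const.mul hq.continuousOn)
  have hcre' : ∀ v : ℂ, ContinuousOn
      (fun z => (v * (v * deriv (fun z => deriv G z / G z) z)).re) U := fun v =>
    Complex.continuous_re.comp_continuousOn
      (continuousOn_const.mul (continuousOn_const.mul hq'.continuousOn))
  rw [integral_smul_laplacian hU hcu (hcre 1) (hcre' 1) (hcre Complex.I) (hcre' Complex.I)
    (fun z hz => hasLineDerivAt_log_norm (hG.differentiableAt (hU.mem_nhds hz)) (h0 z hz) 1)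
    (fun z hz => hre z hz 1)
    (fun z hz => hasLineDerivAt_log_norm (hG.differentiableAt (hU.mem_nhds hz)) (h0 z hz) _)
    (fun z hz => hre z hz Complex.I) h hc hgU]
  convert MeasureTheory.integral_zero ℂ ℂ using 2
  ext z
  rw [← mul_assoc Complex.I, Complex.I_mul_I]
  simp

theorem locallyIntegrable_log_norm {f : ℂ → ℂ} (hf : Differentiable ℂ f) (h0 : ∃ c, f c ≠ 0) :
    MeasureTheory.LocallyIntegrable (fun z => Real.log ‖f z‖) := by
  obtain ⟨c, hc⟩ := h0
  intro z
  set R := dist z c + 1 with hR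
  have hRpos : 0 < R := by positivity
  obtain ⟨B, hB⟩ := (isCompact_closedBall c R).exists_bound_of_continuousOn
    hf.continuous.continuousOn
  have hB0 : 0 ≤ B := (norm_nonneg _).trans (hB c (Metric.mem_closedBall_self hRpos.le))
  have hM : ∀ w ∈ Metric.ball c R, Real.log ‖f w‖ ≤ B := fun w hw => by
    have h1 := hB w (Metric.ball_subset_closedBall hw)
    exact (Real.log_le_self (norm_nonneg _)).trans h1
  have hl := lintegral_ball_log_norm_le hRpos hf hc hB0 hM
  refine ⟨Metric.ball c R, Metric.isOpen_ball.mem_nhds (by rw [Metric.mem_ball, hR]; linarith), ?_⟩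
  refine ⟨(measurable_log_norm hf).aestronglyMeasurable, ?_⟩
  exact hl.trans_lt ENNReal.ofReal_lt_top

theorem integral_two_div_one_add_norm_sq_sq :
    ∫ w : ℂ, 2 / (1 + ‖w‖ ^ 2) ^ 2 = 2 * Real.pi := by
  rw [← Complex.integral_comp_polarCoord_symm, polarCoord_target,
    MeasureTheory.Measure.volume_eq_prod]
  have h1 : ∀ p ∈ Set.Ioi (0:ℝ) ×ˢ Set.Ioo (-Real.pi) Real.pi,
      p.1 • (2 / (1 + ‖Complex.polarCoord.symm p‖ ^ 2) ^ 2) =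
        (2 * p.1 / (1 + p.1 ^ 2) ^ 2) * 1 := by
    intro p hp
    rw [Complex.norm_polarCoord_symm, sq_abs, smul_eq_mul]
    ring
  rw [MeasureTheory.setIntegral_congr_fun (by measurability) h1,
    MeasureTheory.setIntegral_prod_mul (fun r : ℝ => 2 * r / (1 + r ^ 2) ^ 2) (fun _ => (1:ℝ))]
  have h2 : ∫ r in Set.Ioi (0:ℝ), 2 * r / (1 + r ^ 2) ^ 2 = 1 := by
    have hd : ∀ r ∈ Set.Ici (0:ℝ), HasDerivAt (fun r : ℝ => -(1 + r ^ 2)⁻¹)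
        (2 * r / (1 + r ^ 2) ^ 2) r := by
      intro r _
      have := (((hasDerivAt_pow 2 r).const_add 1).inv (by positivity : (1 + r ^ 2) ≠ 0)).neg
      convert! this using 1
      push_cast
      ring
    rw [MeasureTheory.integral_Ioi_of_hasDerivAt_of_nonneg' (l := 0) hd
      (fun r hr => by rw [Set.mem_Ioi] at hr; positivity)]
    · norm_num
    · rw [← neg_zero]
      refine Filter.Tendsto.neg ?_
      refine Filter.Tendsto.inv_tendsto_atTop ?_
      exact Filter.tendsto_atTop_add_const_left _ _ (Filter.tendsto_pow_atTop (by norm_num))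
  rw [h2]
  simp
  rw [max_eq_left (by positivity)]
  ring

theorem integrable_two_div_one_add_norm_sq_sq :
    MeasureTheory.Integrable fun w : ℂ => 2 / (1 + ‖w‖ ^ 2) ^ 2 := by
  by_contra h
  have := MeasureTheory.integral_undef h
  rw [integral_two_div_one_add_norm_sq_sq] at this
  linarith [Real.pi_pos]

theorem integral_regularized_log_laplacian {ρ : ℂ} {ε : ℝ} (hε : 0 < ε)
    {Ψ Ψx Ψxx Ψy Ψyy : ℂ → ℂ} (h : HasPartials Ψ Ψx Ψxx Ψy Ψyy) (hc : HasCompactSupport Ψ) :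
    ∫ z, (Real.log (‖z - ρ‖ ^ 2 + ε ^ 2) / 2) • (Ψxx z + Ψyy z) =
      ∫ w : ℂ, (2 / (1 + ‖w‖ ^ 2) ^ 2) • Ψ (ρ + ε • w) := by
  have hNpos : ∀ z : ℂ, 0 < ‖z - ρ‖ ^ 2 + ε ^ 2 := fun z => by positivity
  have hN : ∀ z : ℂ, ‖z - ρ‖ ^ 2 = (z.re - ρ.re) ^ 2 + (z.im - ρ.im) ^ 2 := fun z => by
    rw [← Complex.normSq_eq_norm_sq, Complex.normSq_apply]; simp; ring
  have hcN : Continuous fun z : ℂ => ‖z - ρ‖ ^ 2 + ε ^ 2 := by fun_prop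
  have kx : ∀ z : ℂ, HasDerivAt (fun t : ℝ => ‖z + t • (1:ℂ) - ρ‖ ^ 2 + ε ^ 2)
      (2 * (z.re - ρ.re)) 0 := fun z => by
    have := (((hasDerivAt_id (0 : ℝ)).const_add (z.re - ρ.re)).pow 2).add_const
      ((z.im - ρ.im) ^ 2 + ε ^ 2)
    convert! this using 1
    · ext t; rw [hN]; simp; ring
    · simp
  have ky : ∀ z : ℂ, HasDerivAt (fun t : ℝ => ‖z + t • Complex.I - ρ‖ ^ 2 + ε ^ 2)
      (2 * (z.im - ρ.im)) 0 := fun z => by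
    have := (((hasDerivAt_id (0 : ℝ)).const_add (z.im - ρ.im)).pow 2).add_const
      ((z.re - ρ.re) ^ 2 + ε ^ 2)
    convert! this using 1
    · ext t; rw [hN]; simp; ring
    · simp
  have kx1 : ∀ z : ℂ, HasDerivAt (fun t : ℝ => (z + t • (1:ℂ)).re - ρ.re) 1 0 := fun z => by
    simpa using ((hasDerivAt_id (0 : ℝ)).const_add z.re).sub_const ρ.re
  have ky1 : ∀ z : ℂ, HasDerivAt (fun t : ℝ => (z + t • Complex.I).im - ρ.im) 1 0 := fun z => by
    simpa using ((hasDerivAt_id (0 : ℝ)).const_add z.im).sub_const ρ.im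
  have hN' : ∀ z : ℂ, (z.re - ρ.re) ^ 2 + (z.im - ρ.im) ^ 2 + ε ^ 2 ≠ 0 := fun z => by
    rw [← hN]; exact (hNpos z).ne'
  rw [integral_smul_laplacian (U := Set.univ) isOpen_univ
    (u := fun z => Real.log (‖z - ρ‖ ^ 2 + ε ^ 2) / 2)
    (ux := fun z => (z.re - ρ.re) / (‖z - ρ‖ ^ 2 + ε ^ 2))
    (uxx := fun z => (‖z - ρ‖ ^ 2 + ε ^ 2 - 2 * (z.re - ρ.re) ^ 2) / (‖z - ρ‖ ^ 2 + ε ^ 2) ^ 2)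
    (uy := fun z => (z.im - ρ.im) / (‖z - ρ‖ ^ 2 + ε ^ 2))
    (uyy := fun z => (‖z - ρ‖ ^ 2 + ε ^ 2 - 2 * (z.im - ρ.im) ^ 2) / (‖z - ρ‖ ^ 2 + ε ^ 2) ^ 2)
    _ _ _ _ _ _ _ _ _ h hc (Set.subset_univ _)]
  · have e1 : ∀ z : ℂ, ((‖z - ρ‖ ^ 2 + ε ^ 2 - 2 * (z.re - ρ.re) ^ 2) /
        (‖z - ρ‖ ^ 2 + ε ^ 2) ^ 2 + (‖z - ρ‖ ^ 2 + ε ^ 2 - 2 * (z.im - ρ.im) ^ 2) /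
        (‖z - ρ‖ ^ 2 + ε ^ 2) ^ 2) = 2 * ε ^ 2 / (‖z - ρ‖ ^ 2 + ε ^ 2) ^ 2 := fun z => by
      rw [hN]; ring
    simp_rw [e1]
    rw [← MeasureTheory.integral_add_left_eq_self _ ρ]
    have hs := MeasureTheory.Measure.integral_comp_smul
      (μ := (MeasureTheory.volume : MeasureTheory.Measure ℂ))
      (fun z : ℂ => (2 * ε ^ 2 / (‖ρ + z - ρ‖ ^ 2 + ε ^ 2) ^ 2) • Ψ (ρ + z)) ε
    rw [Complex.finrank_real_complex, abs_of_pos (by positivity),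
      eq_inv_smul_iff₀ (by positivity)] at hs
    rw [← hs, ← MeasureTheory.integral_smul]
    congr 1
    ext w
    rw [smul_smul, add_sub_cancel_left, norm_smul, Real.norm_of_nonneg hε.le]
    congr 1
    field_simp
    ring
  · exact (hcN.log fun z => (hNpos z).ne').continuousOn.div_const _
  · exact ((Continuous.div (by fun_prop) hcN fun z => (hNpos z).ne')).continuousOn
  · exact ((Continuous.div (by fun_prop) (hcN.pow 2) fun z => (pow_pos (hNpos z) 2).ne')).continuousOn
  · exact ((Continuous.div (by fun_prop) hcN fun z => (hNpos z).ne')).continuousOn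
  · exact ((Continuous.div (by fun_prop) (hcN.pow 2) fun z => (pow_pos (hNpos z) 2).ne')).continuousOn
  · intro z _
    have := ((kx z).log (by simpa using (hNpos z).ne')).div_const 2
    rw [HasLineDerivAt]
    convert! this using 1
    simp only [zero_smul, add_zero]
    have := hNpos z
    field_simp
  · intro z _
    have := (kx1 z).div (kx z) (by simpa using (hNpos z).ne')
    rw [HasLineDerivAt]
    convert! this using 1
    simp only [zero_smul, add_zero]
    ring
  · intro z _
    have := ((ky z).log (by simpa using (hNpos z).ne')).div_const 2
    rw [HasLineDerivAt]
    convert! this using 1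
    simp only [zero_smul, add_zero]
    have := hNpos z
    field_simp
  · intro z _
    have := (ky1 z).div (ky z) (by simpa using (hNpos z).ne')
    rw [HasLineDerivAt]
    convert! this using 1
    simp only [zero_smul, add_zero]
    ring

theorem HasPartials.tsupport_laplacian_subset {Ψ Ψx Ψxx Ψy Ψyy : ℂ → ℂ}
    (h : HasPartials Ψ Ψx Ψxx Ψy Ψyy) : tsupport (fun z => Ψxx z + Ψyy z) ⊆ tsupport Ψ := by
  have hsx := (tsupport_lineDeriv_subset h.deriv_xx).trans (tsupport_lineDeriv_subset h.deriv_x)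
  have hsy := (tsupport_lineDeriv_subset h.deriv_yy).trans (tsupport_lineDeriv_subset h.deriv_y)
  refine closure_minimal (fun z hz => ?_) (isClosed_tsupport _)
  by_contra hzt
  apply hz
  have e1 : Ψxx z = 0 := image_eq_zero_of_notMem_tsupport fun h => hzt (hsx h)
  have e2 : Ψyy z = 0 := image_eq_zero_of_notMem_tsupport fun h => hzt (hsy h)
  simp [e1, e2]

theorem integral_log_norm_sub_laplacian (ρ : ℂ) {Ψ Ψx Ψxx Ψy Ψyy : ℂ → ℂ}
    (h : HasPartials Ψ Ψx Ψxx Ψy Ψyy) (hc : HasCompactSupport Ψ) :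
    ∫ z, Real.log ‖z - ρ‖ • (Ψxx z + Ψyy z) = (2 * Real.pi) • Ψ ρ := by
  have hcΔ : HasCompactSupport fun z => Ψxx z + Ψyy z :=
    hc.of_isClosed_subset (isClosed_tsupport _) h.tsupport_laplacian_subset
  have hΔ : Continuous fun z => Ψxx z + Ψyy z := h.cont_xx.add h.cont_yy
  have hli : MeasureTheory.LocallyIntegrable (fun z : ℂ => Real.log ‖z - ρ‖) :=
    locallyIntegrable_log_norm (by fun_prop) ⟨ρ + 1, by simp⟩
  have hli2 : MeasureTheory.LocallyIntegrable
      (fun z : ℂ => ‖Real.log ‖z - ρ‖‖ + Real.log (‖z - ρ‖ ^ 2 + 1) / 2) := by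
    refine MeasureTheory.LocallyIntegrable.add (fun z => (hli z).norm)
      (Continuous.locallyIntegrable ?_)
    refine (Continuous.log (by fun_prop) fun z => ?_).div_const _
    positivity
  set ε : ℕ → ℝ := fun n => 1 / ((n : ℝ) + 1) with hε
  have hεpos : ∀ n, 0 < ε n := fun n => by simp only [hε]; positivity
  have hε1 : ∀ n, ε n ≤ 1 := fun n => by
    simp only [hε]; rw [div_le_one (by positivity)]; linarith [n.cast_nonneg (α := ℝ)]
  have hε0 : Filter.Tendsto ε Filter.atTop (nhds 0) := tendsto_one_div_add_atTop_nhds_zero_nat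
  have t1 : Filter.Tendsto (fun n => ∫ z, (Real.log (‖z - ρ‖ ^ 2 + ε n ^ 2) / 2) •
      (Ψxx z + Ψyy z)) Filter.atTop (nhds (∫ z, Real.log ‖z - ρ‖ • (Ψxx z + Ψyy z))) := by
    refine MeasureTheory.tendsto_integral_of_dominated_convergence
      (fun z => (‖Real.log ‖z - ρ‖‖ + Real.log (‖z - ρ‖ ^ 2 + 1) / 2) • ‖Ψxx z + Ψyy z‖)
      (fun n => ?_) (hli2.integrable_smul_right_of_hasCompactSupport hΔ.norm hcΔ.norm)
      (fun n => ?_) ?_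
    · refine Continuous.aestronglyMeasurable (Continuous.fun_smul ?_ hΔ)
      refine (Continuous.log (by fun_prop) fun z => ?_).div_const _
      have := hεpos n
      positivity
    · have hne : ∀ᵐ z : ℂ, z ≠ ρ := by
        simp [MeasureTheory.ae_iff]
      filter_upwards [hne] with z hz
      rw [norm_smul, smul_eq_mul]
      refine mul_le_mul_of_nonneg_right ?_ (norm_nonneg _)
      have hp : 0 < ‖z - ρ‖ := norm_pos_iff.2 (sub_ne_zero.2 hz)
      have l1 : Real.log ‖z - ρ‖ ≤ Real.log (‖z - ρ‖ ^ 2 + ε n ^ 2) / 2 := by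
        have : 2 * Real.log ‖z - ρ‖ = Real.log (‖z - ρ‖ ^ 2) := by rw [Real.log_pow]; norm_num
        have : Real.log (‖z - ρ‖ ^ 2) ≤ Real.log (‖z - ρ‖ ^ 2 + ε n ^ 2) :=
          Real.log_le_log (by positivity) (by nlinarith [hεpos n])
        linarith
      have l2 : Real.log (‖z - ρ‖ ^ 2 + ε n ^ 2) ≤ Real.log (‖z - ρ‖ ^ 2 + 1) :=
        Real.log_le_log (by have := hεpos n; positivity) (by nlinarith [hεpos n, hε1 n])
      have l3 : 0 ≤ Real.log (‖z - ρ‖ ^ 2 + 1) := Real.log_nonneg (by nlinarith)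
      rw [Real.norm_eq_abs, Real.norm_eq_abs, abs_le]
      constructor
      · linarith [neg_abs_le (Real.log ‖z - ρ‖)]
      · linarith [abs_nonneg (Real.log ‖z - ρ‖)]
    · have hne : ∀ᵐ z : ℂ, z ≠ ρ := by
        simp [MeasureTheory.ae_iff]
      filter_upwards [hne] with z hz
      have hp : 0 < ‖z - ρ‖ := norm_pos_iff.2 (sub_ne_zero.2 hz)
      refine Filter.Tendsto.smul_const ?_ _
      have : Filter.Tendsto (fun n => ‖z - ρ‖ ^ 2 + ε n ^ 2) Filter.atTop
          (nhds (‖z - ρ‖ ^ 2 + 0 ^ 2)) := (hε0.pow 2).const_add _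
      have := (this.log (by positivity)).div_const 2
      convert this using 2
      rw [zero_pow two_ne_zero, add_zero, Real.log_pow]
      push_cast
      ring
  have t2 : Filter.Tendsto (fun n => ∫ w : ℂ, (2 / (1 + ‖w‖ ^ 2) ^ 2) • Ψ (ρ + ε n • w))
      Filter.atTop (nhds (∫ w : ℂ, (2 / (1 + ‖w‖ ^ 2) ^ 2) • Ψ ρ)) := by
    obtain ⟨B, hB⟩ := h.cont.bounded_above_of_compact_support hc
    refine MeasureTheory.tendsto_integral_of_dominated_convergence
      (fun w => (2 / (1 + ‖w‖ ^ 2) ^ 2) * B) (fun n => ?_)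
      (integrable_two_div_one_add_norm_sq_sq.mul_const B) (fun n => ?_) ?_
    · refine Continuous.aestronglyMeasurable (Continuous.fun_smul ?_ ?_)
      · exact Continuous.div (by fun_prop) (by fun_prop) fun z => by positivity
      · exact h.cont.comp (by fun_prop)
    · refine Filter.Eventually.of_forall fun w => ?_
      rw [norm_smul, Real.norm_of_nonneg (by positivity)]
      exact mul_le_mul_of_nonneg_left (hB _) (by positivity)
    · refine Filter.Eventually.of_forall fun w => Filter.Tendsto.const_smul ?_ _
      have : Filter.Tendsto (fun n => ρ + ε n • w) Filter.atTop (nhds (ρ + (0:ℝ) • w)) :=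
        (hε0.smul_const w).const_add ρ
      rw [zero_smul, add_zero] at this
      exact (h.cont.tendsto ρ).comp this
  rw [integral_smul_const, integral_two_div_one_add_norm_sq_sq] at t2
  refine tendsto_nhds_unique t1 (t2.congr fun n => ?_)
  rw [integral_regularized_log_laplacian (hεpos n) h hc]

theorem analyticOrderAt_ne_top_of_differentiable {F : ℂ → ℂ} (hF : Differentiable ℂ F)
    (h0 : ∃ c, F c ≠ 0) (z : ℂ) : analyticOrderAt F z ≠ ⊤ := by
  obtain ⟨c, hc⟩ := h0
  intro htop
  rw [analyticOrderAt_eq_top] at htop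
  have hA : AnalyticOnNhd ℂ F Set.univ := fun z _ => hF.analyticAt z
  exact hc (hA.eqOn_zero_of_preconnected_of_eventuallyEq_zero isPreconnected_univ
    (Set.mem_univ z) htop (Set.mem_univ c))

theorem riesz_formula_compact {F : ℂ → ℂ} (hF : Differentiable ℂ F) (h0 : ∃ c, F c ≠ 0)
    {Ψ Ψx Ψxx Ψy Ψyy : ℂ → ℂ} (h : HasPartials Ψ Ψx Ψxx Ψy Ψyy) (hc : HasCompactSupport Ψ) :
    HasSum (fun u => (analyticOrderNatAt F u : ℂ) * Ψ u)
      ((2 * Real.pi)⁻¹ • ∫ z, Real.log ‖F z‖ • (Ψxx z + Ψyy z)) := by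
  have hcΔ : HasCompactSupport fun z => Ψxx z + Ψyy z :=
    hc.of_isClosed_subset (isClosed_tsupport _) h.tsupport_laplacian_subset
  have hΔ : Continuous fun z => Ψxx z + Ψyy z := h.cont_xx.add h.cont_yy
  obtain ⟨R, hR⟩ := hc.isBounded.subset_ball (0 : ℂ)
  set U := Metric.closedBall (0 : ℂ) R with hU
  have hA : AnalyticOnNhd ℂ F U := fun z _ => hF.analyticAt z
  have hord : ∀ u : U, meromorphicOrderAt F u ≠ ⊤ := fun u => by
    rw [(hF.analyticAt _).meromorphicOrderAt_eq]
    simpa using analyticOrderAt_ne_top_of_differentiable hF h0 u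
  have hfin := (MeromorphicOn.divisor F U).finiteSupport (isCompact_closedBall 0 R)
  obtain ⟨g, hg, hg0, hfg⟩ := hA.meromorphicOn.extract_zeros_poles hord hfin
  have hlog := MeromorphicOn.extract_zeros_poles_log hg0 hfg
  set E := MeromorphicOn.divisor F U with hE
  have hmeas : MeasurableSet U := (Metric.isClosed_closedBall).measurableSet
  have hae : ∀ᵐ z, z ∈ U → Real.log ‖F z‖ =
      ∑ u ∈ hfin.toFinset, (E u : ℝ) * Real.log ‖z - u‖ + Real.log ‖g z‖ := by
    rw [← MeasureTheory.ae_restrict_iff' hmeas]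
    have := ae_restrict_le_codiscreteWithin
      (μ := (MeasureTheory.volume : MeasureTheory.Measure ℂ)) hmeas hlog
    filter_upwards [this] with z hz
    refine hz.trans ?_
    rw [Pi.add_apply, finsum_eq_sum_of_support_subset (s := hfin.toFinset), Finset.sum_apply]
    intro u hu
    rw [Set.Finite.coe_toFinset]
    intro h0
    apply hu
    ext z
    simp [h0]
  have hsub := h.tsupport_laplacian_subset
  have hbU : Metric.ball (0:ℂ) R ⊆ U := Metric.ball_subset_closedBall
  have e1 : ∫ z, Real.log ‖F z‖ • (Ψxx z + Ψyy z) =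
      ∫ z, ((∑ u ∈ hfin.toFinset, (E u : ℝ) • (Real.log ‖z - u‖ • (Ψxx z + Ψyy z))) +
        Real.log ‖g z‖ • (Ψxx z + Ψyy z)) := by
    apply MeasureTheory.integral_congr_ae
    filter_upwards [hae] with z hz
    by_cases hzU : z ∈ U
    · rw [hz hzU, add_smul, Finset.sum_smul]
      simp only [smul_smul]
    · have : Ψxx z + Ψyy z = 0 :=
        image_eq_zero_of_notMem_tsupport (f := fun z => Ψxx z + Ψyy z)
          fun h => hzU (hbU (hR (hsub h)))
      simp [this]
  have hgU : DifferentiableOn ℂ g (Metric.ball 0 R) := fun z hz =>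
    (hg z (hbU hz)).differentiableAt.differentiableWithinAt
  have hg0U : ∀ z ∈ Metric.ball (0:ℂ) R, g z ≠ 0 := fun z hz => hg0 ⟨z, hbU hz⟩
  have hi : ∀ u : ℂ, MeasureTheory.Integrable fun z =>
      Real.log ‖z - u‖ • (Ψxx z + Ψyy z) := fun u =>
    (locallyIntegrable_log_norm (f := fun z => z - u) (by fun_prop)
      ⟨u + 1, by simp⟩).integrable_smul_right_of_hasCompactSupport hΔ hcΔ
  have hi' : ∀ u : ℂ, MeasureTheory.Integrable fun z =>
      (E u : ℝ) • (Real.log ‖z - u‖ • (Ψxx z + Ψyy z)) := fun u => (hi u).fun_smul _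
  rw [e1, MeasureTheory.integral_add (MeasureTheory.integrable_finsetSum _ fun u _ => hi' u)
    (integrable_smul_of_continuousOn_tsupport Metric.isOpen_ball
      (hgU.continuousOn.norm.log fun z hz => by simpa using hg0U z hz) hΔ hcΔ (hsub.trans hR)),
    integral_log_norm_laplacian_eq_zero Metric.isOpen_ball hgU hg0U h hc hR, add_zero,
    MeasureTheory.integral_finsetSum _ fun u _ => hi' u, Finset.smul_sum]
  have hordE : ∀ u ∈ U, E u = (analyticOrderNatAt F u : ℤ) := fun u huU => by
    rw [hE, MeromorphicOn.AnalyticOnNhd.divisor_apply hA huU, analyticOrderNatAt]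
    obtain ⟨n, hn⟩ := ENat.ne_top_iff_exists.1
      (analyticOrderAt_ne_top_of_differentiable hF h0 u)
    rw [← hn]
    rfl
  have hsum : HasSum (fun u => (analyticOrderNatAt F u : ℂ) * Ψ u)
      (∑ u ∈ hfin.toFinset, (analyticOrderNatAt F u : ℂ) * Ψ u) := by
    refine hasSum_sum_of_ne_finset_zero fun u hu => ?_
    by_contra hne
    have huU : u ∈ U := by
      by_contra hnU
      have : Ψ u = 0 := image_eq_zero_of_notMem_tsupport fun h => hnU (hbU (hR h))
      exact hne (by simp [this])
    apply hu
    rw [Set.Finite.mem_toFinset, Function.mem_support, hordE u huU]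
    intro h1
    exact hne (by simp [show analyticOrderNatAt F u = 0 by exact_mod_cast h1])
  convert hsum using 1
  refine Finset.sum_congr rfl fun u hu => ?_
  have huU : u ∈ U := by
    by_contra hne
    rw [Set.Finite.mem_toFinset] at hu
    exact hu (Function.locallyFinsuppWithin.apply_eq_zero_of_notMem _ hne)
  rw [MeasureTheory.integral_smul, integral_log_norm_sub_laplacian u h hc, smul_comm,
    inv_smul_smul₀ (by positivity), hordE u huU, Complex.real_smul]
  push_cast
  rfl

/-- `f`, with first two derivatives `f'`, `f''`, is a cutoff function that is `1` on
`[c - r, c + r]` and vanishes outside `[c - R, c + R]`. -/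
structure IsCutoff (c r R K : ℝ) (f f' f'' : ℝ → ℝ) : Prop where
  deriv1 : ∀ t, HasDerivAt f (f' t) t
  deriv2 : ∀ t, HasDerivAt f' (f'' t) t
  cont : Continuous f''
  nonneg : ∀ t, 0 ≤ f t
  le_one : ∀ t, f t ≤ 1
  eq_one : ∀ t, |t - c| ≤ r → f t = 1
  eq_zero : ∀ t, R < |t - c| → f t = 0 ∧ f' t = 0 ∧ f'' t = 0
  deriv_eq_zero : ∀ t, |t - c| < r → f' t = 0 ∧ f'' t = 0
  one_le : 1 ≤ K
  bound1 : ∀ t, |f' t| ≤ K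
  bound2 : ∀ t, |f'' t| ≤ K

theorem exists_isCutoff (c : ℝ) {r R : ℝ} (hr : 0 < r) (hrR : r < R) :
    ∃ K f f' f'', IsCutoff c r R K f f' f'' := by
  let b : ContDiffBump c := ⟨r, R, hr, hrR⟩
  have hb : ContDiff ℝ 2 b := b.contDiff
  have hb1 : ContDiff ℝ 1 (deriv b) := ContDiff.deriv' (by rw [one_add_one_eq_two]; exact hb)
  have hb0 : Continuous (deriv (deriv b)) := hb1.continuous_deriv le_rfl
  have hcs := b.hasCompactSupport
  obtain ⟨K1, hK1⟩ := hcs.deriv.exists_bound_of_continuous hb1.continuous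
  obtain ⟨K2, hK2⟩ := hcs.deriv.deriv.exists_bound_of_continuous hb0
  have hz : ∀ (f : ℝ → ℝ) (a : ℝ) (t : ℝ), f =ᶠ[nhds t] (fun _ => a) →
      deriv f t = 0 ∧ deriv (deriv f) t = 0 := by
    intro f a t h
    have h1 : deriv f =ᶠ[nhds t] fun _ => 0 := by
      have := h.deriv
      simpa using this
    refine ⟨h1.eq_of_nhds, ?_⟩
    have := h1.deriv.eq_of_nhds
    simpa using this
  refine ⟨max 1 (max K1 K2), b, deriv b, deriv (deriv b), ?_, ?_, hb0, fun t => b.nonneg,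
    fun t => b.le_one, ?_, ?_, ?_, le_max_left _ _, ?_, ?_⟩
  · exact fun t => ((hb.differentiable (by norm_num)) t).hasDerivAt
  · exact fun t => ((hb1.differentiable (by norm_num)) t).hasDerivAt
  · exact fun t ht => b.one_of_mem_closedBall (by simpa [Real.dist_eq] using ht)
  · intro t ht
    have hev : (b : ℝ → ℝ) =ᶠ[nhds t] fun _ => 0 := by
      have : {s : ℝ | R < |s - c|} ∈ nhds t :=
        (isOpen_lt continuous_const (by fun_prop)).mem_nhds ht
      filter_upwards [this] with s hs
      exact b.zero_of_le_dist (by rw [Real.dist_eq]; exact hs.le)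
    exact ⟨hev.eq_of_nhds, hz b 0 t hev⟩
  · intro t ht
    have hev : (b : ℝ → ℝ) =ᶠ[nhds t] fun _ => 1 := by
      have : {s : ℝ | |s - c| < r} ∈ nhds t :=
        (isOpen_lt (by fun_prop) continuous_const).mem_nhds ht
      filter_upwards [this] with s hs
      exact b.one_of_mem_closedBall (by rw [Metric.mem_closedBall, Real.dist_eq]; exact hs.le)
    exact hz b 1 t hev
  · exact fun t => (hK1 t).trans ((le_max_left _ _).trans (le_max_right _ _))
  · exact fun t => (hK2 t).trans ((le_max_right _ _).trans (le_max_right _ _))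

open scoped ComplexOrder in
theorem HasPartials.hasSum_of_summable {F : ℂ → ℂ} (hF : Differentiable ℂ F) (h0 : ∃ c, F c ≠ 0)
    {Ψ Ψx Ψxx Ψy Ψyy : ℂ → ℂ} (h : HasPartials Ψ Ψx Ψxx Ψy Ψyy) {B : ℂ → ℝ} {a : ℝ}
    (hB0 : ∀ z, ‖Ψ z‖ ≤ B z) (hB1 : ∀ z, ‖Ψy z‖ ≤ B z) (hB2 : ∀ z, ‖Ψxx z + Ψyy z‖ ≤ B z)
    (hI : MeasureTheory.Integrable fun z => Real.log ‖F z‖ * B z)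
    (ha : ∀ z, Ψ z ≠ 0 → |z.re| ≤ a)
    (hs : Summable (fun u => (analyticOrderNatAt F u : ℝ) * ‖Ψ u‖) ∨ ∀ z, 0 ≤ Ψ z) :
    HasSum (fun u => (analyticOrderNatAt F u : ℂ) * Ψ u)
      ((2 * Real.pi)⁻¹ • ∫ z, Real.log ‖F z‖ • (Ψxx z + Ψyy z)) := by
  obtain ⟨K, f, f', f'', hf⟩ := exists_isCutoff 0 one_pos one_lt_two
  have hK0 : 0 ≤ K := zero_le_one.trans hf.one_le
  set T : ℕ → ℝ := fun n => (n : ℝ) + 1 with hT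
  have hT1 : ∀ n, 1 ≤ T n := fun n => by simp [hT]
  have hT0 : ∀ n, 0 < T n := fun n => zero_lt_one.trans_le (hT1 n)
  have hTtop : Filter.Tendsto T Filter.atTop Filter.atTop :=
    Filter.tendsto_atTop_add_const_right _ _ tendsto_natCast_atTop_atTop
  have hcut : ∀ n, HasPartials (fun z => ((f (z.im / T n) : ℝ) : ℂ)) (fun _ => 0) (fun _ => 0)
      (fun z => ((f' (z.im / T n) / T n : ℝ) : ℂ))
      (fun z => ((f'' (z.im / T n) / T n / T n : ℝ) : ℂ)) := by
    intro n
    have hd : ∀ t : ℝ, HasDerivAt (fun t => t / T n) (1 / T n) t := fun t =>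
      (hasDerivAt_id t).div_const _
    refine hasPartials_im (f := fun t => ((f (t / T n) : ℝ) : ℂ))
      (f' := fun t => ((f' (t / T n) / T n : ℝ) : ℂ))
      (f'' := fun t => ((f'' (t / T n) / T n / T n : ℝ) : ℂ)) (fun t => ?_) (fun t => ?_) ?_
    · refine HasDerivAt.ofReal_comp ?_
      have := (hf.deriv1 (t / T n)).comp t (hd t)
      convert! this using 1
      ring
    · refine HasDerivAt.ofReal_comp ?_
      have := ((hf.deriv2 (t / T n)).comp t (hd t)).div_const (T n)
      convert! this using 1
      ring
    · have := hf.cont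
      fun_prop
  have hprod := fun n => h.mul (hcut n)
  have hcomp : ∀ n, HasCompactSupport (fun z => Ψ z * ((f (z.im / T n) : ℝ) : ℂ)) := by
    intro n
    refine HasCompactSupport.of_support_subset_isCompact
      (K := (Set.Icc (-a) a) ×ℂ (Set.Icc (-(2 * T n)) (2 * T n)))
      (isCompact_Icc.reProdIm isCompact_Icc) fun z hz => ?_
    rw [Function.mem_support] at hz
    rw [Complex.mem_reProdIm, Set.mem_Icc, Set.mem_Icc, ← abs_le, ← abs_le]
    refine ⟨ha z (left_ne_zero_of_mul hz), ?_⟩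
    by_contra hlt
    rw [not_le] at hlt
    apply right_ne_zero_of_mul hz
    have := (hf.eq_zero (z.im / T n) (by
      rw [sub_zero, abs_div, abs_of_pos (hT0 n), lt_div_iff₀ (hT0 n)]; exact hlt)).1
    simp [this]
  have hR := fun n => riesz_formula_compact hF h0 (hprod n) (hcomp n)
  have hev : ∀ z : ℂ, ∀ᶠ n in Filter.atTop, |z.im / T n| < 1 := by
    intro z
    filter_upwards [hTtop.eventually_gt_atTop |z.im|] with n hn
    rwa [abs_div, abs_of_pos (hT0 n), div_lt_one (hT0 n)]
  have lim1 : Filter.Tendsto (fun n => ∫ z, Real.log ‖F z‖ •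
      (Ψxx z * ((f (z.im / T n) : ℝ) : ℂ) + 2 * (Ψx z * 0) + Ψ z * 0 +
        (Ψyy z * ((f (z.im / T n) : ℝ) : ℂ) + 2 * (Ψy z * ((f' (z.im / T n) / T n : ℝ) : ℂ)) +
          Ψ z * ((f'' (z.im / T n) / T n / T n : ℝ) : ℂ)))) Filter.atTop
      (nhds (∫ z, Real.log ‖F z‖ • (Ψxx z + Ψyy z))) := by
    refine MeasureTheory.tendsto_integral_of_dominated_convergence
      (fun z => ‖Real.log ‖F z‖ * B z‖ * (4 * K)) (fun n => ?_) (hI.norm.mul_const _)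
      (fun n => ?_) ?_
    · refine MeasureTheory.AEStronglyMeasurable.fun_smul
        (measurable_log_norm hF).aestronglyMeasurable (Continuous.aestronglyMeasurable ?_)
      exact (hprod n).cont_xx.add (hprod n).cont_yy
    · refine Filter.Eventually.of_forall fun z => ?_
      have hBz : 0 ≤ B z := (norm_nonneg _).trans (hB0 z)
      rw [norm_smul, norm_mul, Real.norm_of_nonneg hBz, mul_assoc]
      refine mul_le_mul_of_nonneg_left ?_ (norm_nonneg _)
      have e : Ψxx z * ((f (z.im / T n) : ℝ) : ℂ) + 2 * (Ψx z * 0) + Ψ z * 0 +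
        (Ψyy z * ((f (z.im / T n) : ℝ) : ℂ) + 2 * (Ψy z * ((f' (z.im / T n) / T n : ℝ) : ℂ)) +
          Ψ z * ((f'' (z.im / T n) / T n / T n : ℝ) : ℂ)) =
          (Ψxx z + Ψyy z) * ((f (z.im / T n) : ℝ) : ℂ) +
          2 * (Ψy z * ((f' (z.im / T n) / T n : ℝ) : ℂ)) +
          Ψ z * ((f'' (z.im / T n) / T n / T n : ℝ) : ℂ) := by ring
      rw [e]
      have n1 : ‖((f (z.im / T n) : ℝ) : ℂ)‖ ≤ K := by
        rw [Complex.norm_real, Real.norm_of_nonneg (hf.nonneg _)]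
        exact (hf.le_one _).trans hf.one_le
      have n2 : ‖((f' (z.im / T n) / T n : ℝ) : ℂ)‖ ≤ K := by
        rw [Complex.norm_real, norm_div, Real.norm_of_nonneg (hT0 n).le]
        exact (div_le_self (norm_nonneg _) (hT1 n)).trans (hf.bound1 _)
      have n3 : ‖((f'' (z.im / T n) / T n / T n : ℝ) : ℂ)‖ ≤ K := by
        rw [Complex.norm_real, norm_div, norm_div, Real.norm_of_nonneg (hT0 n).le]
        exact (div_le_self (by have := hT0 n; positivity) (hT1 n)).trans
          ((div_le_self (norm_nonneg _) (hT1 n)).trans (hf.bound2 _))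
      calc _ ≤ ‖Ψxx z + Ψyy z‖ * ‖((f (z.im / T n) : ℝ) : ℂ)‖ +
            2 * (‖Ψy z‖ * ‖((f' (z.im / T n) / T n : ℝ) : ℂ)‖) +
            ‖Ψ z‖ * ‖((f'' (z.im / T n) / T n / T n : ℝ) : ℂ)‖ := by
            refine (norm_add₃_le).trans ?_
            simp only [norm_mul, RCLike.norm_ofNat]
            rfl
        _ ≤ B z * K + 2 * (B z * K) + B z * K := by
            have := hB0 z
            have := hB1 z
            have := hB2 z
            gcongr
        _ = _ := by ring
    · refine Filter.Eventually.of_forall fun z => ?_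
      refine tendsto_const_nhds.congr' ?_
      filter_upwards [hev z] with n hn
      have e1 := hf.eq_one (z.im / T n) (by rw [sub_zero]; exact hn.le)
      have e2 := hf.deriv_eq_zero (z.im / T n) (by rw [sub_zero]; exact hn)
      rw [e1, e2.1, e2.2]
      simp
  have lim1' := lim1.const_smul (2 * Real.pi)⁻¹
  have hsum : Summable (fun u => (analyticOrderNatAt F u : ℝ) * ‖Ψ u‖) := by
    rcases hs with hs | hs
    · exact hs
    · have hΨ : ∀ u, Ψ u = ((‖Ψ u‖ : ℝ) : ℂ) := fun u => Complex.eq_coe_norm_of_nonneg (hs u)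
      refine summable_of_sum_le (c := ((2 * Real.pi)⁻¹ • ∫ z, Real.log ‖F z‖ •
        (Ψxx z + Ψyy z)).re) (fun u => by positivity) fun A => ?_
      refine ge_of_tendsto ((Complex.continuous_re.tendsto _).comp lim1') ?_
      have hA : ∀ᶠ n in Filter.atTop, ∀ u ∈ A, |u.im / T n| < 1 :=
        (Filter.eventually_all_finset A).2 fun u _ => hev u
      filter_upwards [hA] with n hn
      have hre := Complex.hasSum_re (hR n)
      refine le_trans (le_of_eq ?_) (sum_le_hasSum A (fun u _ => ?_) hre)
      · refine Finset.sum_congr rfl fun u hu => ?_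
        rw [hf.eq_one (u.im / T n) (by rw [sub_zero]; exact (hn u hu).le), hΨ u]
        simp
      · have e : ((analyticOrderNatAt F u : ℂ) * (Ψ u * ((f (u.im / T n) : ℝ) : ℂ))) =
          (((analyticOrderNatAt F u : ℝ) * (‖Ψ u‖ * f (u.im / T n)) : ℝ) : ℂ) := by
          rw [hΨ u]; simp
        rw [e, Complex.ofReal_re]
        have := hf.nonneg (u.im / T n)
        positivity
  have hsum' : Summable (fun u => (analyticOrderNatAt F u : ℂ) * Ψ u) :=
    Summable.of_norm (by simpa using hsum)
  have lim2 : Filter.Tendsto (fun n => ∑' u, (analyticOrderNatAt F u : ℂ) *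
      (Ψ u * ((f (u.im / T n) : ℝ) : ℂ))) Filter.atTop
      (nhds (∑' u, (analyticOrderNatAt F u : ℂ) * Ψ u)) := by
    refine tendsto_tsum_of_dominated_convergence hsum (fun u => ?_)
      (Filter.Eventually.of_forall fun n u => ?_)
    · refine tendsto_const_nhds.congr' ?_
      filter_upwards [hev u] with n hn
      rw [hf.eq_one (u.im / T n) (by rw [sub_zero]; exact hn.le)]
      simp
    · rw [norm_mul, norm_mul, Complex.norm_real, Real.norm_of_nonneg (hf.nonneg _),
        Complex.norm_natCast]
      refine mul_le_mul_of_nonneg_left ?_ (by positivity)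
      exact mul_le_of_le_one_right (norm_nonneg _) (hf.le_one _)
  have := tendsto_nhds_unique lim1' (lim2.congr fun n => ((hR n).tsum_eq))
  rw [this]
  exact hsum'.hasSum

theorem summable_int_one_div_one_add_sq : Summable fun n : ℤ => 1 / (1 + (n : ℝ) ^ 2) := by
  have h := (Real.summable_one_div_int_pow (p := 2)).2 (by norm_num)
  refine (h.add (hasSum_ite_eq (0 : ℤ) (1:ℝ)).summable).of_nonneg_of_le
    (fun n => by positivity) fun n => ?_
  rcases eq_or_ne n 0 with rfl | hn
  · simp
  · simp only [hn, if_false, add_zero]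
    have : (0:ℝ) < (n:ℝ) ^ 2 := by positivity
    exact one_div_le_one_div_of_le this (by linarith)

theorem exists_bound_integral_strip_log_norm : ∃ C : ℝ, 0 < C ∧ ∀ (F : ℂ → ℂ) (Q : ℝ),
    Differentiable ℂ F → 0 ≤ Q →
    (∀ s : ℂ, -1 / 4 ≤ s.re → s.re ≤ 5 → Real.log ‖F s‖ ≤ Q * (1 + |s.im|)) →
    (∀ t : ℝ, F (2 + t * Complex.I) ≠ 0 ∧ -Q ≤ Real.log ‖F (2 + t * Complex.I)‖) →
    MeasureTheory.IntegrableOn (fun z : ℂ => Real.log ‖F z‖ * ((1 + z.im ^ 2) ^ 2)⁻¹)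
      {z : ℂ | -1 / 8 ≤ z.re ∧ z.re ≤ 3 / 2} ∧
    ∫ z in {z : ℂ | -1 / 8 ≤ z.re ∧ z.re ≤ 3 / 2},
      ‖Real.log ‖F z‖ * ((1 + z.im ^ 2) ^ 2)⁻¹‖ ≤ C * Q := by
  set k : ℝ := 9 * (81 / 16) * (2 * Real.pi) * 10 with hk
  have hkpos : 0 < k := by positivity
  refine ⟨k * ∑' n : ℤ, 1 / (1 + (n : ℝ) ^ 2),
    mul_pos hkpos (summable_int_one_div_one_add_sq.tsum_pos (fun n => by positivity) 0
      (by positivity)), fun F Q hF hQ hub hlb => ?_⟩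
  set S : Set ℂ := {z : ℂ | -1 / 8 ≤ z.re ∧ z.re ≤ 3 / 2} with hS
  set box : ℤ → Set ℂ := fun n => {z : ℂ | z ∈ S ∧ |z.im - n| ≤ 1 / 2} with hbox
  have hcover : S ⊆ ⋃ n, box n := fun z hz =>
    Set.mem_iUnion.2 ⟨round z.im, hz, abs_sub_round _⟩
  have hmeas : Measurable fun z : ℂ => Real.log ‖F z‖ * ((1 + z.im ^ 2) ^ 2)⁻¹ :=
    (measurable_log_norm hF).mul (by fun_prop)
  have hball : ∀ n : ℤ, box n ⊆ Metric.ball (2 + (n : ℝ) * Complex.I) (9 / 4) := by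
    rintro n z ⟨⟨h1, h2⟩, h3⟩
    rw [Metric.mem_ball, dist_eq_norm, ← sq_lt_sq₀ (norm_nonneg _) (by norm_num),
      ← Complex.normSq_eq_norm_sq, Complex.normSq_apply]
    simp only [Complex.sub_re, Complex.add_re, Complex.mul_re, Complex.sub_im, Complex.add_im,
      Complex.mul_im, Complex.ofReal_re, Complex.ofReal_im, Complex.I_re, Complex.I_im,
      Complex.re_ofNat, Complex.im_ofNat]
    rw [abs_le] at h3
    nlinarith
  have hterm : ∀ n : ℤ, ∫⁻ z in box n, ‖Real.log ‖F z‖ * ((1 + z.im ^ 2) ^ 2)⁻¹‖ₑ ≤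
      ENNReal.ofReal (k * Q * (1 / (1 + (n : ℝ) ^ 2))) := by
    intro n
    have hM : ∀ z ∈ Metric.ball (2 + (n : ℝ) * Complex.I : ℂ) (9 / 4),
        Real.log ‖F z‖ ≤ Q * (|(n:ℝ)| + 13 / 4) := by
      intro z hz
      rw [Metric.mem_ball, dist_eq_norm] at hz
      have hre := (Complex.abs_re_le_norm _).trans hz.le
      have him := (Complex.abs_im_le_norm _).trans hz.le
      simp only [Complex.sub_re, Complex.add_re, Complex.mul_re, Complex.sub_im, Complex.add_im,
        Complex.mul_im, Complex.ofReal_re, Complex.ofReal_im, Complex.I_re, Complex.I_im,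
        Complex.re_ofNat, Complex.im_ofNat] at hre him
      ring_nf at hre him
      rw [abs_le] at hre
      refine (hub z (by linarith) (by linarith)).trans ?_
      refine mul_le_mul_of_nonneg_left ?_ hQ
      have := abs_sub_abs_le_abs_sub z.im (n : ℝ)
      have e : |z.im - n| = |-(n:ℝ) + z.im| := by ring_nf
      rw [← e] at him
      linarith
    have hl := lintegral_ball_log_norm_le (by norm_num) hF (hlb n).1 (by positivity) hM
    have hw : ∀ z ∈ box n, ‖Real.log ‖F z‖ * ((1 + z.im ^ 2) ^ 2)⁻¹‖ₑ ≤
        ENNReal.ofReal (9 / (1 + (n:ℝ) ^ 2) ^ 2) * ‖Real.log ‖F z‖‖ₑ := by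
      rintro z ⟨-, h3⟩
      rw [enorm_mul, mul_comm]
      gcongr
      rw [Real.enorm_of_nonneg (by positivity)]
      apply ENNReal.ofReal_le_ofReal
      rw [inv_eq_one_div, div_le_div_iff₀ (by positivity) (by positivity), one_mul]
      rw [abs_le] at h3
      have h5 : 1 + (n:ℝ) ^ 2 ≤ 3 * (1 + z.im ^ 2) := by nlinarith [sq_nonneg (z.im + (z.im - n))]
      calc (1 + (n:ℝ) ^ 2) ^ 2 ≤ (3 * (1 + z.im ^ 2)) ^ 2 := by gcongr
        _ = _ := by ring
    have hboxm : MeasurableSet (box n) := by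
      simp only [hbox, hS]
      refine MeasurableSet.inter (MeasurableSet.inter ?_ ?_) ?_
      · exact measurableSet_le measurable_const Complex.measurable_re
      · exact measurableSet_le Complex.measurable_re measurable_const
      · exact measurableSet_le ((Complex.measurable_im.sub_const _).norm) measurable_const
    calc _ ≤ ∫⁻ z in box n, ENNReal.ofReal (9 / (1 + (n:ℝ) ^ 2) ^ 2) * ‖Real.log ‖F z‖‖ₑ :=
          MeasureTheory.setLIntegral_mono' hboxm hw
      _ = ENNReal.ofReal (9 / (1 + (n:ℝ) ^ 2) ^ 2) * ∫⁻ z in box n, ‖Real.log ‖F z‖‖ₑ :=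
          MeasureTheory.lintegral_const_mul _ (measurable_log_norm hF).enorm
      _ ≤ ENNReal.ofReal (9 / (1 + (n:ℝ) ^ 2) ^ 2) * ENNReal.ofReal (9 / 4 * (9 / 4) *
            (2 * Real.pi) * (2 * (Q * (|(n:ℝ)| + 13 / 4)) -
              Real.log ‖F (2 + (n:ℝ) * Complex.I)‖)) := by
          gcongr
          exact (MeasureTheory.lintegral_mono_set (hball n)).trans hl
      _ ≤ _ := by
          rw [← ENNReal.ofReal_mul (by positivity)]
          apply ENNReal.ofReal_le_ofReal
          have h6 := (hlb n).2
          have h7 : |(n:ℝ)| ≤ (1 + (n:ℝ) ^ 2) / 2 := by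
            rcases abs_cases (n:ℝ) with h | h <;> nlinarith [sq_nonneg ((n:ℝ) - 1), sq_nonneg ((n:ℝ) + 1)]
          calc _ ≤ 9 / (1 + (n:ℝ) ^ 2) ^ 2 * (9 / 4 * (9 / 4) * (2 * Real.pi) *
                (10 * Q * (1 + (n:ℝ) ^ 2))) := by
                gcongr
                nlinarith [mul_nonneg hQ (sq_nonneg (n:ℝ)), mul_le_mul_of_nonneg_left h7 hQ]
            _ = _ := by
                rw [hk]
                field_simp
                ring
  have hsum := (summable_int_one_div_one_add_sq.mul_left (k * Q))
  have htot : ∫⁻ z in S, ‖Real.log ‖F z‖ * ((1 + z.im ^ 2) ^ 2)⁻¹‖ₑ ≤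
      ENNReal.ofReal (k * (∑' n : ℤ, 1 / (1 + (n : ℝ) ^ 2)) * Q) := by
    calc _ ≤ _ := MeasureTheory.lintegral_mono_set hcover
      _ ≤ ∑' n, ∫⁻ z in box n, ‖Real.log ‖F z‖ * ((1 + z.im ^ 2) ^ 2)⁻¹‖ₑ :=
          MeasureTheory.lintegral_iUnion_le _ _
      _ ≤ ∑' n : ℤ, ENNReal.ofReal (k * Q * (1 / (1 + (n : ℝ) ^ 2))) := ENNReal.tsum_le_tsum hterm
      _ = ENNReal.ofReal (∑' n : ℤ, k * Q * (1 / (1 + (n : ℝ) ^ 2))) :=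
          (ENNReal.ofReal_tsum_of_nonneg (fun n => by positivity) hsum).symm
      _ = _ := by rw [tsum_mul_left]; ring_nf
  refine ⟨⟨hmeas.aestronglyMeasurable, htot.trans_lt ENNReal.ofReal_lt_top⟩, ?_⟩
  rw [MeasureTheory.integral_norm_eq_lintegral_enorm hmeas.aestronglyMeasurable]
  refine ENNReal.toReal_le_of_le_ofReal ?_ htot
  have : 0 ≤ ∑' n : ℤ, 1 / (1 + (n : ℝ) ^ 2) := tsum_nonneg fun n => by positivity
  positivity

/-- The Mellin transform of `t ↦ f (log t / L) / (L t)`, written in the variable `log t / L`. -/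
noncomputable def logMellin (f : ℝ → ℂ) (L : ℝ) (s : ℂ) : ℂ :=
  ∫ u : ℝ, f u * Complex.exp (L * u * (s - 1))

theorem norm_logMellin_integrand (f : ℝ → ℂ) (L : ℝ) (s : ℂ) (u : ℝ) :
    ‖f u * Complex.exp (L * u * (s - 1))‖ = ‖f u‖ * Real.exp (L * u * (s.re - 1)) := by
  rw [norm_mul, Complex.norm_exp]
  congr 2
  simp [Complex.mul_re]

theorem integrable_logMellin_integrand {f : ℝ → ℂ} (hf : Continuous f) (hc : HasCompactSupport f)
    (L : ℝ) (s : ℂ) : MeasureTheory.Integrable fun u : ℝ => f u * Complex.exp (L * u * (s - 1)) :=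
  Continuous.integrable_of_hasCompactSupport (by fun_prop) hc.mul_right

theorem hasDerivAt_logMellin {f : ℝ → ℂ} (hf : Continuous f) (hc : HasCompactSupport f)
    (L : ℝ) (s : ℂ) :
    HasDerivAt (logMellin f L) (L * logMellin (fun u => u * f u) L s) s := by
  have hb : Continuous fun u : ℝ => ‖f u‖ * (|L * u| * Real.exp (|L * u| * (‖s‖ + 2))) := by
    fun_prop
  have h := hasDerivAt_integral_of_dominated_loc_of_deriv_le
    (F := fun (s : ℂ) (u : ℝ) => f u * Complex.exp (L * u * (s - 1)))
    (F' := fun (s : ℂ) (u : ℝ) => f u * (Complex.exp (L * u * (s - 1)) * (L * u)))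
    (bound := fun u : ℝ => ‖f u‖ * (|L * u| * Real.exp (|L * u| * (‖s‖ + 2))))
    (μ := MeasureTheory.volume) (x₀ := s) (Metric.ball_mem_nhds s one_pos)
    (Filter.Eventually.of_forall fun z =>
      (integrable_logMellin_integrand hf hc L z).aestronglyMeasurable)
    (integrable_logMellin_integrand hf hc L s)
    (Continuous.aestronglyMeasurable (by fun_prop)) ?_
    (hb.integrable_of_hasCompactSupport (hc.norm.mul_right)) ?_
  · refine h.2.congr_deriv ?_
    rw [logMellin, ← MeasureTheory.integral_const_mul]
    congr 1
    funext u
    ring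
  · refine Filter.Eventually.of_forall fun u z hz => ?_
    rw [norm_mul, norm_mul, Complex.norm_exp, mul_comm (Real.exp _)]
    have e : ‖((L : ℂ) * u)‖ = |L * u| := by
      rw [← Complex.ofReal_mul, Complex.norm_real, Real.norm_eq_abs]
    rw [e]
    gcongr
    have e2 : ((L : ℂ) * u * (z - 1)).re = (L * u) * (z - 1).re := by
      rw [← Complex.ofReal_mul, Complex.re_ofReal_mul]
    rw [e2]
    refine (le_abs_self _).trans ?_
    rw [abs_mul]
    gcongr
    refine (Complex.abs_re_le_norm _).trans ?_
    have h1 : ‖z - s‖ < 1 := by simpa [dist_eq_norm] using hz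
    calc ‖z - 1‖ = ‖(z - s) + s - 1‖ := by ring_nf
      _ ≤ ‖z - s‖ + ‖s‖ + ‖(1 : ℂ)‖ := (norm_sub_le _ _).trans (by gcongr; exact norm_add_le _ _)
      _ ≤ _ := by rw [norm_one]; linarith
  · refine Filter.Eventually.of_forall fun u z _ => ?_
    have : HasDerivAt (fun s : ℂ => (L : ℂ) * u * (s - 1)) (L * u) z := by
      simpa using ((hasDerivAt_id z).sub_const 1).const_mul ((L : ℂ) * u)
    exact this.cexp.const_mul _

theorem logMellin_deriv {f : ℝ → ℂ} (hf : ContDiff ℝ 1 f) (hc : HasCompactSupport f)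
    (L : ℝ) (s : ℂ) : logMellin (deriv f) L s = -(L * (s - 1) * logMellin f L s) := by
  have hd : ∀ u : ℝ, HasDerivAt (fun u : ℝ => Complex.exp (L * u * (s - 1)))
      (Complex.exp (L * u * (s - 1)) * (L * (s - 1))) u := fun u => by
    have : HasDerivAt (fun u : ℝ => (L : ℂ) * u * (s - 1)) (L * (s - 1)) u := by
      simpa using ((Complex.ofRealCLM.hasDerivAt (x := u)).const_mul (L : ℂ)).mul_const (s - 1)
    exact this.cexp
  have hf0 := hf.continuous
  have hf1 : Continuous (deriv f) := hf.continuous_deriv le_rfl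
  have h := MeasureTheory.integral_mul_deriv_eq_deriv_mul_of_integrable
    (u := fun u : ℝ => Complex.exp (L * u * (s - 1))) (v := f) (u' := fun u : ℝ =>
      Complex.exp (L * u * (s - 1)) * (L * (s - 1))) (v' := deriv f)
    (fun u _ => hd u) (fun u _ => (hf.differentiable one_ne_zero u).hasDerivAt)
    (Continuous.integrable_of_hasCompactSupport (by fun_prop) hc.deriv.mul_left)
    (Continuous.integrable_of_hasCompactSupport (by fun_prop) hc.mul_left)
    (Continuous.integrable_of_hasCompactSupport (by fun_prop) hc.mul_left)
  simp only [logMellin]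
  rw [← MeasureTheory.integral_const_mul, ← MeasureTheory.integral_neg]
  calc _ = _ := by simp only [mul_comm (deriv f _)]
    _ = _ := h
    _ = _ := by
      rw [← MeasureTheory.integral_neg]
      congr 1
      funext u
      ring

theorem tsupport_iterate_deriv_subset (f : ℝ → ℂ) (k : ℕ) : tsupport (deriv^[k] f) ⊆ tsupport f := by
  induction k with
  | zero => simp
  | succ k ih =>
    rw [Function.iterate_succ_apply']
    exact (closure_minimal support_deriv_subset (isClosed_tsupport _)).trans ih

theorem logMellin_iterate_deriv {f : ℝ → ℂ} (hf : ContDiff ℝ (⊤ : ℕ∞) f)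
    (hc : HasCompactSupport f) (L : ℝ) (s : ℂ) (k : ℕ) :
    logMellin (deriv^[k] f) L s = (-(L * (s - 1))) ^ k * logMellin f L s := by
  induction k with
  | zero => simp
  | succ k ih =>
    have h1 : ContDiff ℝ 1 (deriv^[k] f) := (hf.iterate_deriv k).of_le (by norm_cast)
    have h2 : HasCompactSupport (deriv^[k] f) :=
      hc.of_isClosed_subset (isClosed_tsupport _) (tsupport_iterate_deriv_subset f k)
    rw [Function.iterate_succ_apply', logMellin_deriv h1 h2, ih]
    ring

theorem norm_logMellin_le {f : ℝ → ℂ} {α₁ α₂ : ℝ} (hf : Continuous f)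
    (hs : tsupport f ⊆ Set.Icc α₁ α₂) {L c : ℝ} {s : ℂ}
    (h : ∀ u ∈ Set.Icc α₁ α₂, L * u * (s.re - 1) ≤ c) :
    ‖logMellin f L s‖ ≤ (∫ u, ‖f u‖) * Real.exp c := by
  have hc : HasCompactSupport f := isCompact_Icc.of_isClosed_subset (isClosed_tsupport f) hs
  rw [← MeasureTheory.integral_mul_const]
  refine MeasureTheory.norm_integral_le_of_norm_le
    ((hf.norm.integrable_of_hasCompactSupport hc.norm).mul_const _)
    (Filter.Eventually.of_forall fun u => ?_)
  rw [norm_logMellin_integrand]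
  by_cases hu : u ∈ tsupport f
  · gcongr
    exact h u (hs hu)
  · simp [image_eq_zero_of_notMem_tsupport hu]

theorem exists_norm_logMellin_le {f : ℝ → ℂ} {α₁ α₂ : ℝ} (hf : ContDiff ℝ (⊤ : ℕ∞) f)
    (hs : tsupport f ⊆ Set.Icc α₁ α₂) : ∃ C : ℝ, 0 < C ∧ ∀ (L c : ℝ) (s : ℂ), 1 ≤ L →
      (∀ u ∈ Set.Icc α₁ α₂, L * u * (s.re - 1) ≤ c) →
      ‖logMellin f L s‖ ≤ C * Real.exp c * ((1 + s.im ^ 2) ^ 2)⁻¹ := by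
  have hc : HasCompactSupport f := isCompact_Icc.of_isClosed_subset (isClosed_tsupport f) hs
  have hI0 : 0 ≤ ∫ u, ‖f u‖ := MeasureTheory.integral_nonneg fun u => norm_nonneg _
  have hI4 : 0 ≤ ∫ u, ‖(deriv^[4] f) u‖ := MeasureTheory.integral_nonneg fun u => norm_nonneg _
  refine ⟨2 * ((∫ u, ‖f u‖) + ∫ u, ‖(deriv^[4] f) u‖) + 1, by positivity, ?_⟩
  intro L c s hL h
  have h0 := norm_logMellin_le hf.continuous hs h
  have h4 := norm_logMellin_le (f := (deriv^[4] f))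
    (hf.iterate_deriv 4).continuous ((tsupport_iterate_deriv_subset f 4).trans hs) h
  rw [logMellin_iterate_deriv hf hc, norm_mul, norm_pow, norm_neg, norm_mul, Complex.norm_real,
    Real.norm_of_nonneg (by linarith)] at h4
  have h5 : s.im ^ 4 ≤ (L * ‖s - 1‖) ^ 4 := by
    have : |s.im| ≤ L * ‖s - 1‖ := by
      have := Complex.abs_im_le_norm (s - 1)
      simp only [Complex.sub_im, Complex.one_im, sub_zero] at this
      nlinarith [norm_nonneg (s - 1)]
    calc s.im ^ 4 = |s.im| ^ 4 := by rw [← abs_pow, abs_of_nonneg (by positivity)]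
      _ ≤ _ := by gcongr
  rw [← div_eq_mul_inv, le_div_iff₀ (by positivity)]
  have h6 : (1 + s.im ^ 2) ^ 2 ≤ 2 * (1 + s.im ^ 4) := by nlinarith [sq_nonneg (1 - s.im ^ 2)]
  have h7 := mul_le_mul_of_nonneg_right h5 (norm_nonneg (logMellin f L s))
  have h8 := mul_le_mul_of_nonneg_left h6 (norm_nonneg (logMellin f L s))
  nlinarith [Real.exp_pos c]

open scoped FourierTransform in
theorem integral_logMellin_mul_exp {f : ℝ → ℂ} {α₁ α₂ : ℝ} (hf : ContDiff ℝ (⊤ : ℕ∞) f)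
    (hs : tsupport f ⊆ Set.Icc α₁ α₂) {L : ℝ} (hL : 1 ≤ L) (σ v : ℝ) :
    ∫ t : ℝ, logMellin f L (σ + t * Complex.I) * Complex.exp (-(t * v * Complex.I)) =
      2 * Real.pi / L * f (v / L) * Complex.exp (v * (σ - 1)) := by
  have hc : HasCompactSupport f := isCompact_Icc.of_isClosed_subset (isClosed_tsupport f) hs
  have hL0 : (L : ℂ) ≠ 0 := by exact_mod_cast (by linarith : L ≠ 0)
  set h : ℝ → ℂ := fun u => f u * Complex.exp (L * u * (σ - 1)) with hh
  have hf0 := hf.continuous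
  have hcont : Continuous h := by fun_prop
  have hintg : MeasureTheory.Integrable h := hcont.integrable_of_hasCompactSupport hc.mul_right
  have hpi : (Real.pi : ℂ) ≠ 0 := by exact_mod_cast Real.pi_ne_zero
  have key : ∀ w : ℝ, 𝓕⁻ h w =
      logMellin f L (σ + (2 * Real.pi / L * w : ℝ) * Complex.I) := by
    intro w
    rw [Real.fourierInv_eq']
    simp only [logMellin]
    congr 1
    funext u
    rw [smul_eq_mul, hh, mul_left_comm, ← Complex.exp_add]
    congr 2
    simp
    field_simp
    ring
  obtain ⟨C, hC, hb⟩ := exists_norm_logMellin_le hf hs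
  obtain ⟨c, hcb⟩ : ∃ c : ℝ, ∀ u ∈ Set.Icc α₁ α₂, L * u * (σ - 1) ≤ c := by
    obtain ⟨c, hc⟩ := (isCompact_Icc (a := α₁) (b := α₂)).exists_bound_of_continuousOn
      (f := fun u => L * u * (σ - 1)) (by fun_prop)
    exact ⟨c, fun u hu => (le_abs_self _).trans (hc u hu)⟩
  have hTc : Continuous fun t : ℝ => logMellin f L (σ + t * Complex.I) :=
    (continuous_iff_continuousAt.2 fun z => (hasDerivAt_logMellin hf0 hc L z).continuousAt).comp
      (by fun_prop)
  have hTi : MeasureTheory.Integrable fun t : ℝ => logMellin f L (σ + t * Complex.I) := by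
    refine (integrable_inv_one_add_sq.const_mul (C * Real.exp c)).mono'
      hTc.aestronglyMeasurable (Filter.Eventually.of_forall fun t => ?_)
    have := hb L c (σ + t * Complex.I) hL (by simpa using hcb)
    simp only [Complex.add_im, Complex.ofReal_im, Complex.mul_im, Complex.ofReal_re, Complex.I_im,
      Complex.I_re, mul_one, mul_zero, add_zero, zero_add] at this
    refine this.trans ?_
    gcongr
    nlinarith [sq_nonneg t]
  have hFi : MeasureTheory.Integrable (𝓕⁻ h) := by
    have := hTi.comp_mul_left' (R := 2 * Real.pi / L) (by positivity)
    exact this.congr (Filter.Eventually.of_forall fun w => (key w).symm)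
  have hFi' : MeasureTheory.Integrable (𝓕 h) := by
    have := hFi.comp_neg
    refine this.congr (Filter.Eventually.of_forall fun w => ?_)
    change 𝓕⁻ h (-w) = 𝓕 h w
    rw [Real.fourierInv_eq_fourier_neg, neg_neg]
  have hinv := congrFun (hcont.fourier_fourierInv_eq hintg hFi') (v / L)
  rw [Real.fourier_real_eq_integral_exp_smul] at hinv
  simp only [key] at hinv
  have hsub := MeasureTheory.Measure.integral_comp_mul_left
    (fun t : ℝ => logMellin f L (σ + t * Complex.I) * Complex.exp (-(t * v * Complex.I)))
    (2 * Real.pi / L)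
  have e : ∫ w : ℝ, Complex.exp (((-2 * Real.pi * w * (v / L) : ℝ) : ℂ) * Complex.I) •
      logMellin f L (σ + (2 * Real.pi / L * w : ℝ) * Complex.I) = ∫ w : ℝ,
        logMellin f L (σ + (2 * Real.pi / L * w : ℝ) * Complex.I) *
          Complex.exp (-((2 * Real.pi / L * w : ℝ) * v * Complex.I)) := by
    congr 1
    funext w
    rw [smul_eq_mul, mul_comm]
    congr 2
    push_cast
    field_simp
  rw [e, hsub, abs_of_pos (by positivity)] at hinv
  rw [hh, Complex.real_smul] at hinv
  have e2 : (L : ℂ) * ((v / L : ℝ) : ℂ) * (σ - 1) = v * (σ - 1) := by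
    push_cast
    field_simp
  beta_reduce at hinv
  rw [e2] at hinv
  rw [mul_assoc, ← hinv, ← mul_assoc]
  push_cast
  rw [mul_inv_cancel₀ (div_ne_zero (mul_ne_zero two_ne_zero hpi) hL0), one_mul]

theorem integrable_strip_weight (p q : ℝ) : MeasureTheory.Integrable
    fun z : ℂ => (Set.Icc p q).indicator (fun _ => (1 : ℝ)) z.re * ((1 + z.im ^ 2) ^ 2)⁻¹ := by
  have h1 : MeasureTheory.Integrable ((Set.Icc p q).indicator fun _ => (1 : ℝ)) :=
    (MeasureTheory.integrable_indicator_iff measurableSet_Icc).2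
      (MeasureTheory.integrableOn_const (by simp))
  have h2 : MeasureTheory.Integrable fun t : ℝ => ((1 + t ^ 2) ^ 2)⁻¹ := by
    refine integrable_inv_one_add_sq.mono' (Measurable.aestronglyMeasurable (by fun_prop))
      (Filter.Eventually.of_forall fun t => ?_)
    rw [Real.norm_of_nonneg (by positivity)]
    gcongr
    nlinarith [sq_nonneg t]
  exact (Complex.volume_preserving_equiv_real_prod.integrable_comp_emb
    Complex.measurableEquivRealProd.measurableEmbedding).2 (h1.mul_prod h2)

theorem integral_complex_eq_integral_integral {f : ℂ → ℂ} (hf : MeasureTheory.Integrable f) :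
    ∫ z, f z = ∫ σ : ℝ, ∫ t : ℝ, f (σ + t * Complex.I) := by
  have h1 := Complex.volume_preserving_equiv_real_prod.symm.integral_comp
    Complex.measurableEquivRealProd.symm.measurableEmbedding f
  rw [← h1]
  have h2 := (Complex.volume_preserving_equiv_real_prod.symm.integrable_comp_emb
    Complex.measurableEquivRealProd.symm.measurableEmbedding).2 hf
  rw [MeasureTheory.Measure.volume_eq_prod] at h2 ⊢
  refine (MeasureTheory.integral_prod _ h2).trans ?_
  exact MeasureTheory.integral_congr_ae (Filter.Eventually.of_forall fun σ =>
    MeasureTheory.integral_congr_ae (Filter.Eventually.of_forall fun t =>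
      congrArg f (Complex.mk_eq_add_mul_I σ t)))

theorem continuous_logMellin {f : ℝ → ℂ} (hf : Continuous f) (hc : HasCompactSupport f) (L : ℝ) :
    Continuous (logMellin f L) :=
  continuous_iff_continuousAt.2 fun z => (hasDerivAt_logMellin hf hc L z).continuousAt

section Strip

variable {f : ℝ → ℂ} {α₁ α₂ L : ℝ} {a : ℝ → ℝ}

theorem integrable_strip_logMellin_mul (hf : ContDiff ℝ (⊤ : ℕ∞) f)
    (hs : tsupport f ⊆ Set.Icc α₁ α₂) (hL : 1 ≤ L) {K p q : ℝ} (ham : Measurable a)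
    (haK : ∀ t, |a t| ≤ K) (ha : ∀ t, t ∉ Set.Icc p q → a t = 0) {e : ℂ → ℂ} (he : Continuous e)
    {B : ℝ} (heB : ∀ z : ℂ, z.re ∈ Set.Icc p q → ‖e z‖ ≤ B) :
    MeasureTheory.Integrable fun z : ℂ => (a z.re : ℂ) * (logMellin f L z * e z) := by
  have hc : HasCompactSupport f := isCompact_Icc.of_isClosed_subset (isClosed_tsupport f) hs
  obtain ⟨C, hC, hb⟩ := exists_norm_logMellin_le hf hs
  obtain ⟨c, hc'⟩ := ((isCompact_Icc (a := α₁) (b := α₂)).prod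
    (isCompact_Icc (a := p) (b := q))).exists_bound_of_continuousOn
      (f := fun u : ℝ × ℝ => L * u.1 * (u.2 - 1)) (by fun_prop)
  have hK : 0 ≤ K := (abs_nonneg _).trans (haK 0)
  refine ((integrable_strip_weight p q).const_mul (K * (C * Real.exp c * B))).mono'
    (((Complex.measurable_ofReal.comp (ham.comp Complex.measurable_re)).mul
      ((continuous_logMellin hf.continuous hc L).mul he).measurable).aestronglyMeasurable)
    (Filter.Eventually.of_forall fun z => ?_)
  by_cases hz : z.re ∈ Set.Icc p q
  · rw [Set.indicator_of_mem hz, norm_mul, norm_mul, Complex.norm_real]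
    have h1 := hb L c z hL fun u hu => (le_abs_self _).trans (hc' (u, z.re) ⟨hu, hz⟩)
    calc _ ≤ K * ((C * Real.exp c * ((1 + z.im ^ 2) ^ 2)⁻¹) * B) := by
          gcongr
          · exact haK _
          · exact heB z hz
      _ = _ := by ring
  · rw [ha _ hz, Set.indicator_of_notMem hz]
    simp

theorem integral_strip_logMellin_mul (hf : ContDiff ℝ (⊤ : ℕ∞) f)
    (hs : tsupport f ⊆ Set.Icc α₁ α₂) (hL : 1 ≤ L) {K p q : ℝ} (ham : Measurable a)
    (haK : ∀ t, |a t| ≤ K) (ha : ∀ t, t ∉ Set.Icc p q → a t = 0) (v v' : ℝ) :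
    ∫ z : ℂ, (a z.re : ℂ) * (logMellin f L z * Complex.exp (-(z.re * v + z.im * v' * Complex.I))) =
      ∫ σ : ℝ, (a σ : ℂ) * (2 * Real.pi / L * f (v' / L) *
        Complex.exp (v' * (σ - 1) - σ * v)) := by
  obtain ⟨B, hB⟩ := (isCompact_Icc (a := p) (b := q)).exists_bound_of_continuousOn
    (f := fun σ : ℝ => Real.exp (-(σ * v))) (by fun_prop)
  rw [integral_complex_eq_integral_integral
    (integrable_strip_logMellin_mul hf hs hL ham haK ha
    (e := fun z : ℂ => Complex.exp (-(z.re * v + z.im * v' * Complex.I))) (by fun_prop) (B := B)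
    fun z hz => ?_)]
  · congr 1
    funext σ
    simp only [Complex.add_re, Complex.ofReal_re, Complex.mul_re, Complex.I_re, Complex.ofReal_im,
      Complex.I_im, Complex.add_im, Complex.mul_im, mul_zero, mul_one, sub_zero, add_zero, zero_add]
    rw [MeasureTheory.integral_const_mul]
    congr 1
    have h1 := integral_logMellin_mul_exp hf hs hL σ v'
    rw [sub_eq_add_neg, Complex.exp_add, ← mul_assoc, ← h1, ← MeasureTheory.integral_mul_const]
    congr 1
    funext t
    have e : -((σ : ℂ) * v + t * v' * Complex.I) = -(t * v' * Complex.I) + -(σ * v) := by ring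
    rw [e, Complex.exp_add]
    ring
  · refine le_trans (le_of_eq ?_) (hB _ hz)
    rw [Complex.norm_exp, Real.norm_of_nonneg (Real.exp_nonneg _)]
    simp

theorem integral_strip_logMellin_mul_cpow (hf : ContDiff ℝ (⊤ : ℕ∞) f)
    (hs : tsupport f ⊆ Set.Icc α₁ α₂) (hL : 1 ≤ L) {K p q : ℝ} (ham : Measurable a)
    (haK : ∀ t, |a t| ≤ K) (ha : ∀ t, t ∉ Set.Icc p q → a t = 0) {n : ℕ} (hn : n ≠ 0) :
    ∫ z : ℂ, (a z.re : ℂ) * (logMellin f L z * (n : ℂ) ^ (-z)) =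
      (∫ σ, a σ : ℝ) * (2 * Real.pi / L * (f (Real.log n / L) / n)) := by
  have h := integral_strip_logMellin_mul hf hs hL ham haK ha (Real.log n) (Real.log n)
  have hn' : (n : ℂ) ≠ 0 := by exact_mod_cast hn
  have e1 : ∀ z : ℂ, (n : ℂ) ^ (-z) =
      Complex.exp (-(z.re * Real.log n + z.im * Real.log n * Complex.I)) := fun z => by
    rw [Complex.cpow_def_of_ne_zero hn', Complex.natCast_log]
    congr 1
    conv_lhs => rw [← Complex.re_add_im z]
    ring
  simp only [e1]
  rw [h, ← integral_complex_ofReal, ← MeasureTheory.integral_mul_const]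
  congr 1
  funext σ
  have e2 : ((Real.log n : ℝ) : ℂ) * (σ - 1) - σ * (Real.log n : ℝ) = -(Real.log n : ℝ) := by ring
  rw [e2, Complex.exp_neg, Complex.ofReal_log (Nat.cast_nonneg _), Complex.ofReal_natCast,
    Complex.exp_log hn']
  ring

theorem integral_strip_logMellin_mul_conj_cpow (hf : ContDiff ℝ (⊤ : ℕ∞) f)
    (hs : tsupport f ⊆ Set.Icc α₁ α₂) (h1 : 0 < α₁) (hL : 1 ≤ L) {K p q : ℝ} (ham : Measurable a)
    (haK : ∀ t, |a t| ≤ K) (ha : ∀ t, t ∉ Set.Icc p q → a t = 0) {n : ℕ} (hn : n ≠ 0) :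
    ∫ z : ℂ, (a z.re : ℂ) * (logMellin f L z * (starRingEnd ℂ) ((n : ℂ) ^ (-z))) = 0 := by
  have h := integral_strip_logMellin_mul hf hs hL ham haK ha (Real.log n) (-Real.log n)
  have hn' : (n : ℂ) ≠ 0 := by exact_mod_cast hn
  have e1 : ∀ z : ℂ, (starRingEnd ℂ) ((n : ℂ) ^ (-z)) =
      Complex.exp (-(z.re * Real.log n + z.im * (-Real.log n : ℝ) * Complex.I)) := fun z => by
    rw [Complex.cpow_def_of_ne_zero hn', ← Complex.natCast_log, ← Complex.exp_conj]
    congr 1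
    conv_lhs => rw [← Complex.re_add_im z]
    simp only [map_mul, map_neg, map_add, Complex.conj_ofReal, Complex.conj_I]
    push_cast
    ring
  simp only [e1]
  rw [h]
  have h0 : f (-Real.log n / L) = 0 := by
    refine image_eq_zero_of_notMem_tsupport fun hu => ?_
    have h2 := (hs hu).1
    have h3 : -Real.log n / L ≤ 0 :=
      div_nonpos_of_nonpos_of_nonneg (neg_nonpos.2 (Real.log_natCast_nonneg n)) (by linarith)
    linarith
  simp [h0]

end Strip

/-- An entire function of order one in the strip `-1/4 ≤ Re s ≤ 5`, quantitatively, and bounded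
below on the line `Re s = 2`. -/
structure IsStripBounded (F : ℂ → ℂ) (Q : ℝ) : Prop where
  differentiable : Differentiable ℂ F
  nonneg : 0 ≤ Q
  upper : ∀ s : ℂ, -1 / 4 ≤ s.re → s.re ≤ 5 → Real.log ‖F s‖ ≤ Q * (1 + |s.im|)
  lower : ∀ t : ℝ, F (2 + t * Complex.I) ≠ 0 ∧ -Q ≤ Real.log ‖F (2 + t * Complex.I)‖

/-- The weight `(1 + (Im s)²)⁻²` on the strip `0 ≤ Re s ≤ 1`. -/
noncomputable def stripWeight (s : ℂ) : ℝ :=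
  if 0 ≤ s.re ∧ s.re ≤ 1 then ((1 + s.im ^ 2) ^ 2)⁻¹ else 0

open scoped ComplexOrder in
theorem exists_sum_zeros_stripWeight_le : ∃ C : ℝ, 0 < C ∧ ∀ F Q, IsStripBounded F Q →
    Summable (fun u => (analyticOrderNatAt F u : ℝ) * stripWeight u) ∧
      ∑' u, (analyticOrderNatAt F u : ℝ) * stripWeight u ≤ C * Q := by
  obtain ⟨C, hC, hR⟩ := exists_bound_integral_strip_log_norm
  obtain ⟨K, f, f', f'', hf⟩ := exists_isCutoff (1 / 2) (r := 1 / 2) (R := 5 / 8) (by norm_num)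
    (by norm_num)
  set w : ℝ → ℝ := fun t => ((1 + t ^ 2) ^ 2)⁻¹ with hw
  set w' : ℝ → ℝ := fun t => -4 * t * ((1 + t ^ 2) ^ 3)⁻¹ with hw'
  set w'' : ℝ → ℝ := fun t => -4 * ((1 + t ^ 2) ^ 3)⁻¹ + 24 * t ^ 2 * ((1 + t ^ 2) ^ 4)⁻¹ with hw''
  have hwpos : ∀ t, 0 < w t := fun t => by positivity
  have hpos : ∀ t : ℝ, 1 + t ^ 2 ≠ 0 := fun t => by positivity
  have hd0 : ∀ t : ℝ, HasDerivAt (fun t : ℝ => 1 + t ^ 2) (2 * t) t := fun t => by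
    simpa using (hasDerivAt_pow 2 t).const_add 1
  have hd1 : ∀ t, HasDerivAt w (w' t) t := fun t => by
    refine ((hd0 t).pow 2).inv (pow_ne_zero _ (hpos t)) |>.congr_deriv ?_
    simp only [hw', Pi.pow_apply]
    have := hpos t
    field_simp
    ring
  have hd2 : ∀ t, HasDerivAt w' (w'' t) t := fun t => by
    have h1 : HasDerivAt (fun t : ℝ => ((1 + t ^ 2) ^ 3)⁻¹) _ t :=
      ((hd0 t).pow 3).inv (pow_ne_zero _ (hpos t))
    have h2 : HasDerivAt (fun t : ℝ => -4 * t) (-4) t := by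
      simpa using (hasDerivAt_id t).const_mul (-4)
    refine (h2.mul h1).congr_deriv ?_
    simp only [hw'', Pi.pow_apply]
    have := hpos t
    field_simp
    ring
  have hw1 : ∀ t, |w' t| ≤ 4 * w t := fun t => by
    simp only [hw', hw]
    rw [abs_mul, abs_mul, abs_inv, abs_of_pos (by positivity : (0:ℝ) < (1 + t ^ 2) ^ 3),
      ← div_eq_mul_inv, ← div_eq_mul_inv, div_le_div_iff₀ (by positivity) (by positivity)]
    have h1 : |t| ≤ 1 + t ^ 2 := by
      rw [← sq_abs t]
      nlinarith [sq_nonneg (|t| - 1)]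
    have h2 : |(-4:ℝ)| = 4 := by norm_num
    rw [h2]
    calc 4 * |t| * (1 + t ^ 2) ^ 2 ≤ 4 * (1 + t ^ 2) * (1 + t ^ 2) ^ 2 := by gcongr
      _ = _ := by ring
  have hw2 : ∀ t, |w'' t| ≤ 28 * w t := fun t => by
    simp only [hw'', hw]
    have e1 : |-4 * ((1 + t ^ 2) ^ 3)⁻¹| ≤ 4 * ((1 + t ^ 2) ^ 2)⁻¹ := by
      rw [abs_mul, abs_inv, abs_of_pos (by positivity : (0:ℝ) < (1 + t ^ 2) ^ 3), abs_neg,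
        abs_of_pos (by norm_num : (0:ℝ) < 4)]
      gcongr ?_ * (?_)⁻¹
      exact pow_le_pow_right₀ (by nlinarith [sq_nonneg t]) (by norm_num)
    have e2 : |24 * t ^ 2 * ((1 + t ^ 2) ^ 4)⁻¹| ≤ 24 * ((1 + t ^ 2) ^ 2)⁻¹ := by
      rw [abs_of_nonneg (by positivity), ← div_eq_mul_inv, ← div_eq_mul_inv,
        div_le_div_iff₀ (by positivity) (by positivity)]
      have : t ^ 2 ≤ (1 + t ^ 2) ^ 2 := by nlinarith [sq_nonneg t, sq_nonneg (t ^ 2)]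
      calc 24 * t ^ 2 * (1 + t ^ 2) ^ 2 ≤ 24 * (1 + t ^ 2) ^ 2 * (1 + t ^ 2) ^ 2 := by gcongr
        _ = _ := by ring
    exact (abs_add_le _ _).trans (by linarith)
  have hw''c : Continuous w'' := by
    simp only [hw'']
    exact (continuous_const.mul (Continuous.inv₀ (by fun_prop) fun t => pow_ne_zero _ (hpos t))).add
      (Continuous.mul (by fun_prop) (Continuous.inv₀ (by fun_prop) fun t => pow_ne_zero _ (hpos t)))
  have hP := (hasPartials_re (f := fun t => (f t : ℂ)) (fun t => (hf.deriv1 t).ofReal_comp)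
    (fun t => (hf.deriv2 t).ofReal_comp) (Complex.continuous_ofReal.comp hf.cont)).mul
    (hasPartials_im (f := fun t => (w t : ℂ)) (fun t => (hd1 t).ofReal_comp)
      (fun t => (hd2 t).ofReal_comp) (Complex.continuous_ofReal.comp hw''c))
  have hK := hf.one_le
  set B : ℂ → ℝ := fun z =>
    (K + 28) * ((Set.Icc (-1 / 8) (9 / 8)).indicator (fun _ => (1 : ℝ)) z.re * w z.im) with hB
  have hout : ∀ z : ℂ, z.re ∉ Set.Icc (-1 / 8 : ℝ) (9 / 8) → 5 / 8 < |z.re - 1 / 2| := fun z hz => by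
    by_contra! h
    rw [abs_le] at h
    exact hz ⟨by linarith, by linarith⟩
  have hBb : ∀ (c d e : ℝ) (z : ℂ), |c| ≤ K → |e| ≤ 28 * w z.im → |d| ≤ 1 →
      (5 / 8 < |z.re - 1 / 2| → c = 0 ∧ d = 0) → |c * w z.im + d * e| ≤ B z := by
    intro c d e z hc he hd h0
    by_cases hz : z.re ∈ Set.Icc (-1 / 8 : ℝ) (9 / 8)
    · simp only [hB, Set.indicator_of_mem hz, one_mul]
      refine (abs_add_le _ _).trans ?_
      rw [abs_mul, abs_mul, abs_of_pos (hwpos z.im)]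
      have h1 := hwpos z.im
      nlinarith [abs_nonneg d, abs_nonneg e, mul_le_mul_of_nonneg_right hd (abs_nonneg e),
        mul_le_mul_of_nonneg_right hc h1.le]
    · obtain ⟨h1, h2⟩ := h0 (hout z hz)
      simp only [hB, Set.indicator_of_notMem hz, h1, h2]
      simp
  have habs : ∀ t, |f t| ≤ 1 := fun t => abs_le.2 ⟨by linarith [hf.nonneg t], hf.le_one t⟩
  refine ⟨(2 * Real.pi)⁻¹ * ((K + 28) * C), by positivity, fun F Q h => ?_⟩
  obtain ⟨hi, hle⟩ := hR F Q h.differentiable h.nonneg h.upper h.lower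
  set S : Set ℂ := {z : ℂ | -1 / 8 ≤ z.re ∧ z.re ≤ 3 / 2} with hS
  have hSm : MeasurableSet S := MeasurableSet.inter
    (measurableSet_le measurable_const Complex.measurable_re)
    (measurableSet_le Complex.measurable_re measurable_const)
  have hBS : ∀ z, ‖Real.log ‖F z‖ * B z‖ ≤
      (K + 28) * S.indicator (fun z => ‖Real.log ‖F z‖ * w z.im‖) z := fun z => by
    by_cases hz : z.re ∈ Set.Icc (-1 / 8 : ℝ) (9 / 8)
    · have hz' : z ∈ S := ⟨hz.1, hz.2.trans (by norm_num)⟩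
      simp only [hB, Set.indicator_of_mem hz, Set.indicator_of_mem hz', one_mul, norm_mul,
        Real.norm_of_nonneg (by linarith : 0 ≤ K + 28)]
      exact le_of_eq (by ring)
    · simp only [hB, Set.indicator_of_notMem hz]
      simp only [zero_mul, mul_zero, norm_zero]
      exact mul_nonneg (by linarith) (Set.indicator_nonneg (fun z _ => norm_nonneg _) _)
  have hdom : MeasureTheory.Integrable fun z =>
      (K + 28) * S.indicator (fun z => ‖Real.log ‖F z‖ * w z.im‖) z :=
    ((MeasureTheory.integrable_indicator_iff hSm).2 hi.norm).const_mul _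
  have hBm : Measurable B := by
    refine measurable_const.mul (Measurable.mul ?_ ?_)
    · exact (measurable_const.indicator measurableSet_Icc).comp Complex.measurable_re
    · exact (show Measurable w by fun_prop).comp Complex.measurable_im
  have hIB : MeasureTheory.Integrable fun z => Real.log ‖F z‖ * B z :=
    hdom.mono' ((measurable_log_norm h.differentiable).mul hBm).aestronglyMeasurable
      (Filter.Eventually.of_forall hBS)
  have hB2 : ∀ z : ℂ, |f'' z.re * w z.im + f z.re * w'' z.im| ≤ B z := fun z =>
    hBb _ _ _ z (hf.bound2 _) (hw2 _) (habs _) fun h => ⟨(hf.eq_zero _ h).2.2, (hf.eq_zero _ h).1⟩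
  have hsum := hP.hasSum_of_summable h.differentiable ⟨_, (h.lower 0).1⟩ (B := B) (a := 9 / 8)
    (fun z => by
      have := hBb (f z.re) 0 0 z ((habs _).trans hK) (by simpa using (hwpos _).le) (by simp)
        fun h => ⟨(hf.eq_zero _ h).1, rfl⟩
      simpa [Complex.norm_real, Real.norm_eq_abs, abs_mul] using this)
    (fun z => by
      have := hBb 0 (f z.re) (w' z.im) z (by simp; linarith)
        ((hw1 _).trans (by linarith [hwpos z.im])) (habs _) fun h => ⟨rfl, (hf.eq_zero _ h).1⟩
      simpa [Complex.norm_real, Real.norm_eq_abs, abs_mul] using this)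
    (fun z => by
      have := hB2 z
      rw [← Real.norm_eq_abs, ← Complex.norm_real] at this
      simpa using this)
    hIB
    (fun z hz => by
      by_contra! hc
      apply hz
      have : 5 / 8 < |z.re - 1 / 2| := by
        have := abs_sub_abs_le_abs_sub z.re (1 / 2)
        rw [abs_of_pos (by norm_num : (0:ℝ) < 1 / 2)] at this
        linarith
      simp [(hf.eq_zero _ this).1])
    (Or.inr fun z => by
      rw [← Complex.ofReal_mul]
      exact_mod_cast mul_nonneg (hf.nonneg _) (hwpos _).le)
  have hsumR : HasSum (fun u => (analyticOrderNatAt F u : ℝ) * (f u.re * w u.im))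
      ((2 * Real.pi)⁻¹ * ∫ z : ℂ, Real.log ‖F z‖ * (f'' z.re * w z.im + f z.re * w'' z.im)) := by
    rw [← Complex.hasSum_ofReal]
    convert! hsum using 1
    · funext u
      push_cast
      rfl
    · rw [Complex.ofReal_mul, ← integral_complex_ofReal, Complex.real_smul]
      congr 2
      funext z
      rw [Complex.real_smul]
      push_cast
      ring
  have hle' : ∀ u : ℂ, stripWeight u ≤ f u.re * w u.im := fun u => by
    unfold stripWeight
    split_ifs with hu
    · rw [hf.eq_one _ (abs_le.2 ⟨by linarith [hu.1], by linarith [hu.2]⟩), one_mul]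
    · exact mul_nonneg (hf.nonneg _) (hwpos _).le
  have h0 : ∀ u, 0 ≤ stripWeight u := fun u => by
    unfold stripWeight
    split_ifs
    · exact (hwpos u.im).le
    · exact le_rfl
  have hs : Summable fun u => (analyticOrderNatAt F u : ℝ) * stripWeight u :=
    hsumR.summable.of_nonneg_of_le (fun u => mul_nonneg (Nat.cast_nonneg _) (h0 u))
      fun u => mul_le_mul_of_nonneg_left (hle' u) (Nat.cast_nonneg _)
  refine ⟨hs, (hs.tsum_le_tsum (fun u => mul_le_mul_of_nonneg_left (hle' u) (Nat.cast_nonneg _))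
    hsumR.summable).trans ?_⟩
  rw [hsumR.tsum_eq, mul_assoc (2 * Real.pi)⁻¹]
  gcongr
  calc _ ≤ ‖_‖ := Real.le_norm_self _
    _ ≤ ∫ z, (K + 28) * S.indicator (fun z => ‖Real.log ‖F z‖ * w z.im‖) z := by
        refine MeasureTheory.norm_integral_le_of_norm_le hdom
          (Filter.Eventually.of_forall fun z => le_trans ?_ (hBS z))
        rw [norm_mul, norm_mul]
        gcongr
        exact (hB2 z).trans (le_abs_self _)
    _ = (K + 28) * ∫ z in S, ‖Real.log ‖F z‖ * w z.im‖ := by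
        rw [MeasureTheory.integral_const_mul, MeasureTheory.integral_indicator hSm]
    _ ≤ (K + 28) * (C * Q) := by gcongr
    _ = _ := by ring

theorem tsupport_ofReal_mul_subset (f : ℝ → ℂ) : tsupport (fun u : ℝ => (u : ℂ) * f u) ⊆ tsupport f :=
  closure_mono fun u hu => by
    simp only [Function.mem_support] at hu ⊢
    exact right_ne_zero_of_mul hu

/-- On `Re s > 1`, `F` is zero-free and `log |F|` is the real part of the Dirichlet series
`Σ b n n⁻ˢ`, which is absolutely convergent. -/
structure HasLogSeries (F : ℂ → ℂ) (b : ℕ → ℂ) : Prop where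
  zero : b 0 = 0
  summable : ∀ s : ℂ, 1 < s.re → Summable fun n : ℕ => b n * (n : ℂ) ^ (-s)
  ne_zero : ∀ s : ℂ, 1 ≤ s.re → F s ≠ 0
  log_norm : ∀ s : ℂ, 1 < s.re → Real.log ‖F s‖ = (∑' n : ℕ, b n * (n : ℂ) ^ (-s)).re

theorem hasSum_integral_log_norm {f : ℝ → ℂ} {α₁ α₂ : ℝ} (h1 : 0 < α₁)
    (hf : ContDiff ℝ (⊤ : ℕ∞) f) (hs : tsupport f ⊆ Set.Icc α₁ α₂) {L : ℝ} (hL : 1 ≤ L)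
    {F : ℂ → ℂ} (hF : Differentiable ℂ F) {b : ℕ → ℂ} (hFb : HasLogSeries F b)
    {a : ℝ → ℝ} {K p q : ℝ} (hp : 1 < p)
    (ham : Measurable a) (haK : ∀ t, |a t| ≤ K) (ha : ∀ t, t ∉ Set.Icc p q → a t = 0) :
    MeasureTheory.Integrable (fun z => Real.log ‖F z‖ • ((a z.re : ℂ) * logMellin f L z)) ∧
    HasSum (fun n : ℕ => (∫ σ, a σ : ℝ) * (Real.pi / L * (b n * (f (Real.log n / L) / n))))
      (∫ z, Real.log ‖F z‖ • ((a z.re : ℂ) * logMellin f L z)) := by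
  set g : ℕ → ℂ → ℂ := fun n z => (a z.re : ℂ) * (logMellin f L z *
    (b n * (n : ℂ) ^ (-z) + (starRingEnd ℂ) (b n * (n : ℂ) ^ (-z)))) / 2 with hg
  have hnorm : ∀ (n : ℕ) (z : ℂ), n ≠ 0 → z.re ∈ Set.Icc p q →
      ‖(n : ℂ) ^ (-z)‖ ≤ ‖(n : ℂ) ^ (-(p : ℂ))‖ := fun n z hn hz => by
    rw [Complex.norm_natCast_cpow_of_pos (Nat.pos_of_ne_zero hn),
      Complex.norm_natCast_cpow_of_pos (Nat.pos_of_ne_zero hn)]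
    refine Real.rpow_le_rpow_of_exponent_le (by exact_mod_cast Nat.one_le_iff_ne_zero.2 hn) ?_
    simpa using hz.1
  have hi0 : MeasureTheory.Integrable fun z : ℂ => (a z.re : ℂ) * logMellin f L z := by
    simpa using integrable_strip_logMellin_mul hf hs hL ham haK ha (e := fun _ => 1)
      continuous_const (B := 1) (by simp)
  have hcp : ∀ n : ℕ, n ≠ 0 → Continuous fun z : ℂ => (n : ℂ) ^ (-z) := fun n hn =>
    continuous_neg.const_cpow (Or.inl (by exact_mod_cast hn))
  have hi1 : ∀ n : ℕ, n ≠ 0 → MeasureTheory.Integrable fun z : ℂ =>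
      (a z.re : ℂ) * (logMellin f L z * (n : ℂ) ^ (-z)) := fun n hn =>
    integrable_strip_logMellin_mul hf hs hL ham haK ha (hcp n hn) fun z hz => hnorm n z hn hz
  have hi2 : ∀ n : ℕ, n ≠ 0 → MeasureTheory.Integrable fun z : ℂ =>
      (a z.re : ℂ) * (logMellin f L z * (starRingEnd ℂ) ((n : ℂ) ^ (-z))) := fun n hn =>
    integrable_strip_logMellin_mul hf hs hL ham haK ha
      (Complex.continuous_conj.comp (hcp n hn)) (B := ‖(n : ℂ) ^ (-(p : ℂ))‖)
      fun z hz => by simpa using hnorm n z hn hz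
  have hgn : ∀ n z, g n z = (b n / 2) * ((a z.re : ℂ) * (logMellin f L z * (n : ℂ) ^ (-z))) +
      ((starRingEnd ℂ) (b n) / 2) *
        ((a z.re : ℂ) * (logMellin f L z * (starRingEnd ℂ) ((n : ℂ) ^ (-z)))) := fun n z => by
    simp only [hg, map_mul]
    ring
  have hg0 : g 0 = 0 := by
    funext z
    simp [hg, hFb.zero]
  have hgi : ∀ n, MeasureTheory.Integrable (g n) := fun n => by
    rcases eq_or_ne n 0 with rfl | hn
    · rw [hg0]
      exact MeasureTheory.integrable_zero _ _ _
    · exact (((hi1 n hn).const_mul _).add ((hi2 n hn).const_mul _)).congr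
        (Filter.Eventually.of_forall fun z => (hgn n z).symm)
  have hgint : ∀ n : ℕ, ∫ z, g n z =
      (∫ σ, a σ : ℝ) * (Real.pi / L * (b n * (f (Real.log n / L) / n))) := fun n => by
    rcases eq_or_ne n 0 with rfl | hn
    · simp [hg0, hFb.zero]
    · simp only [hgn]
      rw [MeasureTheory.integral_add ((hi1 n hn).const_mul _) ((hi2 n hn).const_mul _),
        MeasureTheory.integral_const_mul, MeasureTheory.integral_const_mul,
        integral_strip_logMellin_mul_cpow hf hs hL ham haK ha hn,
        integral_strip_logMellin_mul_conj_cpow hf hs h1 hL ham haK ha hn]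
      ring
  have hbound : ∀ n z, ‖g n z‖ ≤ ‖b n * (n : ℂ) ^ (-(p : ℂ))‖ *
      ‖(a z.re : ℂ) * logMellin f L z‖ := fun n z => by
    rcases eq_or_ne n 0 with rfl | hn
    · simp [hg0, hFb.zero]
    by_cases hz : z.re ∈ Set.Icc p q
    · have h2 : ‖b n * (n : ℂ) ^ (-z)‖ ≤ ‖b n * (n : ℂ) ^ (-(p : ℂ))‖ := by
        rw [norm_mul, norm_mul]
        gcongr
        exact hnorm n z hn hz
      simp only [hg]
      rw [← mul_assoc, norm_div, norm_mul, mul_comm]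
      have h3 : ‖b n * (n : ℂ) ^ (-z) + (starRingEnd ℂ) (b n * (n : ℂ) ^ (-z))‖ ≤
          2 * ‖b n * (n : ℂ) ^ (-(p : ℂ))‖ := by
        refine (norm_add_le _ _).trans ?_
        rw [Complex.norm_conj]
        linarith
      have := mul_le_mul_of_nonneg_right h3 (norm_nonneg ((a z.re : ℂ) * logMellin f L z))
      have h4 : ‖(2 : ℂ)‖ = 2 := by simp
      rw [h4]
      linarith
    · simp [hg, ha _ hz]
  have hsp : Summable fun n : ℕ => ‖b n * (n : ℂ) ^ (-(p : ℂ))‖ :=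
    (hFb.summable p (by simpa using hp)).norm
  have hpt : ∀ z, HasSum (fun n => g n z) (Real.log ‖F z‖ • ((a z.re : ℂ) * logMellin f L z)) := by
    intro z
    by_cases hz : z.re ∈ Set.Icc p q
    · have hz1 : 1 < z.re := hp.trans_le hz.1
      have hS := (hFb.summable z hz1).hasSum
      have hS' := Complex.hasSum_conj'.2 hS
      have h5 := ((hS.add hS').mul_left ((a z.re : ℂ) * logMellin f L z)).div_const 2
      convert! h5 using 1
      · funext n
        simp only [hg]
        ring
      · rw [hFb.log_norm z hz1, Complex.add_conj, Complex.real_smul]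
        push_cast
        ring
    · have : ∀ n, g n z = 0 := fun n => by simp [hg, ha _ hz]
      simp only [this, ha _ hz]
      simp
  have hsum := MeasureTheory.hasSum_integral_of_summable_integral_norm hgi
    ((hsp.mul_right (∫ z, ‖(a z.re : ℂ) * logMellin f L z‖)).of_nonneg_of_le
      (fun n => MeasureTheory.integral_nonneg fun z => norm_nonneg _) fun n => by
        rw [← MeasureTheory.integral_const_mul]
        exact MeasureTheory.integral_mono (hgi n).norm (hi0.norm.const_mul _) (hbound n))
  simp only [hgint, fun z => (hpt z).tsum_eq] at hsum
  refine ⟨?_, hsum⟩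
  refine (hi0.norm.const_mul (∑' n, ‖b n * (n : ℂ) ^ (-(p : ℂ))‖)).mono' ?_
    (Filter.Eventually.of_forall fun z => ?_)
  · have hc : HasCompactSupport f := isCompact_Icc.of_isClosed_subset (isClosed_tsupport f) hs
    exact ((measurable_log_norm hF).smul ((Complex.measurable_ofReal.comp
      (ham.comp Complex.measurable_re)).mul
        (continuous_logMellin hf.continuous hc L).measurable)).aestronglyMeasurable
  · rw [← (hpt z).tsum_eq, ← tsum_mul_right]
    exact tsum_of_norm_bounded (hsp.mul_right _).hasSum (hbound · z)

theorem stripWeight_nonneg (u : ℂ) : 0 ≤ stripWeight u := by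
  unfold stripWeight
  split_ifs <;> positivity

theorem IsCutoff.integral_indicator {c r R K p q : ℝ} {f f' f'' : ℝ → ℝ}
    (hf : IsCutoff c r R K f f' f'') (hpq : p ≤ q) :
    ∫ t, (Set.Ioc p q).indicator f' t = f q - f p ∧
      ∫ t, (Set.Ioc p q).indicator f'' t = f' q - f' p := by
  have hc' : Continuous f' := continuous_iff_continuousAt.2 fun t => (hf.deriv2 t).continuousAt
  constructor
  · rw [MeasureTheory.integral_indicator measurableSet_Ioc,
      ← intervalIntegral.integral_of_le hpq]
    exact intervalIntegral.integral_eq_sub_of_hasDerivAt (fun t _ => hf.deriv1 t)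
      (hc'.intervalIntegrable _ _)
  · rw [MeasureTheory.integral_indicator measurableSet_Ioc,
      ← intervalIntegral.integral_of_le hpq]
    exact intervalIntegral.integral_eq_sub_of_hasDerivAt (fun t _ => hf.deriv2 t)
      (hf.cont.intervalIntegrable _ _)

theorem exists_explicit_formula_le {g : ℝ → ℂ} {α₁ α₂ : ℝ} (h1 : 0 < α₁) (h2 : α₂ ≤ 1)
    (hg : ContDiff ℝ (⊤ : ℕ∞) g) (hs : tsupport g ⊆ Set.Icc α₁ α₂) :
    ∃ C : ℝ, 0 < C ∧ ∀ (L Q : ℝ) (F : ℂ → ℂ) (b : ℕ → ℂ), 1 ≤ L → IsStripBounded F Q →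
      HasLogSeries F b →
      Summable (fun ρ : {ρ : ℂ // F ρ = 0 ∧ 0 < ρ.re ∧ ρ.re < 1} =>
        (analyticOrderNatAt F ρ : ℝ) * ‖logMellin g L ρ‖) ∧
      ‖∑' n : ℕ, b n * ((Real.log n / L : ℝ) * g (Real.log n / L) / n) +
          ∑' ρ : {ρ : ℂ // F ρ = 0 ∧ 0 < ρ.re ∧ ρ.re < 1},
            (analyticOrderNatAt F ρ : ℂ) * logMellin g L ρ‖ ≤
        C * L * Real.exp (-(3 / 4 * α₁ * L)) * Q := by
  obtain ⟨CR, hCR, hR⟩ := exists_bound_integral_strip_log_norm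
  obtain ⟨CZ, hCZ, hZ⟩ := exists_sum_zeros_stripWeight_le
  obtain ⟨K, f, f', f'', hf⟩ := exists_isCutoff (3 / 4) (r := 1 / 2) (R := 5 / 8) (by norm_num)
    (by norm_num)
  have hK := hf.one_le
  set g1 : ℝ → ℂ := fun u => u * g u with hg1
  have hid : ContDiff ℝ (⊤ : ℕ∞) (fun u : ℝ => (u : ℂ)) := Complex.ofRealCLM.contDiff
  have hg1c : ContDiff ℝ (⊤ : ℕ∞) g1 := hid.mul hg
  have hs1 : tsupport g1 ⊆ Set.Icc α₁ α₂ := (tsupport_ofReal_mul_subset g).trans hs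
  have hg2c : ContDiff ℝ (⊤ : ℕ∞) fun u : ℝ => (u : ℂ) * g1 u := hid.mul hg1c
  have hcs : HasCompactSupport g := isCompact_Icc.of_isClosed_subset (isClosed_tsupport g) hs
  have hcs1 : HasCompactSupport g1 := isCompact_Icc.of_isClosed_subset (isClosed_tsupport _) hs1
  have hcs2 : HasCompactSupport fun u : ℝ => (u : ℂ) * g1 u := hcs1.mul_left
  obtain ⟨C0, hC0, hb0⟩ := exists_norm_logMellin_le hg hs
  obtain ⟨C1, hC1, hb1⟩ := exists_norm_logMellin_le hg1c hs1
  refine ⟨(2 * Real.pi)⁻¹ * (K * (C0 + 2 * C1) * CR) + C0 * CZ, by positivity, ?_⟩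
  intro L Q F b hL hFQ hFb
  obtain ⟨hi, hle⟩ := hR F Q hFQ.differentiable hFQ.nonneg hFQ.upper hFQ.lower
  obtain ⟨hZs, hZle⟩ := hZ F Q hFQ
  have hL0 : 0 < L := by linarith
  set E : ℝ := Real.exp (-(3 / 4 * α₁ * L)) with hE
  have hEpos : 0 < E := Real.exp_pos _
  set w : ℝ → ℝ := fun t => ((1 + t ^ 2) ^ 2)⁻¹ with hw
  have hwpos : ∀ t, 0 < w t := fun t => by positivity
  have hcL : ∀ σ : ℝ, σ ≤ 11 / 8 → ∀ u ∈ Set.Icc α₁ α₂, L * u * (σ - 1) ≤ L := fun σ hσ u hu => by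
    have hu0 : 0 ≤ u := h1.le.trans hu.1
    have hu1 : u ≤ 1 := hu.2.trans h2
    nlinarith [mul_nonneg hL0.le hu0, mul_le_mul_of_nonneg_left hu1 hL0.le]
  have hcE : ∀ σ : ℝ, σ ≤ 1 / 4 → ∀ u ∈ Set.Icc α₁ α₂,
      L * u * (σ - 1) ≤ -(3 / 4 * α₁ * L) := fun σ hσ u hu => by
    have h3 : L * α₁ ≤ L * u := mul_le_mul_of_nonneg_left hu.1 hL0.le
    nlinarith [mul_nonneg hL0.le h1.le]
  set P : ℂ → ℂ := logMellin g L with hPdef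
  set P1 : ℂ → ℂ := fun s => L * logMellin g1 L s with hP1def
  have hP0 : ∀ s, HasDerivAt P (P1 s) s := fun s => hasDerivAt_logMellin hg.continuous hcs L s
  have hP1 : ∀ s, HasDerivAt P1 (L * (L * logMellin (fun u => u * g1 u) L s)) s := fun s =>
    (hasDerivAt_logMellin hg1c.continuous hcs1 L s).const_mul _
  have hPart := (hasPartials_re (f := fun t => (f t : ℂ)) (fun t => (hf.deriv1 t).ofReal_comp)
    (fun t => (hf.deriv2 t).ofReal_comp) (Complex.continuous_ofReal.comp hf.cont)).mul
    (hasPartials_of_hasDerivAt hP0 hP1 (continuous_const.mul (continuous_const.mul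
      (continuous_logMellin hg2c.continuous hcs2 L))))
  have hout : ∀ t : ℝ, t ∉ Set.Icc (1 / 8 : ℝ) (11 / 8) → f t = 0 ∧ f' t = 0 ∧ f'' t = 0 :=
    fun t ht => hf.eq_zero t (by
      by_contra! h
      rw [abs_le] at h
      exact ht ⟨by linarith, by linarith⟩)
  have habs : ∀ t, |f t| ≤ 1 := fun t => abs_le.2 ⟨by linarith [hf.nonneg t], hf.le_one t⟩
  have hPn : ∀ (c : ℝ) (z : ℂ), (∀ u ∈ Set.Icc α₁ α₂, L * u * (z.re - 1) ≤ c) →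
      ‖P z‖ ≤ C0 * Real.exp c * w z.im ∧ ‖P1 z‖ ≤ L * (C1 * Real.exp c * w z.im) := fun c z h => by
    refine ⟨hb0 L c z hL h, ?_⟩
    simp only [hP1def]
    rw [norm_mul, Complex.norm_real, Real.norm_of_nonneg hL0.le]
    gcongr
    exact hb1 L c z hL h
  have hcomb : ∀ (c x y : ℝ) (z : ℂ), (∀ u ∈ Set.Icc α₁ α₂, L * u * (z.re - 1) ≤ c) →
      |x| ≤ K → |y| ≤ 2 * K → ‖(x : ℂ) * P z + y * P1 z‖ ≤
        K * (C0 + 2 * C1) * L * Real.exp c * w z.im := fun c x y z h hx hy => by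
    obtain ⟨hp0, hp1⟩ := hPn c z h
    have h3 : 0 ≤ C0 * Real.exp c * w z.im := by
      have := hwpos z.im
      positivity
    calc _ ≤ |x| * ‖P z‖ + |y| * ‖P1 z‖ := by
          refine (norm_add_le _ _).trans (le_of_eq ?_)
          rw [norm_mul, norm_mul, Complex.norm_real, Complex.norm_real, Real.norm_eq_abs,
            Real.norm_eq_abs]
      _ ≤ K * (L * (C0 * Real.exp c * w z.im)) + 2 * K * (L * (C1 * Real.exp c * w z.im)) := by
          gcongr
          exact hp0.trans (le_mul_of_one_le_left h3 hL)
      _ = _ := by ring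
  set ind : ℝ → ℝ → ℂ → ℝ := fun p q z => (Set.Icc p q).indicator (fun _ => (1 : ℝ)) z.re * w z.im
    with hind
  set M : ℝ := K * (C0 + 2 * C1) * L with hM
  have hM0 : 0 < M := by positivity
  have hindm : ∀ p q, Measurable (ind p q) := fun p q => by
    refine Measurable.mul ?_ ?_
    · exact (measurable_const.indicator measurableSet_Icc).comp Complex.measurable_re
    · exact (show Measurable w by fun_prop).comp Complex.measurable_im
  set S : Set ℂ := {z : ℂ | -1 / 8 ≤ z.re ∧ z.re ≤ 3 / 2} with hS
  have hSm : MeasurableSet S := MeasurableSet.inter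
    (measurableSet_le measurable_const Complex.measurable_re)
    (measurableSet_le Complex.measurable_re measurable_const)
  have hdom : MeasureTheory.Integrable fun z => S.indicator (fun z => ‖Real.log ‖F z‖ * w z.im‖) z :=
    (MeasureTheory.integrable_indicator_iff hSm).2 hi.norm
  have hindle : ∀ p q : ℝ, -1 / 8 ≤ p → q ≤ 3 / 2 → ∀ z, ‖Real.log ‖F z‖ * ind p q z‖ ≤
      S.indicator (fun z => ‖Real.log ‖F z‖ * w z.im‖) z := fun p q hp hq z => by
    by_cases hz : z.re ∈ Set.Icc p q
    · have hz' : z ∈ S := ⟨hp.trans hz.1, hz.2.trans hq⟩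
      simp only [hind, Set.indicator_of_mem hz, Set.indicator_of_mem hz', one_mul]
      exact le_rfl
    · simp only [hind, Set.indicator_of_notMem hz]
      simp only [zero_mul, mul_zero, norm_zero]
      exact Set.indicator_nonneg (fun z _ => norm_nonneg _) _
  have hindi : ∀ p q : ℝ, -1 / 8 ≤ p → q ≤ 3 / 2 → MeasureTheory.Integrable
      fun z => Real.log ‖F z‖ * ind p q z := fun p q hp hq =>
    hdom.mono' ((measurable_log_norm hFQ.differentiable).mul (hindm p q)).aestronglyMeasurable
      (Filter.Eventually.of_forall (hindle p q hp hq))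
  set A : ℂ → ℂ := fun z => (f'' z.re : ℂ) * P z + (2 * f' z.re : ℝ) * P1 z with hA
  set B : ℂ → ℝ := fun z => M * Real.exp L * ind (1 / 8) (11 / 8) z with hB
  have hBb : ∀ (x y : ℝ) (z : ℂ), |x| ≤ K → |y| ≤ 2 * K →
      (z.re ∉ Set.Icc (1 / 8 : ℝ) (11 / 8) → x = 0 ∧ y = 0) →
      ‖(x : ℂ) * P z + y * P1 z‖ ≤ B z := fun x y z hx hy h0 => by
    by_cases hz : z.re ∈ Set.Icc (1 / 8 : ℝ) (11 / 8)
    · simp only [hB, hind, Set.indicator_of_mem hz, one_mul]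
      exact hcomb L x y z (hcL _ hz.2) hx hy
    · obtain ⟨rfl, rfl⟩ := h0 hz
      simp only [hB, hind, Set.indicator_of_notMem hz]
      simp
  have h2K : ∀ x : ℝ, |x| ≤ K → |2 * x| ≤ 2 * K := fun x hx => by
    rw [abs_mul, abs_of_pos (two_pos)]
    linarith
  have hzero : ∀ u, analyticOrderNatAt F u ≠ 0 → F u = 0 := fun u hu => by
    by_contra h
    exact hu (by simp [analyticOrderNatAt,
      ((hFQ.differentiable.analyticAt u).analyticOrderAt_eq_zero).2 h])
  have hre1 : ∀ u, F u = 0 → u.re < 1 := fun u hu => by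
    by_contra! h
    exact hFb.ne_zero u h hu
  set Ψ : ℂ → ℂ := fun z => (f z.re : ℂ) * P z with hΨ
  have hΨs : Summable fun u => (analyticOrderNatAt F u : ℝ) * ‖Ψ u‖ := by
    refine (hZs.mul_left (C0 * Real.exp L)).of_nonneg_of_le (fun u => by positivity) fun u => ?_
    by_cases hu : analyticOrderNatAt F u = 0
    · simp [hu]
    by_cases hz : u.re ∈ Set.Icc (1 / 8 : ℝ) (11 / 8)
    · have hst : stripWeight u = w u.im :=
        if_pos ⟨by linarith [hz.1], (hre1 u (hzero u hu)).le⟩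
      rw [hst, mul_left_comm]
      gcongr
      simp only [hΨ]
      rw [norm_mul, Complex.norm_real, Real.norm_eq_abs]
      exact (mul_le_of_le_one_left (norm_nonneg _) (habs _)).trans (hPn L u (hcL _ hz.2)).1
    · simp only [hΨ, (hout _ hz).1]
      simp only [Complex.ofReal_zero, zero_mul, norm_zero, mul_zero]
      have := stripWeight_nonneg u
      positivity
  have hsum := hPart.hasSum_of_summable hFQ.differentiable ⟨_, (hFQ.lower 0).1⟩ (B := B)
    (a := 11 / 8)
    (fun z => by
      have := hBb (f z.re) 0 z ((habs _).trans hK) (by simp; linarith)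
        fun h => ⟨(hout _ h).1, rfl⟩
      simp only [Complex.ofReal_zero, zero_mul, add_zero] at this
      exact this)
    (fun z => by
      have := hBb 0 (f z.re) z (by simp; linarith) ((habs _).trans (by linarith))
        fun h => ⟨rfl, (hout _ h).1⟩
      simp only [Complex.ofReal_zero, zero_mul, zero_add, norm_mul, Complex.norm_I, one_mul]
        at this ⊢
      exact this)
    (fun z => by
      have := hBb (f'' z.re) (2 * f' z.re) z (hf.bound2 _) (h2K _ (hf.bound1 _))
        fun h => ⟨(hout _ h).2.2, by rw [(hout _ h).2.1, mul_zero]⟩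
      convert this using 2
      push_cast
      ring)
    (by
      convert! (hindi (1 / 8) (11 / 8) (by norm_num) (by norm_num)).const_mul (M * Real.exp L)
        using 2
      simp only [hB]
      ring)
    (fun z hz => by
      by_contra! hc
      apply hz
      have : z.re ∉ Set.Icc (1 / 8 : ℝ) (11 / 8) := fun h => by
        rw [abs_of_nonneg (by linarith [h.1])] at hc
        linarith [h.2]
      have h0 := (hout _ this).1
      change (f z.re : ℂ) * P z = 0
      rw [h0, Complex.ofReal_zero, zero_mul])
    (Or.inl hΨs)
  have hAeq : ∀ z : ℂ, (f'' z.re : ℂ) * P z + 2 * ((f' z.re : ℂ) * P1 z) +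
      (f z.re : ℂ) * (L * (L * logMellin (fun u => u * g1 u) L z)) + (0 * P z +
        2 * (0 * (Complex.I * P1 z)) +
        (f z.re : ℂ) * -(L * (L * logMellin (fun u => u * g1 u) L z))) = A z := fun z => by
    simp only [hA]
    push_cast
    ring
  simp only [hAeq] at hsum
  set a2 : ℝ → ℝ := (Set.Ioc (3 / 4) 2).indicator f'' with ha2
  set a1 : ℝ → ℝ := (Set.Ioc (3 / 4) 2).indicator f' with ha1
  have hc' : Continuous f' := continuous_iff_continuousAt.2 fun t => (hf.deriv2 t).continuousAt
  have hIcc : ∀ t : ℝ, t ∉ Set.Icc (5 / 4 : ℝ) (11 / 8) → a1 t = 0 ∧ a2 t = 0 := fun t ht => by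
    by_cases h3 : t ∈ Set.Ioc (3 / 4 : ℝ) 2
    · simp only [ha1, ha2, Set.indicator_of_mem h3]
      by_cases h4 : t < 5 / 4
      · exact hf.deriv_eq_zero t (abs_lt.2 ⟨by linarith [h3.1], by linarith⟩)
      · exact (hout t fun h5 => ht ⟨not_lt.1 h4, h5.2⟩).2
    · simp only [ha1, ha2, Set.indicator_of_notMem h3, and_self]
  have hK0 : 0 ≤ K := by linarith
  have ha1K : ∀ t, |a1 t| ≤ K := fun t => by
    simp only [ha1, Set.indicator_apply]
    split_ifs
    · exact hf.bound1 t
    · simpa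
  have ha2K : ∀ t, |a2 t| ≤ K := fun t => by
    simp only [ha2, Set.indicator_apply]
    split_ifs
    · exact hf.bound2 t
    · simpa
  obtain ⟨hi2, hs2⟩ := hasSum_integral_log_norm h1 hg hs hL hFQ.differentiable hFb
    (p := 5 / 4) (by norm_num) (hf.cont.measurable.indicator measurableSet_Ioc) ha2K
    fun t ht => (hIcc t ht).2
  obtain ⟨hi1, hs1'⟩ := hasSum_integral_log_norm h1 hg1c hs1 hL hFQ.differentiable hFb
    (p := 5 / 4) (by norm_num) (hc'.measurable.indicator measurableSet_Ioc) ha1K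
    fun t ht => (hIcc t ht).1
  have hint1 : ∫ σ, a1 σ = -1 := by
    rw [ha1, (hf.integral_indicator (by norm_num)).1, hf.eq_one (3 / 4) (by norm_num),
      (hout 2 fun h => by linarith [h.2]).1]
    norm_num
  have hint2 : ∫ σ, a2 σ = 0 := by
    rw [ha2, (hf.integral_indicator (by norm_num)).2, (hf.deriv_eq_zero (3 / 4) (by norm_num)).1,
      (hout 2 fun h => by linarith [h.2]).2.1]
    norm_num
  set AL : ℂ → ℂ := fun z => ((f'' z.re - a2 z.re : ℝ) : ℂ) * P z +
    (2 * (f' z.re - a1 z.re) : ℝ) * P1 z with hAL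
  have hALle : ∀ z, ‖AL z‖ ≤ M * E * ind (1 / 8) (1 / 4) z := fun z => by
    by_cases hz : z.re ∈ Set.Icc (1 / 8 : ℝ) (1 / 4)
    · have h5 : z.re ∉ Set.Icc (5 / 4 : ℝ) (11 / 8) := fun h => by linarith [h.1, hz.2]
      simp only [hAL, hind, Set.indicator_of_mem hz, one_mul, (hIcc _ h5).1, (hIcc _ h5).2,
        sub_zero]
      exact hcomb _ _ _ z (hcE _ hz.2) (hf.bound2 _) (h2K _ (hf.bound1 _))
    · have h6 : f' z.re - a1 z.re = 0 ∧ f'' z.re - a2 z.re = 0 := by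
        by_cases h3 : z.re ∈ Set.Ioc (3 / 4 : ℝ) 2
        · simp only [ha1, ha2, Set.indicator_of_mem h3, sub_self, and_self]
        · simp only [ha1, ha2, Set.indicator_of_notMem h3, sub_zero]
          by_cases h4 : z.re ∈ Set.Icc (1 / 8 : ℝ) (11 / 8)
          · have h7 : 1 / 4 < z.re := by
              by_contra! h
              exact hz ⟨h4.1, h⟩
            have h8 : z.re ≤ 3 / 4 := by
              by_contra! h
              exact h3 ⟨h, by linarith [h4.2]⟩
            exact hf.deriv_eq_zero _ (abs_lt.2 ⟨by linarith, by linarith⟩)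
          · exact (hout _ h4).2
      simp only [hAL, hind, Set.indicator_of_notMem hz, h6.1, h6.2]
      simp
  have hALle' : ∀ z, ‖Real.log ‖F z‖ • AL z‖ ≤
      M * E * S.indicator (fun z => ‖Real.log ‖F z‖ * w z.im‖) z := fun z => by
    have h7 := hindle (1 / 8) (1 / 4) (by norm_num) (by norm_num) z
    have h8 : 0 ≤ ind (1 / 8) (1 / 4) z :=
      mul_nonneg (Set.indicator_nonneg (fun _ _ => zero_le_one) _) (hwpos _).le
    rw [norm_mul, Real.norm_of_nonneg h8] at h7
    calc _ = ‖Real.log ‖F z‖‖ * ‖AL z‖ := norm_smul _ _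
      _ ≤ ‖Real.log ‖F z‖‖ * (M * E * ind (1 / 8) (1 / 4) z) := by gcongr; exact hALle z
      _ = M * E * (‖Real.log ‖F z‖‖ * ind (1 / 8) (1 / 4) z) := by ring
      _ ≤ _ := by gcongr
  have hALm : Measurable AL :=
    ((Complex.measurable_ofReal.comp ((hf.cont.measurable.sub
      (hf.cont.measurable.indicator measurableSet_Ioc)).comp Complex.measurable_re)).mul
        (continuous_logMellin hg.continuous hcs L).measurable).add
    ((Complex.measurable_ofReal.comp (((hc'.measurable.sub
      (hc'.measurable.indicator measurableSet_Ioc)).const_mul 2).comp Complex.measurable_re)).mul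
        ((continuous_logMellin hg1c.continuous hcs1 L).measurable.const_mul _))
  have hALi : MeasureTheory.Integrable fun z => Real.log ‖F z‖ • AL z :=
    (hdom.const_mul (M * E)).mono'
      ((measurable_log_norm hFQ.differentiable).smul hALm).aestronglyMeasurable
      (Filter.Eventually.of_forall hALle')
  have hALint : ‖∫ z, Real.log ‖F z‖ • AL z‖ ≤ M * E * (CR * Q) := by
    refine (MeasureTheory.norm_integral_le_of_norm_le (hdom.const_mul (M * E))
      (Filter.Eventually.of_forall hALle')).trans ?_
    rw [MeasureTheory.integral_const_mul, MeasureTheory.integral_indicator hSm]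
    gcongr
  set Sb : ℂ := ∑' n : ℕ, b n * ((Real.log n / L : ℝ) * g (Real.log n / L) / n) with hSb
  have hsplit : ∫ z, Real.log ‖F z‖ • A z = (∫ z, Real.log ‖F z‖ • AL z) - 2 * Real.pi * Sb := by
    have e : ∀ z, Real.log ‖F z‖ • A z = Real.log ‖F z‖ • AL z +
        (Real.log ‖F z‖ • ((a2 z.re : ℂ) * logMellin g L z) +
          2 * L * (Real.log ‖F z‖ • ((a1 z.re : ℂ) * logMellin g1 L z))) := fun z => by
      simp only [hA, hAL, hP1def, hPdef, Complex.real_smul]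
      push_cast
      ring
    have hj2 : MeasureTheory.Integrable fun z =>
        Real.log ‖F z‖ • ((a2 z.re : ℂ) * logMellin g L z) := hi2
    have hj1 : MeasureTheory.Integrable fun z =>
        2 * L * (Real.log ‖F z‖ • ((a1 z.re : ℂ) * logMellin g1 L z)) := hi1.const_mul _
    have hj : MeasureTheory.Integrable fun z =>
        (Real.log ‖F z‖ • ((a2 z.re : ℂ) * logMellin g L z) +
          2 * L * (Real.log ‖F z‖ • ((a1 z.re : ℂ) * logMellin g1 L z))) := hj2.add hj1
    simp only [e]
    rw [MeasureTheory.integral_add hALi hj, MeasureTheory.integral_add hj2 hj1,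
      MeasureTheory.integral_const_mul, ← hs2.tsum_eq, ← hs1'.tsum_eq, hint1, hint2,
      sub_eq_add_neg]
    congr 1
    simp only [Complex.ofReal_zero, zero_mul, tsum_zero, zero_add]
    rw [tsum_mul_left, tsum_mul_left]
    have : (L : ℂ) ≠ 0 := by exact_mod_cast hL0.ne'
    simp only [hg1, hSb]
    push_cast
    field_simp
  rw [hsplit] at hsum
  have hzs : Summable fun ρ : {ρ : ℂ // F ρ = 0 ∧ 0 < ρ.re ∧ ρ.re < 1} =>
      (analyticOrderNatAt F ρ : ℝ) * ‖P ρ‖ := by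
    refine ((hZs.mul_left (C0 * Real.exp L)).comp_injective
      Subtype.val_injective).of_nonneg_of_le (fun u => by positivity) ?_
    rintro ⟨u, hu0, hu1, hu2⟩
    have hst : stripWeight u = w u.im := if_pos ⟨hu1.le, hu2.le⟩
    simp only [Function.comp_apply]
    rw [hst, mul_left_comm]
    gcongr
    exact (hPn L u (hcL _ (by linarith))).1
  refine ⟨hzs, ?_⟩
  set T : Set ℂ := {ρ : ℂ | F ρ = 0 ∧ 0 < ρ.re ∧ ρ.re < 1} with hT
  set Z : ℂ → ℂ := T.indicator fun ρ => (analyticOrderNatAt F ρ : ℂ) * P ρ with hZdef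
  have hZsum : HasSum Z (∑' ρ : T, (analyticOrderNatAt F ρ : ℂ) * P ρ) := by
    have h9 : Summable fun ρ : T => (analyticOrderNatAt F ρ : ℂ) * P ρ :=
      by
      refine Summable.of_norm ?_
      simp only [norm_mul, Complex.norm_natCast]
      exact hzs
    exact hasSum_subtype_iff_indicator.1 h9.hasSum
  have hdiff : ∀ u, ‖Z u - (analyticOrderNatAt F u : ℂ) * Ψ u‖ ≤
      C0 * E * ((analyticOrderNatAt F u : ℝ) * stripWeight u) := fun u => by
    have hnn : 0 ≤ C0 * E * ((analyticOrderNatAt F u : ℝ) * stripWeight u) :=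
      mul_nonneg (by positivity) (mul_nonneg (Nat.cast_nonneg _) (stripWeight_nonneg u))
    by_cases hu : analyticOrderNatAt F u = 0
    · simp [hZdef, hu]
    have hFu := hzero u hu
    by_cases hu0 : 0 < u.re
    · have huT : u ∈ T := ⟨hFu, hu0, hre1 u hFu⟩
      have hst : stripWeight u = w u.im := if_pos ⟨hu0.le, (hre1 u hFu).le⟩
      simp only [hZdef, Set.indicator_of_mem huT, hΨ]
      by_cases hq : u.re ≤ 1 / 4
      · have e : (analyticOrderNatAt F u : ℂ) * P u - analyticOrderNatAt F u * (f u.re * P u) =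
            analyticOrderNatAt F u * ((1 - f u.re : ℝ) * P u) := by
          push_cast
          ring
        rw [e, hst, norm_mul, Complex.norm_natCast, mul_left_comm (C0 * E)]
        gcongr
        rw [norm_mul, Complex.norm_real, Real.norm_eq_abs,
          abs_of_nonneg (by linarith [hf.le_one u.re])]
        exact (mul_le_of_le_one_left (norm_nonneg _) (by linarith [hf.nonneg u.re])).trans
          (hPn _ u (hcE _ hq)).1
      · rw [hf.eq_one u.re (abs_le.2 ⟨by linarith, by linarith [hre1 u hFu]⟩)]
        simpa using hnn
    · have huT : u ∉ T := fun h => hu0 h.2.1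
      simp only [hZdef, Set.indicator_of_notMem huT, hΨ,
        (hout u.re fun h => hu0 (by linarith [h.1])).1]
      simpa using hnn
  have hZΨ := hZsum.sub hsum
  have hnormZ : ‖∑' ρ : T, (analyticOrderNatAt F ρ : ℂ) * P ρ - (2 * Real.pi)⁻¹ •
      ((∫ z, Real.log ‖F z‖ • AL z) - 2 * Real.pi * Sb)‖ ≤ C0 * E * (CZ * Q) := by
    rw [← hZΨ.tsum_eq]
    refine (tsum_of_norm_bounded (hZs.mul_left _).hasSum hdiff).trans ?_
    rw [tsum_mul_left]
    gcongr
  have hpi : (Real.pi : ℂ) ≠ 0 := by exact_mod_cast Real.pi_ne_zero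
  have efin : Sb + ∑' ρ : T, (analyticOrderNatAt F ρ : ℂ) * P ρ =
      (∑' ρ : T, (analyticOrderNatAt F ρ : ℂ) * P ρ - (2 * Real.pi)⁻¹ •
      ((∫ z, Real.log ‖F z‖ • AL z) - 2 * Real.pi * Sb)) +
        (2 * Real.pi)⁻¹ • ∫ z, Real.log ‖F z‖ • AL z := by
    simp only [Complex.real_smul]
    push_cast
    field_simp
    ring
  have hQ := hFQ.nonneg
  calc _ = ‖Sb + ∑' ρ : T, (analyticOrderNatAt F ρ : ℂ) * P ρ‖ := rfl
    _ ≤ C0 * E * (CZ * Q) + (2 * Real.pi)⁻¹ * (M * E * (CR * Q)) := by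
        rw [efin]
        refine (norm_add_le _ _).trans (add_le_add hnormZ ?_)
        rw [norm_smul, Real.norm_of_nonneg (by positivity)]
        gcongr
    _ ≤ C0 * E * (CZ * Q) * L + (2 * Real.pi)⁻¹ * (M * E * (CR * Q)) := by
        exact add_le_add_left (le_mul_of_one_le_right (by positivity) hL) _
    _ = _ := by
        rw [hM]
        ring

set_option maxHeartbeats 2000000 in
theorem hasSum_prod_pow_of_fintype {ι : Type*} [Fintype ι] (g : ι → ℂ) (hg : ∀ i, ‖g i‖ < 1) :
    (Summable fun v : ι → ℕ => ‖∏ i, g i ^ v i‖) ∧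
      HasSum (fun v : ι → ℕ => ∏ i, g i ^ v i) (∏ i, (1 - g i)⁻¹) := by
  revert g
  refine Fintype.induction_empty_option (P := fun ι [Fintype ι] => ∀ g : ι → ℂ,
    (∀ i, ‖g i‖ < 1) → (Summable fun v : ι → ℕ => ‖∏ i, g i ^ v i‖) ∧
      HasSum (fun v : ι → ℕ => ∏ i, g i ^ v i) (∏ i, (1 - g i)⁻¹)) ?_ ?_ ?_ ι
  · intro α β _ e ih g hg
    let _ := Fintype.ofEquiv β e.symm
    have h := ih (g ∘ e) fun i => hg _
    obtain ⟨E, hE⟩ : ∃ E : (β → ℕ) ≃ (α → ℕ), ∀ v i, E v i = v (e i) :=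
      ⟨(e.arrowCongr (Equiv.refl ℕ)).symm, fun v i => rfl⟩
    have e1 : ∀ v : β → ℕ, ∏ i, g i ^ v i = ∏ i : α, (g ∘ e) i ^ E v i := fun v => by
      rw [← Equiv.prod_comp e fun i => g i ^ v i]
      simp only [hE, Function.comp_apply]
    have e2 : ∏ i, (1 - g i)⁻¹ = ∏ i, (1 - (g ∘ e) i)⁻¹ :=
      (Equiv.prod_comp e fun i => (1 - g i)⁻¹).symm
    simp only [e1, e2]
    have k1 := E.summable_iff.2 h.1
    have k2 := E.hasSum_iff.2 h.2
    simp only [Function.comp_def] at k1 k2 ⊢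
    exact ⟨k1, k2⟩
  · intro g _
    simp only [Finset.univ_eq_empty, Finset.prod_empty]
    exact ⟨(hasSum_fintype _).summable, by simp⟩
  · intro α _ ih g hg
    have h := ih (fun i => g (some i)) fun i => hg _
    have h0s : Summable fun k : ℕ => ‖g none ^ k‖ := by
      simp only [norm_pow]
      exact summable_geometric_of_lt_one (norm_nonneg _) (hg _)
    have h0 := hasSum_geometric_of_norm_lt_one (hg none)
    have key := h0.mul h.2 (summable_mul_of_summable_norm
      (f := fun k : ℕ => g none ^ k) (g := fun v : α → ℕ => ∏ i, g (some i) ^ v i) h0s h.1)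
    obtain ⟨E, hE1, hE2⟩ : ∃ E : (Option α → ℕ) ≃ ℕ × (α → ℕ),
        (∀ v, (E v).1 = v none) ∧ ∀ v i, (E v).2 i = v (some i) :=
      ⟨Equiv.piOptionEquivProd (β := fun _ : Option α => ℕ), fun v => rfl, fun v i => rfl⟩
    have e1 : ∀ v : Option α → ℕ, ∏ i, g i ^ v i =
        g none ^ (E v).1 * ∏ i, g (some i) ^ (E v).2 i := fun v => by
      rw [Fintype.prod_option]
      simp only [hE1, hE2]
    have e2 : ∏ i, (1 - g i)⁻¹ = (1 - g none)⁻¹ * ∏ i, (1 - g (some i))⁻¹ :=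
      Fintype.prod_option _
    have k1 := E.summable_iff.2 (h0s.mul_norm h.1)
    have k2 := E.hasSum_iff.2 key
    simp only [Function.comp_def] at k1 k2
    simp only [e1, e2]
    exact ⟨k1, k2⟩

theorem hasSum_finsupp_support_subset {ι : Type*} (g : ι → ℂ) (hg : ∀ i, ‖g i‖ < 1)
    (S : Finset ι) :
    (Summable fun v : ι →₀ ℕ => if v.support ⊆ S then ‖v.prod fun i k => g i ^ k‖ else 0) ∧
      HasSum (fun v : ι →₀ ℕ => if v.support ⊆ S then v.prod fun i k => g i ^ k else 0)
        (∏ i ∈ S, (1 - g i)⁻¹) := by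
  obtain ⟨h1, h2⟩ := hasSum_prod_pow_of_fintype (fun i : S => g i) fun i => hg _
  obtain ⟨e, he⟩ : ∃ e : {v : ι →₀ ℕ // (v.support : Set ι) ⊆ S} ≃ (S → ℕ),
      ∀ v (i : S), e v i = v.1 i :=
    ⟨(Finsupp.restrictSupportEquiv (S : Set ι) ℕ).trans Finsupp.equivFunOnFinite,
      fun v i => rfl⟩
  have hev : ∀ v : {v : ι →₀ ℕ // (v.support : Set ι) ⊆ S},
      v.1.prod (fun i k => g i ^ k) = ∏ i : S, g i ^ e v i := fun v => by
    rw [Finsupp.prod_of_support_subset _ (Finset.coe_subset.1 v.2) _ (by simp),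
      ← Finset.prod_coe_sort]
    simp only [he]
  rw [Finset.prod_coe_sort S fun i => (1 - g i)⁻¹] at h2
  have h1' := e.summable_iff.2 h1
  have h2' := e.hasSum_iff.2 h2
  simp only [Function.comp_def, ← hev] at h1' h2'
  have h3 := (summable_subtype_iff_indicator (s := {v : ι →₀ ℕ | (v.support : Set ι) ⊆ (S : Set ι)})
    (f := fun v : ι →₀ ℕ => ‖v.prod fun i k => g i ^ k‖)).1 h1'
  have h4 := (hasSum_subtype_iff_indicator (s := {v : ι →₀ ℕ | (v.support : Set ι) ⊆ (S : Set ι)})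
    (f := fun v : ι →₀ ℕ => v.prod fun i k => g i ^ k)).1 h2'
  exact ⟨h3.congr fun v => by simp [Set.indicator_apply],
    by
      convert! h4 using 1
      funext v
      simp [Set.indicator_apply]⟩

theorem norm_log_one_sub_le {z : ℂ} (hz : ‖z‖ ≤ 1 / 2) : ‖Complex.log (1 - z)‖ ≤ 2 * ‖z‖ := by
  have := Complex.norm_log_one_add_half_le_self (z := -z) (by simpa using hz)
  rw [norm_neg, ← sub_eq_add_neg] at this
  linarith [norm_nonneg z]

theorem hasSum_finsupp_prod_pow {ι : Type*} (g : ι → ℂ) (hg : ∀ i, ‖g i‖ ≤ 1 / 2)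
    (hs : Summable fun i => ‖g i‖) :
    (Summable fun v : ι →₀ ℕ => ‖v.prod fun i k => g i ^ k‖) ∧
      ∑' v : ι →₀ ℕ, ‖v.prod fun i k => g i ^ k‖ ≤ Real.exp (2 * ∑' i, ‖g i‖) ∧
      HasSum (fun v : ι →₀ ℕ => v.prod fun i k => g i ^ k)
        (Complex.exp (∑' i, -Complex.log (1 - g i))) := by
  have hlt : ∀ i, ‖g i‖ < 1 := fun i => (hg i).trans_lt (by norm_num)
  have hne : ∀ i, 1 - g i ≠ 0 := fun i h => by
    have := hlt i
    rw [← sub_eq_zero.1 h] at this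
    simp at this
  have hlogs : Summable fun i => -Complex.log (1 - g i) :=
    Summable.of_norm_bounded (hs.mul_left 2) fun i => by
      rw [norm_neg]
      exact norm_log_one_sub_le (hg i)
  have hexp : ∀ S : Finset ι, ∏ i ∈ S, (1 - g i)⁻¹ =
      Complex.exp (∑ i ∈ S, -Complex.log (1 - g i)) := fun S => by
    rw [Complex.exp_sum]
    refine Finset.prod_congr rfl fun i _ => ?_
    rw [Complex.exp_neg, Complex.exp_log (hne i)]
  have hbd : ∀ T : Finset (ι →₀ ℕ), ∑ v ∈ T, ‖v.prod fun i k => g i ^ k‖ ≤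
      Real.exp (2 * ∑' i, ‖g i‖) := fun T => by
    set S : Finset ι := T.biUnion fun v => v.support with hS
    set gr : ι → ℂ := fun i => (‖g i‖ : ℂ) with hgr
    have hnr : ∀ i, ‖gr i‖ = ‖g i‖ := fun i => by simp [hgr]
    have hcoe : ∀ v : ι →₀ ℕ, v.prod (fun i k => gr i ^ k) =
        ((‖v.prod fun i k => g i ^ k‖ : ℝ) : ℂ) := fun v => by
      simp [Finsupp.prod, hgr]
    obtain ⟨h1, h2⟩ := hasSum_finsupp_support_subset gr (fun i => by rw [hnr]; exact hlt i) S
    have hsum : HasSum (fun v : ι →₀ ℕ => if v.support ⊆ S then ‖v.prod fun i k => g i ^ k‖ else 0)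
        (∏ i ∈ S, (1 - ‖g i‖)⁻¹) := by
      rw [← Complex.hasSum_ofReal]
      convert! h2 using 1
      · funext v
        split_ifs
        · exact (hcoe v).symm
        · simp
      · simp [hgr]
    have h3 := sum_le_hasSum T (fun v _ => by positivity) hsum
    have h4 : ∑ v ∈ T, ‖v.prod fun i k => g i ^ k‖ =
        ∑ v ∈ T, if v.support ⊆ S then ‖v.prod fun i k => g i ^ k‖ else 0 :=
      Finset.sum_congr rfl fun v hv =>
        (if_pos (Finset.subset_biUnion_of_mem (fun v : ι →₀ ℕ => v.support) hv)).symm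
    rw [h4]
    refine h3.trans ?_
    calc _ ≤ ∏ i ∈ S, Real.exp (2 * ‖g i‖) := by
          refine Finset.prod_le_prod (fun i _ => inv_nonneg.2 (by linarith [hlt i])) fun i _ => ?_
          rw [inv_le_comm₀ (by linarith [hlt i]) (Real.exp_pos _), ← Real.exp_neg]
          have h5 : 0 ≤ ‖g i‖ := norm_nonneg _
          have h6 := hg i
          rw [Real.exp_neg, inv_le_comm₀ (Real.exp_pos _) (by linarith)]
          refine le_trans ?_ (Real.add_one_le_exp _)
          rw [inv_le_iff_one_le_mul₀ (by linarith)]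
          nlinarith
      _ = Real.exp (2 * ∑ i ∈ S, ‖g i‖) := by rw [← Real.exp_sum, Finset.mul_sum]
      _ ≤ _ := by
          gcongr
          exact hs.sum_le_tsum _ fun i _ => norm_nonneg _
  have hsumm : Summable fun v : ι →₀ ℕ => ‖v.prod fun i k => g i ^ k‖ :=
    summable_of_sum_le (fun v => norm_nonneg _) hbd
  refine ⟨hsumm, hsumm.tsum_le_of_sum_le hbd, ?_⟩
  have hlim : Filter.Tendsto (fun S : Finset ι => ∑' v : ι →₀ ℕ,
      if v.support ⊆ S then v.prod (fun i k => g i ^ k) else 0) Filter.atTop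
      (nhds (∑' v : ι →₀ ℕ, v.prod fun i k => g i ^ k)) := by
    refine tendsto_tsum_of_dominated_convergence hsumm (fun v => ?_) (Filter.Eventually.of_forall
      fun S v => ?_)
    · refine tendsto_const_nhds.congr' ?_
      filter_upwards [Filter.eventually_ge_atTop v.support] with S hS
      exact (if_pos hS).symm
    · split_ifs
      · exact le_rfl
      · simp
  have hlim2 : Filter.Tendsto (fun S : Finset ι => ∑' v : ι →₀ ℕ,
      if v.support ⊆ S then v.prod (fun i k => g i ^ k) else 0) Filter.atTop
      (nhds (Complex.exp (∑' i, -Complex.log (1 - g i)))) := by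
    simp only [fun S => (hasSum_finsupp_support_subset g hlt S).2.tsum_eq, hexp]
    exact (Complex.continuous_exp.tendsto _).comp hlogs.hasSum
  have := tendsto_nhds_unique hlim hlim2
  rw [← this]
  exact hsumm.of_norm.hasSum

section DedekindProduct

variable {R : Type*} [CommRing R] [IsDedekindDomain R]

/-- A prime ideal as an element of the monoid of nonzero ideals. -/
noncomputable def primeIdealNonzero (p : {p : Ideal R // Prime p}) :
    nonZeroDivisors (Ideal R) :=
  ⟨p, mem_nonZeroDivisors_of_ne_zero p.2.ne_zero⟩

theorem bijective_prod_primeIdealNonzero :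
    Function.Bijective fun v : {p : Ideal R // Prime p} →₀ ℕ =>
      v.prod fun p k => primeIdealNonzero p ^ k := by
  have hval : ∀ v : {p : Ideal R // Prime p} →₀ ℕ,
      ((v.prod fun p k => primeIdealNonzero p ^ k : nonZeroDivisors (Ideal R)) : Ideal R) =
        ((Finsupp.toMultiset v).map Subtype.val).prod := fun v => by
    rw [Finsupp.toMultiset_map, Finsupp.prod_toMultiset, Finsupp.prod_mapDomain_index (by simp)
      (fun _ _ _ => pow_add _ _ _), Finsupp.prod, Finsupp.prod, SubmonoidClass.coe_finsetProd]
    rfl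
  have hnf : ∀ v : {p : Ideal R // Prime p} →₀ ℕ,
      UniqueFactorizationMonoid.normalizedFactors
        ((v.prod fun p k => primeIdealNonzero p ^ k : nonZeroDivisors (Ideal R)) : Ideal R) =
        (Finsupp.toMultiset v).map Subtype.val := fun v => by
    rw [hval]
    refine UniqueFactorizationMonoid.normalizedFactors_prod_of_prime fun p hp => ?_
    obtain ⟨q, -, rfl⟩ := Multiset.mem_map.1 hp
    exact q.2
  constructor
  · intro v w h
    have h1 := (hnf v).symm.trans ((congrArg (fun I : nonZeroDivisors (Ideal R) =>
      UniqueFactorizationMonoid.normalizedFactors (I : Ideal R)) h).trans (hnf w))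
    rw [← Finsupp.toMultiset_toFinsupp v, ← Finsupp.toMultiset_toFinsupp w,
      Multiset.map_injective Subtype.val_injective h1]
  · intro I
    have hI : (I : Ideal R) ≠ 0 := nonZeroDivisors.coe_ne_zero I
    obtain ⟨m, hm⟩ : ∃ m : Multiset {p : Ideal R // Prime p}, m.map Subtype.val =
        UniqueFactorizationMonoid.normalizedFactors (I : Ideal R) :=
      CanLift.prf _ fun p hp => UniqueFactorizationMonoid.prime_of_normalized_factor p hp
    refine ⟨Multiset.toFinsupp m, Subtype.ext ?_⟩
    simp only [hval]
    rw [Multiset.toFinsupp_toMultiset, hm]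
    exact Ideal.prod_normalizedFactors_eq_self hI

theorem hasSum_ideals_eq_exp (f : nonZeroDivisors (Ideal R) →* ℂ)
    (hf : ∀ p, ‖f (primeIdealNonzero p)‖ ≤ 1 / 2)
    (hs : Summable fun p => ‖f (primeIdealNonzero p)‖) :
    (Summable fun I => ‖f I‖) ∧
      ∑' I, ‖f I‖ ≤ Real.exp (2 * ∑' p, ‖f (primeIdealNonzero p)‖) ∧
      HasSum f (Complex.exp (∑' p, -Complex.log (1 - f (primeIdealNonzero p)))) := by
  obtain ⟨h1, h2, h3⟩ := hasSum_finsupp_prod_pow (fun p => f (primeIdealNonzero p)) hf hs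
  obtain ⟨e, he⟩ : ∃ e : ({p : Ideal R // Prime p} →₀ ℕ) ≃ nonZeroDivisors (Ideal R),
      ∀ v, f (e v) = v.prod fun p k => f (primeIdealNonzero p) ^ k :=
    ⟨Equiv.ofBijective _ bijective_prod_primeIdealNonzero, fun v => by
      simp only [Equiv.ofBijective_apply, map_finsuppProd, map_pow]⟩
  simp only [← he] at h1 h2 h3
  exact ⟨e.summable_iff.1 h1, (e.tsum_eq fun I => ‖f I‖) ▸ h2, e.hasSum_iff.1 h3⟩

end DedekindProduct

theorem summable_comp_of_card_fiber_le {X : Type*} (q : X → ℕ)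
    (hq : ∀ n, ∀ T : Finset X, (∀ x ∈ T, q x = n) → T.card ≤ 2) {f : ℕ → ℝ}
    (hf : ∀ n, 0 ≤ f n) (hs : Summable f) :
    Summable (fun x => f (q x)) ∧ ∑' x, f (q x) ≤ 2 * ∑' n, f n := by
  have key : ∀ T : Finset X, ∑ x ∈ T, f (q x) ≤ 2 * ∑' n, f n := fun T => by
    rw [← Finset.sum_fiberwise_of_maps_to (t := T.image q) fun x hx =>
      Finset.mem_image_of_mem _ hx]
    calc _ ≤ ∑ n ∈ T.image q, 2 * f n := by
          refine Finset.sum_le_sum fun n _ => ?_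
          rw [Finset.sum_congr rfl fun x hx => by rw [(Finset.mem_filter.1 hx).2],
            Finset.sum_const, nsmul_eq_mul]
          gcongr
          · exact hf n
          · exact_mod_cast hq n _ fun x hx => (Finset.mem_filter.1 hx).2
      _ ≤ _ := by
          rw [← Finset.mul_sum]
          gcongr
          exact hs.sum_le_tsum _ fun i _ => hf i
  have h1 := summable_of_sum_le (fun x => hf (q x)) key
  exact ⟨h1, h1.tsum_le_of_sum_le key⟩

theorem summable_natCast_rpow_neg {σ : ℝ} (hσ : 1 < σ) : Summable fun n : ℕ => (n : ℝ) ^ (-σ) :=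
  Real.summable_nat_rpow.2 (by linarith)

section Quadratic

variable {K : Type} [Field K] [NumberField K]

theorem exists_prime_mem_of_prime (p : {p : Ideal (𝓞 K) // Prime p}) :
    ∃ ℓ : ℕ, ℓ.Prime ∧ (ℓ : 𝓞 K) ∈ p.1 := by
  have hp : p.1.IsPrime := Ideal.isPrime_of_prime p.2
  have h0 : Ideal.absNorm p.1 ≠ 0 := by
    rw [Ne, Ideal.absNorm_eq_zero_iff]
    exact p.2.ne_zero
  have h := Ideal.absNorm_mem p.1
  rw [← Nat.prod_primeFactorsList h0, Nat.cast_list_prod] at h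
  rw [← Multiset.prod_coe, hp.multiset_prod_mem_iff_exists_mem] at h
  obtain ⟨y, hy, hyp⟩ := h
  obtain ⟨ℓ, hℓ, rfl⟩ := List.mem_map.1 (Multiset.mem_coe.1 hy)
  exact ⟨ℓ, Nat.prime_of_mem_primeFactorsList hℓ, hyp⟩

theorem absNorm_span_natCast_of_finrank (hK : Module.finrank ℚ K = 2) (n : ℕ) :
    Ideal.absNorm (Ideal.span {(n : 𝓞 K)}) = n ^ 2 := by
  rw [Ideal.absNorm_span_natCast, RingOfIntegers.rank, hK]

theorem absNorm_dvd_sq (hK : Module.finrank ℚ K = 2) {I : Ideal (𝓞 K)} {n : ℕ}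
    (h : (n : 𝓞 K) ∈ I) : Ideal.absNorm I ∣ n ^ 2 := by
  rw [← absNorm_span_natCast_of_finrank hK]
  exact Ideal.absNorm_dvd_absNorm_of_le ((Ideal.span_singleton_le_iff_mem _).2 h)

theorem absNorm_prime_ne_one (p : {p : Ideal (𝓞 K) // Prime p}) : Ideal.absNorm p.1 ≠ 1 := by
  rw [Ne, Ideal.absNorm_eq_one_iff]
  exact (Ideal.isPrime_of_prime p.2).ne_top

theorem exists_absNorm_eq_prime_pow (hK : Module.finrank ℚ K = 2)
    (p : {p : Ideal (𝓞 K) // Prime p}) :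
    ∃ ℓ f : ℕ, ℓ.Prime ∧ (ℓ : 𝓞 K) ∈ p.1 ∧ f ≠ 0 ∧ Ideal.absNorm p.1 = ℓ ^ f := by
  obtain ⟨ℓ, hℓ, hp⟩ := exists_prime_mem_of_prime p
  obtain ⟨f, -, hf⟩ := (Nat.dvd_prime_pow hℓ).1 (absNorm_dvd_sq hK hp)
  refine ⟨ℓ, f, hℓ, hp, ?_, hf⟩
  rintro rfl
  exact absNorm_prime_ne_one p (by simpa using hf)

theorem two_le_absNorm_prime (hK : Module.finrank ℚ K = 2) (p : {p : Ideal (𝓞 K) // Prime p}) :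
    2 ≤ Ideal.absNorm p.1 := by
  obtain ⟨ℓ, f, hℓ, -, hf, h⟩ := exists_absNorm_eq_prime_pow hK p
  rw [h]
  exact hℓ.two_le.trans (Nat.le_self_pow hf ℓ)

theorem card_primes_containing_le (hK : Module.finrank ℚ K = 2) {ℓ : ℕ} (hℓ : ℓ.Prime)
    (T : Finset {p : Ideal (𝓞 K) // Prime p}) (hT : ∀ p ∈ T, (ℓ : 𝓞 K) ∈ p.1) :
    T.card ≤ 2 := by
  have h1 : ∏ p ∈ T.image Subtype.val, p ∣ Ideal.span {(ℓ : 𝓞 K)} := by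
    refine Finset.prod_primes_dvd _ (fun p hp => ?_) fun p hp => ?_
    · obtain ⟨q, -, rfl⟩ := Finset.mem_image.1 hp
      exact q.2
    · obtain ⟨q, hq, rfl⟩ := Finset.mem_image.1 hp
      exact Ideal.dvd_iff_le.2 ((Ideal.span_singleton_le_iff_mem _).2 (hT q hq))
  rw [Finset.prod_image fun _ _ _ _ h => Subtype.ext h] at h1
  have h2 := map_dvd Ideal.absNorm h1
  rw [map_prod, absNorm_span_natCast_of_finrank hK] at h2
  have h3 : ℓ ^ T.card ≤ ∏ p ∈ T, Ideal.absNorm p.1 := by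
    rw [← Finset.prod_const]
    refine Finset.prod_le_prod' fun p hp => ?_
    obtain ⟨f, -, hf⟩ := (Nat.dvd_prime_pow hℓ).1 (absNorm_dvd_sq hK (hT p hp))
    rw [hf]
    refine Nat.le_self_pow ?_ ℓ
    rintro rfl
    exact absNorm_prime_ne_one p (by simpa using hf)
  exact (Nat.pow_le_pow_iff_right hℓ.one_lt).1
    (h3.trans (Nat.le_of_dvd (pow_pos hℓ.pos 2) h2))

theorem card_prime_powers_le (hK : Module.finrank ℚ K = 2) (n : ℕ)
    (T : Finset ({p : Ideal (𝓞 K) // Prime p} × ℕ))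
    (hT : ∀ q ∈ T, Ideal.absNorm q.1.1 ^ (q.2 + 1) = n) : T.card ≤ 2 := by
  rcases T.eq_empty_or_nonempty with rfl | ⟨q0, hq0⟩
  · simp
  obtain ⟨ℓ, f, hℓ, -, hf, h⟩ := exists_absNorm_eq_prime_pow hK q0.1
  have hn : n = ℓ ^ (f * (q0.2 + 1)) := by rw [← hT q0 hq0, h, pow_mul]
  have hinj : Set.InjOn Prod.fst (T : Set ({p : Ideal (𝓞 K) // Prime p} × ℕ)) := by
    intro a ha b hb hab
    have h1 := (hT a ha).trans (hT b hb).symm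
    rw [hab] at h1
    have h2 := Nat.pow_right_injective (two_le_absNorm_prime hK b.1) h1
    exact Prod.ext hab (by simpa using h2)
  rw [← Finset.card_image_of_injOn hinj]
  refine card_primes_containing_le hK hℓ _ fun p hp => ?_
  obtain ⟨q, hq, rfl⟩ := Finset.mem_image.1 hp
  obtain ⟨ℓ', f', hℓ', hm, hf', h'⟩ := exists_absNorm_eq_prime_pow hK q.1
  have h3 : ℓ' ∣ ℓ := by
    have : ℓ' ∣ n := by
      rw [← hT q hq, h', ← pow_mul]
      exact dvd_pow_self _ (mul_ne_zero hf' (Nat.succ_ne_zero _))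
    rw [hn] at this
    exact hℓ'.dvd_of_dvd_pow this
  rw [← (Nat.prime_dvd_prime_iff_eq hℓ' hℓ).1 h3]
  exact hm

theorem summable_absNorm_prime_pow (hK : Module.finrank ℚ K = 2) {σ : ℝ} (hσ : 1 < σ) :
    (Summable fun p : {p : Ideal (𝓞 K) // Prime p} => (Ideal.absNorm p.1 : ℝ) ^ (-σ)) ∧
      ∑' p : {p : Ideal (𝓞 K) // Prime p}, (Ideal.absNorm p.1 : ℝ) ^ (-σ) ≤
        2 * ∑' n : ℕ, (n : ℝ) ^ (-σ) := by
  refine summable_comp_of_card_fiber_le (fun p : {p : Ideal (𝓞 K) // Prime p} =>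
    Ideal.absNorm p.1) (fun n T hT => ?_) (f := fun n => (n : ℝ) ^ (-σ))
    (fun n => by positivity) (summable_natCast_rpow_neg hσ)
  have := card_prime_powers_le hK n (T.map ⟨fun p => (p, 0), fun a b h => (Prod.mk.inj h).1⟩)
    fun q hq => by
      obtain ⟨p, hp, rfl⟩ := Finset.mem_map.1 hq
      change Ideal.absNorm p.1 ^ (0 + 1) = n
      simpa using hT p hp
  simpa using this

end Quadratic

section IdealSeries

variable {K : Type} [Field K] [NumberField K]

theorem norm_classGroup_char (χ : ClassGroup (𝓞 K) →* ℂ) (c : ClassGroup (𝓞 K)) : ‖χ c‖ = 1 := by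
  refine Complex.norm_eq_one_of_pow_eq_one (n := Fintype.card (ClassGroup (𝓞 K))) ?_ Fintype.card_ne_zero
  rw [← map_pow, pow_card_eq_one, map_one]

theorem absNorm_nonZeroDivisors_ne_zero (I : nonZeroDivisors (Ideal (𝓞 K))) :
    Ideal.absNorm (I : Ideal (𝓞 K)) ≠ 0 := by
  rw [Ne, Ideal.absNorm_eq_zero_iff]
  exact nonZeroDivisors.coe_ne_zero I

/-- The completely multiplicative function `𝔞 ↦ χ(𝔞) N𝔞 ^ (-s)` on nonzero ideals. -/
noncomputable def idealTerm (χ : ClassGroup (𝓞 K) →* ℂ) (s : ℂ) :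
    nonZeroDivisors (Ideal (𝓞 K)) →* ℂ where
  toFun I := χ (ClassGroup.mk0 I) * (Ideal.absNorm (I : Ideal (𝓞 K)) : ℂ) ^ (-s)
  map_one' := by simp
  map_mul' I J := by
    rw [Submonoid.coe_mul, map_mul, map_mul, map_mul, Nat.cast_mul,
      Complex.natCast_mul_natCast_cpow]
    ring

theorem norm_idealTerm (χ : ClassGroup (𝓞 K) →* ℂ) (s : ℂ) (I : nonZeroDivisors (Ideal (𝓞 K))) :
    ‖idealTerm χ s I‖ = (Ideal.absNorm (I : Ideal (𝓞 K)) : ℝ) ^ (-s.re) := by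
  change ‖χ (ClassGroup.mk0 I) * (Ideal.absNorm (I : Ideal (𝓞 K)) : ℂ) ^ (-s)‖ = _
  rw [norm_mul, norm_classGroup_char, one_mul, Complex.norm_natCast_cpow_of_pos
    (Nat.pos_of_ne_zero (absNorm_nonZeroDivisors_ne_zero I)), Complex.neg_re]

theorem norm_idealTerm_prime (χ : ClassGroup (𝓞 K) →* ℂ) (s : ℂ)
    (p : {p : Ideal (𝓞 K) // Prime p}) :
    ‖idealTerm χ s (primeIdealNonzero p)‖ = (Ideal.absNorm p.1 : ℝ) ^ (-s.re) :=
  norm_idealTerm χ s _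

theorem norm_idealTerm_prime_le (hK : Module.finrank ℚ K = 2) (χ : ClassGroup (𝓞 K) →* ℂ) {s : ℂ}
    (hs : 1 < s.re) (p : {p : Ideal (𝓞 K) // Prime p}) :
    ‖idealTerm χ s (primeIdealNonzero p)‖ ≤ 1 / 2 := by
  have h2 : (2 : ℝ) ≤ Ideal.absNorm p.1 := by exact_mod_cast two_le_absNorm_prime hK p
  rw [norm_idealTerm_prime]
  calc (Ideal.absNorm p.1 : ℝ) ^ (-s.re) ≤ (Ideal.absNorm p.1 : ℝ) ^ (-1 : ℝ) :=
        Real.rpow_le_rpow_of_exponent_le (by linarith) (by linarith)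
    _ = (Ideal.absNorm p.1 : ℝ)⁻¹ := Real.rpow_neg_one _
    _ ≤ _ := by
        rw [one_div]
        exact inv_anti₀ two_pos h2

/-- The coefficient at `n` of the logarithm of the class group `L`-series of `χ`. -/
noncomputable def logCoeff (χ : ClassGroup (𝓞 K) →* ℂ) (n : ℕ) : ℂ :=
  ∑' q : (fun q : {p : Ideal (𝓞 K) // Prime p} × ℕ => Ideal.absNorm q.1.1 ^ (q.2 + 1)) ⁻¹' {n},
    χ (ClassGroup.mk0 (primeIdealNonzero q.1.1)) ^ (q.1.2 + 1) / ((q.1.2 : ℂ) + 1)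

theorem norm_char_pow_div_le (χ : ClassGroup (𝓞 K) →* ℂ) (c : ClassGroup (𝓞 K)) (k : ℕ) :
    ‖χ c ^ (k + 1) / ((k : ℂ) + 1)‖ ≤ 1 := by
  rw [norm_div, norm_pow, norm_classGroup_char, one_pow]
  have : ‖(k : ℂ) + 1‖ = k + 1 := by
    rw [← Nat.cast_succ, Complex.norm_natCast]
    push_cast
    ring
  rw [this]
  exact div_le_one_of_le₀ (by linarith [(Nat.cast_nonneg k : (0 : ℝ) ≤ k)]) (by positivity)

theorem summable_logCoeff_fiber (hK : Module.finrank ℚ K = 2) (χ : ClassGroup (𝓞 K) →* ℂ) (n : ℕ) :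
    (Summable fun q : (fun q : {p : Ideal (𝓞 K) // Prime p} × ℕ =>
      Ideal.absNorm q.1.1 ^ (q.2 + 1)) ⁻¹' {n} =>
      ‖χ (ClassGroup.mk0 (primeIdealNonzero q.1.1)) ^ (q.1.2 + 1) / ((q.1.2 : ℂ) + 1)‖) ∧
    ‖logCoeff χ n‖ ≤ 2 := by
  have key : ∀ T : Finset ((fun q : {p : Ideal (𝓞 K) // Prime p} × ℕ =>
      Ideal.absNorm q.1.1 ^ (q.2 + 1)) ⁻¹' {n}), ∑ q ∈ T,
      ‖χ (ClassGroup.mk0 (primeIdealNonzero q.1.1)) ^ (q.1.2 + 1) / ((q.1.2 : ℂ) + 1)‖ ≤ 2 :=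
    fun T => by
      refine (Finset.sum_le_card_nsmul T _ 1 fun q _ => norm_char_pow_div_le χ _ _).trans ?_
      rw [nsmul_eq_mul, mul_one]
      have := card_prime_powers_le hK n (T.map (Function.Embedding.subtype _)) fun q hq => by
        obtain ⟨y, -, rfl⟩ := Finset.mem_map.1 hq
        exact y.2
      rw [Finset.card_map] at this
      exact_mod_cast this
  have hs := summable_of_sum_le (fun q => norm_nonneg _) key
  exact ⟨hs, (norm_tsum_le_tsum_norm hs).trans (hs.tsum_le_of_sum_le key)⟩

theorem logCoeff_eq_zero (χ : ClassGroup (𝓞 K) →* ℂ) {n : ℕ}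
    (h : ∀ (p : {p : Ideal (𝓞 K) // Prime p}) (k : ℕ), Ideal.absNorm p.1 ^ (k + 1) ≠ n) :
    logCoeff χ n = 0 := by
  have : IsEmpty ((fun q : {p : Ideal (𝓞 K) // Prime p} × ℕ =>
      Ideal.absNorm q.1.1 ^ (q.2 + 1)) ⁻¹' {n}) := ⟨fun q => h _ _ q.2⟩
  exact tsum_empty

theorem logCoeff_zero (χ : ClassGroup (𝓞 K) →* ℂ) : logCoeff χ 0 = 0 :=
  logCoeff_eq_zero χ fun p _ =>
    pow_ne_zero _ (absNorm_nonZeroDivisors_ne_zero (primeIdealNonzero p))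

theorem isPrimePow_of_logCoeff_ne_zero (hK : Module.finrank ℚ K = 2) (χ : ClassGroup (𝓞 K) →* ℂ)
    {n : ℕ} (h : logCoeff χ n ≠ 0) : IsPrimePow n := by
  by_contra hn
  refine h (logCoeff_eq_zero χ fun p k hp => hn ?_)
  obtain ⟨ℓ, f, hℓ, -, hf, hN⟩ := exists_absNorm_eq_prime_pow hK p
  rw [← hp, hN, ← pow_mul]
  exact hℓ.isPrimePow.pow (mul_ne_zero hf (Nat.succ_ne_zero _))

theorem summable_logCoeff (hK : Module.finrank ℚ K = 2) (χ : ClassGroup (𝓞 K) →* ℂ) {s : ℂ}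
    (hs : 1 < s.re) : (Summable fun n : ℕ => logCoeff χ n * (n : ℂ) ^ (-s)) ∧
      ‖∑' n : ℕ, logCoeff χ n * (n : ℂ) ^ (-s)‖ ≤ 2 * ∑' n : ℕ, (n : ℝ) ^ (-s.re) := by
  have hb : ∀ n : ℕ, ‖logCoeff χ n * (n : ℂ) ^ (-s)‖ ≤ 2 * (n : ℝ) ^ (-s.re) := fun n => by
    rw [norm_mul]
    rcases n.eq_zero_or_pos with rfl | hn
    · rw [logCoeff_zero, norm_zero, zero_mul]
      positivity
    · rw [Complex.norm_natCast_cpow_of_pos hn, Complex.neg_re]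
      gcongr
      exact (summable_logCoeff_fiber hK χ n).2
  have h1 := (summable_natCast_rpow_neg hs).mul_left 2
  refine ⟨Summable.of_norm_bounded h1 hb, ?_⟩
  rw [← tsum_mul_left]
  exact tsum_of_norm_bounded h1.hasSum hb

theorem hasSum_idealTerm (hK : Module.finrank ℚ K = 2) (χ : ClassGroup (𝓞 K) →* ℂ) {s : ℂ}
    (hs : 1 < s.re) :
    (Summable fun I => ‖idealTerm χ s I‖) ∧
      ∑' I, ‖idealTerm χ s I‖ ≤ Real.exp (4 * ∑' n : ℕ, (n : ℝ) ^ (-s.re)) ∧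
      HasSum (idealTerm χ s) (Complex.exp (∑' n : ℕ, logCoeff χ n * (n : ℂ) ^ (-s))) := by
  obtain ⟨hp1, hp2⟩ := summable_absNorm_prime_pow hK hs
  simp only [← norm_idealTerm_prime χ] at hp1 hp2
  have hle := norm_idealTerm_prime_le hK χ hs
  obtain ⟨h1, h2, h3⟩ := hasSum_ideals_eq_exp (idealTerm χ s) hle hp1
  refine ⟨h1, h2.trans (Real.exp_le_exp.2 (by linarith)), ?_⟩
  convert h3 using 2
  set q : {p : Ideal (𝓞 K) // Prime p} × ℕ → ℕ :=
    fun q => Ideal.absNorm q.1.1 ^ (q.2 + 1) with hq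
  set G : {p : Ideal (𝓞 K) // Prime p} × ℕ → ℂ := fun x =>
    idealTerm χ s (primeIdealNonzero x.1) ^ (x.2 + 1) / ((x.2 : ℂ) + 1) with hG
  have hGeq : ∀ x, G x = χ (ClassGroup.mk0 (primeIdealNonzero x.1)) ^ (x.2 + 1) /
      ((x.2 : ℂ) + 1) * (q x : ℂ) ^ (-s) := fun x => by
    simp only [hG, hq]
    have : idealTerm χ s (primeIdealNonzero x.1) =
      χ (ClassGroup.mk0 (primeIdealNonzero x.1)) * (Ideal.absNorm x.1.1 : ℂ) ^ (-s) := rfl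
    rw [this, mul_pow, Nat.cast_pow, ← Complex.natCast_cpow_natCast_mul, mul_comm ((x.2 + 1 : ℕ) : ℂ),
      Complex.cpow_mul_nat]
    ring
  have hqpos : ∀ x, 0 < q x := fun x =>
    pow_pos (Nat.pos_of_ne_zero (absNorm_nonZeroDivisors_ne_zero (primeIdealNonzero x.1))) _
  have hGs : Summable G := by
    refine Summable.of_norm_bounded (summable_comp_of_card_fiber_le q
      (fun n T hT => card_prime_powers_le hK n T hT) (f := fun n => (n : ℝ) ^ (-s.re))
      (fun n => by positivity) (summable_natCast_rpow_neg hs)).1 fun x => ?_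
    rw [hGeq, norm_mul, Complex.norm_natCast_cpow_of_pos (hqpos x), Complex.neg_re]
    exact mul_le_of_le_one_left (by positivity) (norm_char_pow_div_le χ _ _)
  have e1 : ∑' p, -Complex.log (1 - idealTerm χ s (primeIdealNonzero p)) = ∑' x, G x := by
    rw [hGs.tsum_prod]
    refine tsum_congr fun p => ?_
    rw [← (Complex.hasSum_taylorSeries_neg_log' ((hle p).trans_lt (by norm_num))).tsum_eq]
  rw [e1, ← (hGs.hasSum.tsum_fiberwise q).tsum_eq]
  refine tsum_congr fun n => ?_
  rw [logCoeff, ← tsum_mul_right]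
  refine tsum_congr fun y => ?_
  rw [hGeq, show q y = n from y.2]

theorem lambdaChi_eq_tsum (χ : ClassGroup (𝓞 K) →* ℂ) (n : ℕ) :
    lambdaChi K χ n = ∑' I : (fun I : nonZeroDivisors (Ideal (𝓞 K)) =>
      Ideal.absNorm (I : Ideal (𝓞 K))) ⁻¹' {n}, χ (ClassGroup.mk0 I.1) := by
  set e : {I : Ideal (𝓞 K) | Ideal.absNorm I = n ∧ I ≠ 0} →
      (fun I : nonZeroDivisors (Ideal (𝓞 K)) => Ideal.absNorm (I : Ideal (𝓞 K))) ⁻¹' {n} :=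
    fun I => ⟨⟨I.1, mem_nonZeroDivisors_of_ne_zero I.2.2⟩, I.2.1⟩ with he
  have hbij : Function.Bijective e := by
    refine ⟨fun I J h => Subtype.ext ?_, fun J => ⟨⟨J.1.1, J.2,
      nonZeroDivisors.coe_ne_zero J.1⟩, rfl⟩⟩
    exact congrArg (fun z => (z.1 : Ideal (𝓞 K))) h
  have hfin : Finite {I : Ideal (𝓞 K) | Ideal.absNorm I = n ∧ I ≠ 0} :=
    ((Ideal.finite_setOfPred_absNorm_eq n).subset fun I hI => hI.1).to_subtype
  have hfin' := Finite.of_surjective e hbij.2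
  rw [tsum_eq_finsum (Set.toFinite _), ← finsum_eq_of_bijective e hbij fun I => rfl, lambdaChi,
    ← finsum_set_coe_eq_finsum_mem]
  refine finsum_congr fun I => ?_
  rw [idealClass, dif_pos (mem_nonZeroDivisors_of_ne_zero I.2.2)]

theorem tsum_lambdaChi (hK : Module.finrank ℚ K = 2) (χ : ClassGroup (𝓞 K) →* ℂ) {s : ℂ}
    (hs : 1 < s.re) :
    ∑' n : ℕ, lambdaChi K χ n / (n : ℂ) ^ s =
      Complex.exp (∑' n : ℕ, logCoeff χ n * (n : ℂ) ^ (-s)) := by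
  have h := (hasSum_idealTerm hK χ hs).2.2
  rw [← (h.tsum_fiberwise fun I => Ideal.absNorm (I : Ideal (𝓞 K))).tsum_eq]
  refine tsum_congr fun n => ?_
  rw [lambdaChi_eq_tsum, div_eq_mul_inv, ← Complex.cpow_neg, ← tsum_mul_right]
  refine tsum_congr fun I => ?_
  change _ = χ (ClassGroup.mk0 I.1) * (Ideal.absNorm (I.1 : Ideal (𝓞 K)) : ℂ) ^ (-s)
  rw [show Ideal.absNorm (I.1 : Ideal (𝓞 K)) = n from I.2]

theorem logCoeff_prime (χ : ClassGroup (𝓞 K) →* ℂ) {p : ℕ} (hp : p.Prime) :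
    logCoeff χ p = lambdaChi K χ p := by
  rw [lambdaChi_eq_tsum, logCoeff]
  set e : (fun q : {p : Ideal (𝓞 K) // Prime p} × ℕ => Ideal.absNorm q.1.1 ^ (q.2 + 1)) ⁻¹' {p} →
      (fun I : nonZeroDivisors (Ideal (𝓞 K)) => Ideal.absNorm (I : Ideal (𝓞 K))) ⁻¹' {p} :=
    fun q => ⟨primeIdealNonzero q.1.1, by
      have h : Ideal.absNorm q.1.1.1 ^ (q.1.2 + 1) = p := q.2
      rw [← h] at hp
      have h0 := hp.eq_one_of_pow
      rw [h0, pow_one] at h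
      exact h⟩ with he
  have hk : ∀ q : (fun q : {p : Ideal (𝓞 K) // Prime p} × ℕ =>
      Ideal.absNorm q.1.1 ^ (q.2 + 1)) ⁻¹' {p}, q.1.2 = 0 := fun q => by
    have h : Ideal.absNorm q.1.1.1 ^ (q.1.2 + 1) = p := q.2
    rw [← h] at hp
    simpa using hp.eq_one_of_pow
  have hbij : Function.Bijective e := by
    constructor
    · intro a b h
      have h1 : a.1.1 = b.1.1 := Subtype.ext (congrArg (fun I => (I.1 : Ideal (𝓞 K))) h)
      exact Subtype.ext (Prod.ext h1 ((hk a).trans (hk b).symm))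
    · intro J
      have hJ : Ideal.absNorm (J.1 : Ideal (𝓞 K)) = p := J.2
      have hirr : (J.1 : Ideal (𝓞 K)).IsPrime :=
        Ideal.isPrime_of_irreducible_absNorm (by rw [hJ]; exact hp)
      refine ⟨⟨(⟨J.1.1, Ideal.prime_of_isPrime (nonZeroDivisors.coe_ne_zero J.1) hirr⟩, 0), ?_⟩,
        rfl⟩
      simpa using hJ
  rw [← (Equiv.ofBijective e hbij).tsum_eq fun I => χ (ClassGroup.mk0 I.1)]
  refine tsum_congr fun q => ?_
  rw [hk q]
  simp [he]

end IdealSeries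

section Theta

open scoped Real
open HurwitzZeta

theorem pow_le_factorial_mul_inv_pow {y : ℝ} (hy : 0 < y) (N : ℕ) :
    Real.exp (-y) ≤ N.factorial * (y ^ N)⁻¹ := by
  have := Real.pow_div_factorial_le_exp y hy.le N
  rw [Real.exp_neg]
  have hf : (0 : ℝ) < N.factorial := by exact_mod_cast N.factorial_pos
  rw [div_le_iff₀ hf] at this
  rw [inv_le_comm₀ (Real.exp_pos _) (by positivity), mul_inv, inv_inv, inv_mul_le_iff₀ hf]
  linarith

theorem exists_cosKernel_sub_one_le {N : ℕ} (hN : 1 ≤ N) : ∃ C : ℝ, 0 < C ∧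
    ∀ (a : ℝ) {z : ℝ}, 0 < z → |cosKernel a z - 1| ≤ C * (z ^ N)⁻¹ := by
  have hsum : Summable fun n : ℤ => (if n = 0 then 0 else (((n : ℝ) ^ 2) ^ N)⁻¹ : ℝ) := by
    refine Summable.of_nonneg_of_le (fun n => ?_) (fun n => ?_)
      ((Real.summable_one_div_int_pow (p := 2)).2 one_lt_two)
    · split_ifs <;> positivity
    · split_ifs with h
      · positivity
      · rw [one_div]
        have h1 : (1 : ℝ) ≤ (n : ℝ) ^ 2 := by
          have : 1 ≤ n ^ 2 := by
            have := sq_pos_of_ne_zero h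
            omega
          exact_mod_cast this
        exact inv_anti₀ (by positivity) (le_self_pow₀ h1 (by omega))
  set S := ∑' n : ℤ, (if n = 0 then 0 else (((n : ℝ) ^ 2) ^ N)⁻¹ : ℝ) with hS
  have hS0 : 0 ≤ S := tsum_nonneg fun n => by split_ifs <;> positivity
  refine ⟨N.factorial * S + 1, by positivity, fun a z hz => ?_⟩
  have h1 := hasSum_ite_sub_hasSum (hasSum_int_cosKernel a hz) 0
  simp only [Int.cast_zero, mul_zero, Complex.exp_zero, one_mul, ne_eq, OfNat.ofNat_ne_zero,
    not_false_eq_true, zero_pow, zero_mul, Real.exp_zero, Complex.ofReal_one] at h1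
  have h2 : ‖(cosKernel a z : ℂ) - 1‖ ≤ N.factorial * (z ^ N)⁻¹ * S := by
    refine h1.norm_le_of_bounded (hsum.hasSum.mul_left _) fun n => ?_
    split_ifs with h
    · simp
    · have hn : (0 : ℝ) < (n : ℝ) ^ 2 := by positivity
      have e1 : ‖Complex.exp (2 * π * Complex.I * a * n)‖ = 1 := by
        rw [show (2 * π * Complex.I * a * n : ℂ) = ((2 * π * a * n : ℝ) : ℂ) * Complex.I by
          push_cast; ring, Complex.norm_exp_ofReal_mul_I]
      rw [norm_mul, e1, one_mul, Complex.norm_real, Real.norm_of_nonneg (Real.exp_pos _).le]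
      have e2 : Real.exp (-π * n ^ 2 * z) ≤ Real.exp (-(n ^ 2 * z)) := by
        refine Real.exp_le_exp.2 ?_
        nlinarith [Real.pi_gt_three, mul_pos hn hz]
      refine (e2.trans (pow_le_factorial_mul_inv_pow (by positivity) N)).trans_eq ?_
      rw [mul_pow, mul_inv]
      ring
  rw [← Complex.ofReal_one, ← Complex.ofReal_sub, Complex.norm_real, Real.norm_eq_abs] at h2
  refine h2.trans ?_
  have : 0 < (z ^ N)⁻¹ := by positivity
  nlinarith

theorem exists_theta_shift {N : ℕ} (hN : 1 ≤ N) : ∃ C : ℝ, 0 < C ∧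
    ∀ (β : ℝ) {τ : ℝ}, 0 < τ → ∃ E : ℝ, |E| ≤ C * τ ^ N ∧
      HasSum (fun m : ℤ => Real.exp (-τ * (m + β) ^ 2)) (√(π / τ) * (1 + E)) := by
  obtain ⟨C, hC, h⟩ := exists_cosKernel_sub_one_le hN
  refine ⟨C, hC, fun β τ hτ => ⟨cosKernel β (π / τ) - 1, ?_, ?_⟩⟩
  · refine (h β (by positivity : 0 < π / τ)).trans ?_
    gcongr
    rw [← inv_pow, inv_div]
    gcongr
    exact div_le_self hτ.le (by linarith [Real.pi_gt_three])
  · have h1 := hasSum_int_evenKernel β (by positivity : 0 < τ / π)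
    rw [evenKernel_functional_equation, ← Real.sqrt_eq_rpow, one_div_div, one_div, ← Real.sqrt_inv,
      inv_div] at h1
    convert! h1 using 2 with m
    · field_simp
    · ring

/-- A reduced positive definite real binary quadratic form `a m² + b m n + c n²`. -/
structure IsReducedForm (a b c : ℝ) : Prop where
  one_le_left : 1 ≤ a
  one_le_right : 1 ≤ c
  abs_le_left : |b| ≤ a
  abs_le_right : |b| ≤ c

namespace IsReducedForm

variable {a b c : ℝ}

theorem le_form (h : IsReducedForm a b c) (m n : ℝ) :
    (m ^ 2 + n ^ 2) / 2 ≤ a * m ^ 2 + b * m * n + c * n ^ 2 := by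
  have h1 : |b * m * n| ≤ |b| * ((m ^ 2 + n ^ 2) / 2) := by
    rw [mul_assoc, abs_mul]
    gcongr
    rw [abs_mul]
    nlinarith [sq_nonneg (|m| - |n|), sq_abs m, sq_abs n]
  have h2 := (abs_le.1 h1).1
  have := h.one_le_left
  have := h.one_le_right
  have h3 : |b| * m ^ 2 ≤ a * m ^ 2 := by gcongr; exact h.abs_le_left
  have h4 : |b| * n ^ 2 ≤ c * n ^ 2 := by gcongr; exact h.abs_le_right
  nlinarith [mul_nonneg (sub_nonneg.2 h.one_le_left) (sq_nonneg m),
    mul_nonneg (sub_nonneg.2 h.one_le_right) (sq_nonneg n)]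

theorem three_mul_le_disc (h : IsReducedForm a b c) : 3 * (a * c) ≤ 4 * a * c - b ^ 2 := by
  have h1 : |b| * |b| ≤ a * c :=
    mul_le_mul h.abs_le_left h.abs_le_right (abs_nonneg _) (by linarith [h.one_le_left])
  rw [abs_mul_abs_self] at h1
  nlinarith

theorem left_le_disc (h : IsReducedForm a b c) : a ≤ 4 * a * c - b ^ 2 := by
  have := h.three_mul_le_disc
  have := h.one_le_left
  nlinarith [h.one_le_right]

theorem three_le_disc (h : IsReducedForm a b c) : 3 ≤ 4 * a * c - b ^ 2 := by
  have := h.three_mul_le_disc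
  have := h.one_le_left
  nlinarith [h.one_le_right]

end IsReducedForm

/-- The theta series of a binary quadratic form. -/
noncomputable def formTheta (a b c t : ℝ) : ℝ :=
  ∑' p : ℤ × ℤ, Real.exp (-t * (a * p.1 ^ 2 + b * p.1 * p.2 + c * p.2 ^ 2))

theorem summable_exp_neg_sq {τ : ℝ} (hτ : 0 < τ) :
    Summable fun m : ℤ => Real.exp (-τ * (m : ℝ) ^ 2) := by
  obtain ⟨C, -, h⟩ := exists_theta_shift le_rfl
  obtain ⟨E, -, hE⟩ := h 0 hτ
  simpa using hE.summable

theorem summable_exp_neg_sq_add_sq {τ : ℝ} (hτ : 0 < τ) :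
    Summable fun p : ℤ × ℤ => Real.exp (-τ * ((p.1 : ℝ) ^ 2 + (p.2 : ℝ) ^ 2)) := by
  have := (summable_exp_neg_sq hτ).mul_of_nonneg (summable_exp_neg_sq hτ)
    (fun _ => (Real.exp_pos _).le) (fun _ => (Real.exp_pos _).le)
  refine this.congr fun p => ?_
  rw [← Real.exp_add]
  ring_nf

theorem IsReducedForm.summable_theta {a b c : ℝ} (h : IsReducedForm a b c) {t : ℝ} (ht : 0 < t) :
    Summable fun p : ℤ × ℤ =>
      Real.exp (-t * (a * p.1 ^ 2 + b * p.1 * p.2 + c * p.2 ^ 2)) := by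
  refine Summable.of_nonneg_of_le (fun _ => (Real.exp_pos _).le) (fun p => Real.exp_le_exp.2 ?_)
    (summable_exp_neg_sq_add_sq (half_pos ht))
  nlinarith [mul_le_mul_of_nonneg_left (h.le_form p.1 p.2) ht.le]

theorem exists_formTheta_sub_one_le : ∃ C : ℝ, 0 < C ∧ ∀ {a b c : ℝ}, IsReducedForm a b c →
    ∀ {t : ℝ}, 1 ≤ t → |formTheta a b c t - 1| ≤ C * Real.exp (-t / 2) := by
  set S := ∑' p : ℤ × ℤ, Real.exp (-(1 / 2) * ((p.1 : ℝ) ^ 2 + (p.2 : ℝ) ^ 2)) with hS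
  have hS0 : 0 ≤ S := tsum_nonneg fun _ => (Real.exp_pos _).le
  refine ⟨Real.exp (1 / 2) * S + 1, by positivity, fun {a b c} h {t} ht => ?_⟩
  have h1 := hasSum_ite_sub_hasSum (h.summable_theta (by linarith : 0 < t)).hasSum 0
  simp only [Prod.fst_zero, Prod.snd_zero, Int.cast_zero, ne_eq, OfNat.ofNat_ne_zero,
    not_false_eq_true, zero_pow, mul_zero, add_zero, Real.exp_zero] at h1
  have h2 : ‖formTheta a b c t - 1‖ ≤ Real.exp (1 / 2) * Real.exp (-t / 2) * S := by
    refine h1.norm_le_of_bounded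
      ((summable_exp_neg_sq_add_sq one_half_pos).hasSum.mul_left _) fun p => ?_
    split_ifs with hp
    · rw [norm_zero]
      positivity
    · rw [Real.norm_of_nonneg (Real.exp_pos _).le, ← Real.exp_add, ← Real.exp_add]
      refine Real.exp_le_exp.2 ?_
      have h3 := h.le_form p.1 p.2
      have h4 : (1 : ℝ) ≤ (p.1 : ℝ) ^ 2 + (p.2 : ℝ) ^ 2 := by
        have : 1 ≤ p.1 ^ 2 + p.2 ^ 2 := by
          by_contra hlt
          have h5 : p.1 ^ 2 + p.2 ^ 2 = 0 := by nlinarith [sq_nonneg p.1, sq_nonneg p.2]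
          refine hp (Prod.ext ?_ ?_) <;> simp <;> nlinarith [sq_nonneg p.1, sq_nonneg p.2]
        exact_mod_cast this
      nlinarith [mul_le_mul_of_nonneg_left h3 (by linarith : (0 : ℝ) ≤ t)]
  rw [Real.norm_eq_abs] at h2
  refine h2.trans ?_
  have := Real.exp_pos (-t / 2)
  nlinarith

theorem exists_formTheta_sub_le {N : ℕ} (hN : 1 ≤ N) : ∃ C : ℝ, 0 < C ∧
    ∀ {a b c : ℝ}, IsReducedForm a b c → ∀ {t : ℝ}, 0 < t → t ≤ 1 →
      |formTheta a b c t - 2 * π / √(4 * a * c - b ^ 2) / t| ≤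
        C * (4 * a * c - b ^ 2) ^ (2 * N) * t ^ (N - 1) := by
  obtain ⟨C, hC, hth⟩ := exists_theta_shift hN
  refine ⟨2 * π * (C * (2 + C)), by positivity, fun {a b c} h {t} ht ht1 => ?_⟩
  have ha := h.one_le_left
  have ha0 : 0 < a := by linarith
  set V := 4 * a * c - b ^ 2 with hV
  have hV3 : 3 ≤ V := h.three_le_disc
  have haV : a ≤ V := h.left_le_disc
  set u := V / (4 * a) with hu
  have hu0 : 0 < u := by positivity
  have huV : u ≤ V := div_le_self (by linarith) (by linarith)
  have hau : √(a * u) = √V / 2 := by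
    rw [show a * u = V / 2 ^ 2 by rw [hu]; field_simp; norm_num, Real.sqrt_div' _ (by positivity),
      Real.sqrt_sq two_pos.le]
  obtain ⟨E, hE, hsE⟩ := hth 0 (mul_pos ht hu0)
  choose G hG hsG using fun n : ℤ => hth (b * n / (2 * a)) (mul_pos ht ha0)
  have hform : ∀ n m : ℤ, Real.exp (-t * (a * m ^ 2 + b * m * n + c * n ^ 2)) =
      Real.exp (-(t * u) * (n + 0) ^ 2) * Real.exp (-(t * a) * (m + b * n / (2 * a)) ^ 2) := by
    intro n m
    rw [← Real.exp_add, hu, hV]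
    congr 1
    field_simp
    ring
  have hs := h.summable_theta ht
  have hs' := (Equiv.prodComm ℤ ℤ).summable_iff.2 hs
  have e1 : formTheta a b c t = ∑' n : ℤ, Real.exp (-(t * u) * (n + 0) ^ 2) *
      (√(π / (t * a)) * (1 + G n)) := by
    rw [formTheta, ← (Equiv.prodComm ℤ ℤ).tsum_eq]
    refine (hs'.tsum_prod).trans (tsum_congr fun n => ?_)
    rw [← (hsG n).tsum_eq, ← tsum_mul_left]
    exact tsum_congr fun m => hform n m
  have hA : |∑' n : ℤ, Real.exp (-(t * u) * (n + 0) ^ 2) * (√(π / (t * a)) * G n)| ≤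
      √(π / (t * u)) * (1 + E) * (√(π / (t * a)) * (C * (t * a) ^ N)) := by
    rw [← Real.norm_eq_abs]
    refine tsum_of_norm_bounded (hsE.mul_right _) fun n => ?_
    rw [norm_mul, norm_mul, Real.norm_of_nonneg (Real.exp_pos _).le,
      Real.norm_of_nonneg (Real.sqrt_nonneg _), Real.norm_eq_abs]
    gcongr
    exact hG n
  have hsG' : Summable fun n : ℤ => Real.exp (-(t * u) * (n + 0) ^ 2) * (√(π / (t * a)) * G n) := by
    refine Summable.of_norm_bounded (hsE.mul_right (√(π / (t * a)) * (C * (t * a) ^ N))).summable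
      fun n => ?_
    rw [norm_mul, norm_mul, Real.norm_of_nonneg (Real.exp_pos _).le,
      Real.norm_of_nonneg (Real.sqrt_nonneg _), Real.norm_eq_abs]
    gcongr
    exact hG n
  have e2 : formTheta a b c t = √(π / (t * u)) * (1 + E) * √(π / (t * a)) +
      ∑' n : ℤ, Real.exp (-(t * u) * (n + 0) ^ 2) * (√(π / (t * a)) * G n) := by
    rw [e1, ← (hsE.mul_right (√(π / (t * a)))).tsum_eq,
      ← (hsE.mul_right (√(π / (t * a)))).summable.tsum_add hsG']
    exact tsum_congr fun n => by ring
  have e3 : √(π / (t * u)) * √(π / (t * a)) = 2 * π / √V / t := by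
    rw [← Real.sqrt_mul (by positivity), show π / (t * u) * (π / (t * a)) = (π / t) ^ 2 / (a * u) by
      field_simp, Real.sqrt_div (by positivity), Real.sqrt_sq (by positivity), hau]
    field_simp
  set P := 2 * π / √V / t with hP
  have hP0 : 0 ≤ P := by positivity
  have hVN : 1 ≤ V ^ N := one_le_pow₀ (by linarith)
  have htN : t ^ N ≤ 1 := pow_le_one₀ ht.le ht1
  have hE' : |E| ≤ C * (V ^ N * t ^ N) := by
    refine hE.trans ?_
    rw [mul_pow, mul_comm (t ^ N)]
    gcongr
  have hta : (t * a) ^ N ≤ V ^ N * t ^ N := by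
    rw [mul_pow, mul_comm (t ^ N)]
    gcongr
  have e4 : formTheta a b c t - P = P * E +
      ∑' n : ℤ, Real.exp (-(t * u) * (n + 0) ^ 2) * (√(π / (t * a)) * G n) := by
    rw [e2, ← e3]
    ring
  have h5 : |formTheta a b c t - P| ≤ P * (C * (V ^ N * t ^ N)) +
      P * (1 + C * V ^ N) * (C * (V ^ N * t ^ N)) := by
    rw [e4]
    refine (abs_add_le _ _).trans (add_le_add ?_ (hA.trans ?_))
    · rw [abs_mul, abs_of_nonneg hP0]
      gcongr
    · rw [show √(π / (t * u)) * (1 + E) * (√(π / (t * a)) * (C * (t * a) ^ N)) =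
        P * (1 + E) * (C * (t * a) ^ N) by rw [← e3]; ring]
      have : 1 + E ≤ 1 + C * V ^ N := by
        have := (abs_le.1 hE').2
        have h7 : C * (V ^ N * t ^ N) ≤ C * (V ^ N * 1) := by gcongr
        linarith
      gcongr
  refine h5.trans ?_
  have hsV : 1 ≤ √V := Real.one_le_sqrt.2 (by linarith)
  have hPt : P ≤ 2 * π / t := by
    rw [hP]
    gcongr
    exact div_le_self (by positivity) hsV
  have htt : t ^ N = t * t ^ (N - 1) := by
    rw [← pow_succ', Nat.sub_add_cancel hN]
  calc P * (C * (V ^ N * t ^ N)) + P * (1 + C * V ^ N) * (C * (V ^ N * t ^ N)) =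
      P * (2 + C * V ^ N) * (C * (V ^ N * t ^ N)) := by ring
    _ ≤ 2 * π / t * (2 * V ^ N + C * V ^ N) * (C * (V ^ N * t ^ N)) := by
        gcongr
        linarith
    _ = 2 * π * (C * (2 + C)) * (V ^ N * V ^ N) * (t ^ N / t) := by ring
    _ = _ := by
        rw [htt, mul_div_cancel_left₀ _ ht.ne', ← pow_add]
        ring_nf

end Theta

section MellinRemainder

open MeasureTheory

/-- `Θ` is continuous on `(0, ∞)`, decays exponentially at infinity, and differs from `c / t - d`
by a rapidly decreasing function at `0`. -/
structure IsThetaLike (Θ : ℝ → ℂ) (c d : ℂ) : Prop where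
  continuousOn : ContinuousOn Θ (Set.Ioi 0)
  top : ∃ B : ℝ, ∀ t : ℝ, 1 ≤ t → ‖Θ t‖ ≤ B * Real.exp (-(1 / 2) * t)
  bot : ∀ N : ℕ, ∃ B : ℝ, ∀ t : ℝ, 0 < t → t ≤ 1 → ‖Θ t - (c / t - d)‖ ≤ B * t ^ N

/-- The function `Θ` with its singular part `c / t - d` on `(0, 1]` removed. -/
noncomputable def thetaRem (Θ : ℝ → ℂ) (c d : ℂ) (t : ℝ) : ℂ :=
  Θ t - (c • (Set.Ioc 0 1).indicator (fun t : ℝ => (t : ℂ) ^ (-1 : ℂ)) t -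
    d • (Set.Ioc (0 : ℝ) 1).indicator (fun _ => (1 : ℂ)) t)

theorem thetaRem_of_le {Θ : ℝ → ℂ} {c d : ℂ} {t : ℝ} (h0 : 0 < t) (h1 : t ≤ 1) :
    thetaRem Θ c d t = Θ t - (c / t - d) := by
  have ht : t ∈ Set.Ioc (0 : ℝ) 1 := ⟨h0, h1⟩
  rw [thetaRem, Set.indicator_of_mem ht, Set.indicator_of_mem ht, Complex.cpow_neg_one]
  simp [div_eq_mul_inv]

theorem thetaRem_of_lt {Θ : ℝ → ℂ} {c d : ℂ} {t : ℝ} (h1 : 1 < t) : thetaRem Θ c d t = Θ t := by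
  have : t ∉ Set.Ioc (0 : ℝ) 1 := fun h => absurd h.2 (not_le.2 h1)
  simp [thetaRem, Set.indicator_of_notMem this]

namespace IsThetaLike

variable {Θ : ℝ → ℂ} {c d : ℂ}

theorem locallyIntegrableOn_thetaRem (h : IsThetaLike Θ c d) :
    LocallyIntegrableOn (thetaRem Θ c d) (Set.Ioi 0) := by
  have hm : MeasurableSet (Set.Ioc (0 : ℝ) 1) := measurableSet_Ioc
  have h1 : LocallyIntegrableOn (fun t : ℝ => (t : ℂ) ^ (-1 : ℂ)) (Set.Ioi 0) := by
    refine ContinuousOn.locallyIntegrableOn (fun t ht => ?_) measurableSet_Ioi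
    exact (Complex.continuousAt_ofReal_cpow_const t (-1) (Or.inr (ne_of_gt ht))).continuousWithinAt
  have key : ∀ f : ℝ → ℂ, LocallyIntegrableOn f (Set.Ioi 0) →
      LocallyIntegrableOn ((Set.Ioc (0 : ℝ) 1).indicator f) (Set.Ioi 0) := fun f hf => by
    intro t ht
    obtain ⟨s, hs, hs'⟩ := hf t ht
    exact ⟨s, hs, hs'.indicator hm⟩
  exact (h.continuousOn.locallyIntegrableOn measurableSet_Ioi).sub
    (((key _ h1).smul c).sub ((key _ (continuous_const.continuousOn.locallyIntegrableOn
      measurableSet_Ioi)).smul d))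

theorem thetaRem_isBigO_atTop (h : IsThetaLike Θ c d) :
    thetaRem Θ c d =O[Filter.atTop] fun t => Real.exp (-(1 / 2) * t) := by
  obtain ⟨B, hB⟩ := h.top
  refine Asymptotics.IsBigO.of_bound B ?_
  filter_upwards [Filter.eventually_gt_atTop 1] with t ht
  rw [thetaRem_of_lt ht, Real.norm_of_nonneg (Real.exp_pos _).le]
  exact hB t ht.le

theorem thetaRem_isBigO_zero (h : IsThetaLike Θ c d) (N : ℕ) :
    thetaRem Θ c d =O[nhdsWithin 0 (Set.Ioi 0)] fun t => t ^ (-(-(N : ℝ))) := by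
  obtain ⟨B, hB⟩ := h.bot N
  refine Asymptotics.IsBigO.of_bound B ?_
  filter_upwards [Ioc_mem_nhdsGT (zero_lt_one' ℝ)] with t ht
  rw [thetaRem_of_le ht.1 ht.2, neg_neg, Real.rpow_natCast,
    Real.norm_of_nonneg (pow_nonneg ht.1.le _)]
  exact hB t ht.1 ht.2

theorem mellinConvergent_thetaRem (h : IsThetaLike Θ c d) (s : ℂ) :
    MellinConvergent (thetaRem Θ c d) s := by
  obtain ⟨N, hN⟩ := exists_nat_gt (-s.re)
  exact mellinConvergent_of_isBigO_rpow_exp one_half_pos h.locallyIntegrableOn_thetaRem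
    h.thetaRem_isBigO_atTop (h.thetaRem_isBigO_zero N) (by linarith)

theorem differentiable_mellin_thetaRem (h : IsThetaLike Θ c d) :
    Differentiable ℂ (mellin (thetaRem Θ c d)) := fun s => by
  obtain ⟨N, hN⟩ := exists_nat_gt (-s.re)
  exact mellin_differentiableAt_of_isBigO_rpow_exp one_half_pos h.locallyIntegrableOn_thetaRem
    h.thetaRem_isBigO_atTop (h.thetaRem_isBigO_zero N) (by linarith)

theorem mellin_eq (h : IsThetaLike Θ c d) {s : ℂ} (hs : 1 < s.re) :
    mellin Θ s = mellin (thetaRem Θ c d) s + (c / (s - 1) - d / s) := by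
  have h1 := hasMellin_cpow_Ioc (-1) (s := s) (by simpa using sub_pos.2 hs)
  have h2 := hasMellin_one_Ioc (s := s) (by linarith)
  have h3 := hasMellin_sub (h1.1.const_smul c) (h2.1.const_smul d)
  have h4 := hasMellin_add (h.mellinConvergent_thetaRem s) h3.1
  rw [h3.2, mellin_const_smul, mellin_const_smul, h1.2, h2.2] at h4
  convert h4.2 using 2
  · funext t
    simp [thetaRem]
  · simp [div_eq_mul_inv, sub_eq_add_neg]

end IsThetaLike

theorem exists_norm_mellin_le : ∃ C : ℝ, 0 < C ∧ ∀ (f : ℝ → ℂ) (B : ℝ),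
    (∀ t : ℝ, 0 < t → t ≤ 1 → ‖f t‖ ≤ B * t) →
    (∀ t : ℝ, 1 < t → ‖f t‖ ≤ B * Real.exp (-(1 / 2) * t)) →
    ∀ s : ℂ, -1 / 4 ≤ s.re → s.re ≤ 5 / 4 → ‖mellin f s‖ ≤ C * B := by
  have h1 : ∀ r : ℝ, -1 < r →
      IntegrableOn (fun t : ℝ => t ^ r * Real.exp (-(1 / 2) * t)) (Set.Ioi 0) := fun r hr => by
    simpa using integrableOn_rpow_mul_exp_neg_mul_rpow (p := 1) (b := 1 / 2) hr one_pos one_half_pos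
  set k : ℝ → ℝ := fun t => 3 * (t ^ (-1 / 4 : ℝ) * Real.exp (-(1 / 2) * t) +
    t ^ (1 / 4 : ℝ) * Real.exp (-(1 / 2) * t)) with hk
  have hki : IntegrableOn k (Set.Ioi 0) :=
    ((h1 _ (by norm_num)).add (h1 _ (by norm_num))).const_mul 3
  have hk0 : 0 ≤ ∫ t in Set.Ioi 0, k t :=
    setIntegral_nonneg measurableSet_Ioi fun t ht => by
      have : 0 < t := ht
      positivity
  refine ⟨(∫ t in Set.Ioi 0, k t) + 1, by linarith, fun f B hb1 hb2 s hs1 hs2 => ?_⟩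
  have hB : 0 ≤ B := by simpa using (norm_nonneg _).trans (hb1 1 one_pos le_rfl)
  have h2 : ‖mellin f s‖ ≤ ∫ t in Set.Ioi 0, k t * B := by
    refine norm_integral_le_of_norm_le (hki.mul_const B) ?_
    refine (ae_restrict_iff' measurableSet_Ioi).2 (Filter.Eventually.of_forall fun t ht => ?_)
    have ht0 : 0 < t := ht
    rw [norm_smul, Complex.norm_cpow_eq_rpow_re_of_pos ht0, Complex.sub_re, Complex.one_re]
    rcases le_or_gt t 1 with ht1 | ht1
    · have e1 : t ^ (s.re - 1) * t ≤ t ^ (-1 / 4 : ℝ) := by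
        rw [← Real.rpow_add_one ht0.ne', sub_add_cancel]
        exact Real.rpow_le_rpow_of_exponent_ge ht0 ht1 hs1
      have e2 : 1 ≤ 3 * Real.exp (-(1 / 2) * t) := by
        have : Real.exp (-(1 / 2) * 1) ≤ Real.exp (-(1 / 2) * t) :=
          Real.exp_le_exp.2 (by linarith)
        have h3 := Real.add_one_le_exp (-(1 / 2) * 1 : ℝ)
        linarith
      have e3 : t ^ (-1 / 4 : ℝ) * 1 ≤ t ^ (-1 / 4 : ℝ) * (3 * Real.exp (-(1 / 2) * t)) := by
        gcongr
      have e4 : 0 ≤ t ^ (1 / 4 : ℝ) * Real.exp (-(1 / 2) * t) := by positivity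
      calc t ^ (s.re - 1) * ‖f t‖ ≤ t ^ (s.re - 1) * (B * t) := by
            gcongr
            exact hb1 t ht0 ht1
        _ = (t ^ (s.re - 1) * t) * B := by ring
        _ ≤ k t * B := by
            gcongr
            rw [hk]
            linarith
    · have e1 : t ^ (s.re - 1) ≤ t ^ (1 / 4 : ℝ) :=
        Real.rpow_le_rpow_of_exponent_le ht1.le (by linarith)
      have e4 : 0 ≤ t ^ (-1 / 4 : ℝ) * Real.exp (-(1 / 2) * t) := by positivity
      have e5 : 0 ≤ t ^ (1 / 4 : ℝ) * Real.exp (-(1 / 2) * t) := by positivity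
      calc t ^ (s.re - 1) * ‖f t‖ ≤ t ^ (1 / 4 : ℝ) * (B * Real.exp (-(1 / 2) * t)) := by
            gcongr
            exact hb2 t ht1
        _ = (t ^ (1 / 4 : ℝ) * Real.exp (-(1 / 2) * t)) * B := by ring
        _ ≤ k t * B := by
            gcongr
            rw [hk]
            linarith
  rw [integral_mul_const] at h2
  nlinarith

end MellinRemainder

/-- An elementary upper bound for `1 / Γ` to the right of `-1 / 4`. -/
theorem exists_norm_one_div_Gamma_le : ∃ C : ℝ, 0 < C ∧ ∀ s : ℂ, -1 / 4 ≤ s.re → s.re ≤ 5 / 4 →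
    ‖(Complex.Gamma s)⁻¹‖ ≤ Real.exp (C * (1 + |s.im|)) := by
  have hcont : ContinuousOn (fun r : ℝ => Real.Gamma r) (Set.Icc (3 / 4) (9 / 4)) := fun r hr =>
    (Real.differentiableAt_Gamma fun m => by
      have : (0 : ℝ) ≤ m := Nat.cast_nonneg m
      linarith [hr.1]).continuousAt.continuousWithinAt
  obtain ⟨G, hG⟩ := isCompact_Icc.exists_bound_of_continuousOn hcont
  have hG0 : 0 ≤ G := (norm_nonneg _).trans (hG 1 ⟨by norm_num, by norm_num⟩)
  refine ⟨G + 8, by linarith, fun s h1 h2 => ?_⟩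
  have hπ := Real.pi_pos
  have hΓ : ‖Complex.Gamma (2 - s)‖ ≤ G := by
    have hre : 0 < (2 - s).re := by simp; linarith
    have e1 : ‖Complex.Gamma (2 - s)‖ ≤ Real.Gamma (2 - s).re := by
      rw [Complex.Gamma_eq_integral hre, Real.Gamma_eq_integral hre, Complex.GammaIntegral]
      refine (MeasureTheory.norm_integral_le_integral_norm _).trans_eq ?_
      refine MeasureTheory.setIntegral_congr_fun measurableSet_Ioi fun t ht => ?_
      have ht0 : 0 < t := ht
      simp only [norm_mul, Complex.norm_real, Real.norm_eq_abs, Real.abs_exp]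
      rw [Complex.norm_cpow_eq_rpow_re_of_pos ht0, Complex.sub_re, Complex.one_re]
    refine e1.trans ((le_abs_self _).trans (hG _ ⟨?_, ?_⟩)) <;> simp <;> linarith
  have hsin : ∀ w : ℂ, ‖Complex.sin w‖ ≤ ‖w‖ * Real.exp ‖w‖ := fun w => by
    have e1 := Complex.norm_exp_sub_sum_le_norm_mul_exp (-w * Complex.I) 1
    have e2 := Complex.norm_exp_sub_sum_le_norm_mul_exp (w * Complex.I) 1
    simp only [Finset.sum_range_one, pow_zero, Nat.factorial_zero, Nat.cast_one, div_one, pow_one,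
      norm_mul, Complex.norm_I, mul_one, norm_neg] at e1 e2
    have e3 : Complex.sin w = ((Complex.exp (-w * Complex.I) - 1) -
        (Complex.exp (w * Complex.I) - 1)) * (Complex.I / 2) := by
      rw [Complex.sin]
      ring
    rw [e3, norm_mul, norm_div, Complex.norm_I]
    have e4 := norm_sub_le (Complex.exp (-w * Complex.I) - 1) (Complex.exp (w * Complex.I) - 1)
    rw [RCLike.norm_ofNat]
    linarith
  have hexp : 1 ≤ Real.exp ((G + 8) * (1 + |s.im|)) := Real.one_le_exp (by positivity)
  rcases eq_or_ne (Complex.Gamma s) 0 with h0 | h0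
  · rw [h0, inv_zero, norm_zero]
    positivity
  rcases eq_or_ne s 1 with rfl | hs1
  · simpa using hexp
  have hs1' : 1 - s ≠ 0 := sub_ne_zero.2 hs1.symm
  have hrefl := Complex.Gamma_mul_Gamma_one_sub s
  have hΓ1 : Complex.Gamma (1 - s) ≠ 0 := by
    refine Complex.Gamma_ne_zero fun m hm => ?_
    have hre := congrArg Complex.re hm
    simp only [Complex.sub_re, Complex.one_re, Complex.neg_re, Complex.natCast_re] at hre
    rcases m.eq_zero_or_pos with rfl | hm0
    · simp only [Nat.cast_zero, neg_zero] at hm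
      exact hs1' hm
    · have : (1 : ℝ) ≤ m := by exact_mod_cast hm0
      linarith
  have hsin0 : Complex.sin (Real.pi * s) ≠ 0 := fun h => by
    rw [h, div_zero] at hrefl
    exact mul_ne_zero h0 hΓ1 hrefl
  have hπ0 : (Real.pi : ℂ) ≠ 0 := by exact_mod_cast hπ.ne'
  have e1 : (Complex.Gamma s)⁻¹ =
      Complex.Gamma (2 - s) * Complex.sin (Real.pi * (1 - s)) / ((1 - s) * Real.pi) := by
    have e2 : Complex.Gamma (2 - s) = (1 - s) * Complex.Gamma (1 - s) := by
      rw [← Complex.Gamma_add_one _ hs1']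
      ring_nf
    have e3 : Complex.sin (Real.pi * (1 - s)) = Complex.sin (Real.pi * s) := by
      rw [mul_sub, mul_one, Complex.sin_pi_sub]
    rw [eq_div_iff hsin0] at hrefl
    rw [e2, e3, eq_div_iff (mul_ne_zero hs1' hπ0)]
    calc (Complex.Gamma s)⁻¹ * ((1 - s) * Real.pi) = (Complex.Gamma s)⁻¹ * Complex.Gamma s *
          ((1 - s) * Complex.Gamma (1 - s) * Complex.sin (Real.pi * s)) := by
          conv_lhs => rw [← hrefl]
          ring
      _ = _ := by rw [inv_mul_cancel₀ h0, one_mul]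
  have hnorm : ‖1 - s‖ ≤ 5 / 4 + |s.im| := by
    refine (Complex.norm_le_abs_re_add_abs_im _).trans (add_le_add ?_ (by simp))
    rw [abs_le]
    constructor <;> simp <;> linarith
  have hw := hsin (Real.pi * (1 - s))
  rw [norm_mul, Complex.norm_real, Real.norm_of_nonneg hπ.le] at hw
  have h1s : 0 < ‖1 - s‖ := norm_pos_iff.2 hs1'
  rw [e1, norm_div, norm_mul, norm_mul, Complex.norm_real, Real.norm_of_nonneg hπ.le,
    div_le_iff₀ (by positivity)]
  calc ‖Complex.Gamma (2 - s)‖ * ‖Complex.sin (Real.pi * (1 - s))‖ ≤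
      Real.exp G * (Real.pi * ‖1 - s‖ * Real.exp (Real.pi * ‖1 - s‖)) := by
        gcongr
        exact hΓ.trans (by linarith [Real.add_one_le_exp G])
    _ = Real.exp (G + Real.pi * ‖1 - s‖) * (‖1 - s‖ * Real.pi) := by
        rw [Real.exp_add]
        ring
    _ ≤ _ := by
        gcongr
        nlinarith [Real.pi_lt_four, abs_nonneg s.im]

theorem Complex.normSq_add_eq (z w : ℂ) :
    Complex.normSq (z + w) = Complex.normSq z + Complex.normSq w +
      2 * ((starRingEnd ℂ) z * w).re := by
  rw [Complex.normSq_add]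
  simp

theorem exists_reduced_pair {M : Type*} [AddCommGroup M] (f : M →+ ℂ) (q : M → ℕ)
    (hq : ∀ x, Complex.normSq (f x) = q x)
    (hex : ∃ w : M × M, Function.Bijective fun p : ℤ × ℤ => p.1 • w.1 + p.2 • w.2) :
    ∃ w : M × M, (Function.Bijective fun p : ℤ × ℤ => p.1 • w.1 + p.2 • w.2) ∧
      |2 * ((starRingEnd ℂ) (f w.1) * f w.2).re| ≤ q w.1 ∧
      |2 * ((starRingEnd ℂ) (f w.1) * f w.2).re| ≤ q w.2 := by
  set S : Set (M × M) := {w | Function.Bijective fun p : ℤ × ℤ => p.1 • w.1 + p.2 • w.2} with hS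
  set μ : M × M → ℕ := fun w => q w.1 + q w.2 with hμ
  have hne : S.Nonempty := hex
  set w := Function.argminOn μ S hne with hw
  have hwS : w ∈ S := Function.argminOn_mem μ S hne
  have hmin : ∀ v ∈ S, μ w ≤ μ v := fun v hv => Function.argminOn_le μ S hv
  refine ⟨w, hwS, ?_⟩
  have shear1 : ∀ ε : ℤ, (w.1, ε • w.1 + w.2) ∈ S := fun ε => by
    have e : Function.Bijective fun p : ℤ × ℤ => (p.1 + p.2 * ε, p.2) := by
      refine Function.bijective_iff_has_inverse.2 ⟨fun p => (p.1 - p.2 * ε, p.2), ?_, ?_⟩ <;>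
        intro p <;> simp
    have := hwS.comp e
    change Function.Bijective _
    convert this using 1
    funext p
    simp only [Function.comp, add_smul, smul_add, mul_smul]
    abel
  have shear2 : ∀ ε : ℤ, (ε • w.2 + w.1, w.2) ∈ S := fun ε => by
    have e : Function.Bijective fun p : ℤ × ℤ => (p.1, p.2 + p.1 * ε) := by
      refine Function.bijective_iff_has_inverse.2 ⟨fun p => (p.1, p.2 - p.1 * ε), ?_, ?_⟩ <;>
        intro p <;> simp
    have := hwS.comp e
    change Function.Bijective _
    convert this using 1
    funext p
    simp only [Function.comp, add_smul, smul_add, mul_smul]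
    abel
  have key1 : ∀ ε : ℤ, (q w.2 : ℝ) ≤ Complex.normSq (f (ε • w.1 + w.2)) := fun ε => by
    have h := hmin _ (shear1 ε)
    simp only [hμ, add_le_add_iff_left] at h
    rw [hq]
    exact_mod_cast h
  have key2 : ∀ ε : ℤ, (q w.1 : ℝ) ≤ Complex.normSq (f (ε • w.2 + w.1)) := fun ε => by
    have h := hmin _ (shear2 ε)
    simp only [hμ, add_le_add_iff_right] at h
    rw [hq]
    exact_mod_cast h
  have a1 := key1 1
  have a2 := key1 (-1)
  have b1 := key2 1
  have b2 := key2 (-1)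
  simp only [one_smul, neg_smul, map_add, map_neg, Complex.normSq_add_eq, Complex.normSq_neg, hq,
    neg_mul, Complex.neg_re] at a1 a2 b1 b2
  have hsymm : ((starRingEnd ℂ) (f w.2) * f w.1).re = ((starRingEnd ℂ) (f w.1) * f w.2).re := by
    simp
    ring
  rw [hsymm] at b1 b2
  constructor <;> rw [abs_le] <;> constructor <;> linarith

section QuadraticField

variable {K : Type} [Field K] [NumberField K]

theorem exists_embedding_normSq (hK : Module.finrank ℚ K = 2) {D : ℕ} (hD : 0 < D)
    {α : K} (hα : α ^ 2 = -(D : K)) : ∃ σ : K →+* ℂ, (σ α).re = 0 ∧ (σ α).im ^ 2 = D ∧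
      ∀ x : 𝓞 K, Complex.normSq (σ x) = Ideal.absNorm (Ideal.span {x}) := by
  obtain ⟨σ⟩ : Nonempty (K →ₐ[ℚ] ℂ) := ⟨IsAlgClosed.lift⟩
  have h2 : (σ α) ^ 2 = -(D : ℂ) := by rw [← map_pow, hα, map_neg, map_natCast]
  have hre : (σ α).re = 0 ∧ (σ α).im ^ 2 = D := by
    have e1 := congrArg Complex.re h2
    have e2 := congrArg Complex.im h2
    simp only [pow_two, Complex.mul_re, Complex.mul_im, Complex.neg_re, Complex.natCast_re,
      Complex.neg_im, Complex.natCast_im, neg_zero] at e1 e2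
    have hD' : (0 : ℝ) < D := by exact_mod_cast hD
    have h0 : (σ α).re * (σ α).im = 0 := by linarith
    rcases mul_eq_zero.1 h0 with h | h
    · refine ⟨h, ?_⟩
      rw [h] at e1
      linarith
    · rw [h] at e1
      nlinarith [mul_self_nonneg (σ α).re]
  refine ⟨σ, hre.1, hre.2, fun x => ?_⟩
  let τ : K →ₐ[ℚ] ℂ := RingHom.toRatAlgHom ((starRingEnd ℂ).comp (σ : K →+* ℂ))
  have hτ : ∀ y, τ y = (starRingEnd ℂ) (σ y) := fun y => rfl
  have hne : σ ≠ τ := fun h => by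
    have h3 : (σ α).im = -(σ α).im := by
      conv_lhs => rw [h, hτ]
      simp
    have h4 : (σ α).im = 0 := by linarith
    have := hre.2
    rw [h4] at this
    have hD' : (0 : ℝ) < D := by exact_mod_cast hD
    norm_num at this
    linarith
  have huniv : (Finset.univ : Finset (K →ₐ[ℚ] ℂ)) = {σ, τ} := by
    refine (Finset.eq_univ_of_card _ ?_).symm
    rw [Finset.card_pair hne, AlgHom.card, hK]
  have h5 := Algebra.norm_eq_prod_embeddings ℚ ℂ (x : K)
  rw [huniv, Finset.prod_pair hne, hτ, Complex.mul_conj, ← Algebra.coe_norm_int] at h5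
  rw [Ideal.absNorm_span_singleton]
  have h6 : Complex.normSq (σ x) = ((Algebra.norm ℤ x : ℤ) : ℝ) := by
    have : ((Algebra.norm ℤ x : ℤ) : ℂ) = (Complex.normSq (σ x) : ℂ) := by
      rw [← h5]
      simp
    exact_mod_cast this.symm
  have h7 : 0 ≤ Algebra.norm ℤ x := by
    have := Complex.normSq_nonneg (σ x)
    rw [h6] at this
    exact_mod_cast this
  change Complex.normSq (σ x) = _
  rw [h6]
  rw [Nat.cast_natAbs, abs_of_nonneg h7]

theorem im_conj_mul_of_combination (z w : ℂ) (a b c d : ℝ) :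
    ((starRingEnd ℂ) (a * z + b * w) * (c * z + d * w)).im =
      (a * d - b * c) * ((starRingEnd ℂ) z * w).im := by
  simp
  ring

theorem exists_disc (hK : Module.finrank ℚ K = 2) {D : ℕ} (hD : 0 < D) {α : K}
    (hα : α ^ 2 = -(D : K)) : ∃ V : ℝ, V ≤ 4 * D ∧
    ∀ J : nonZeroDivisors (Ideal (𝓞 K)), ∃ a b c : ℝ, IsReducedForm a b c ∧
      4 * a * c - b ^ 2 = V ∧ ∃ e : ℤ × ℤ ≃ (J : Ideal (𝓞 K)), e 0 = 0 ∧ ∀ p,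
        (Ideal.absNorm (Ideal.span {(e p : 𝓞 K)}) : ℝ) = Ideal.absNorm (J : Ideal (𝓞 K)) *
          (a * p.1 ^ 2 + b * p.1 * p.2 + c * p.2 ^ 2) := by
  obtain ⟨σ, hσre, hσim, hσ⟩ := exists_embedding_normSq hK hD hα
  have hrank : Module.finrank ℤ (𝓞 K) = 2 := (RingOfIntegers.rank K).trans hK
  let B := Module.finBasisOfFinrankEq ℤ (𝓞 K) hrank
  have hσB : ∀ x : 𝓞 K, σ x = (B.repr x 0 : ℝ) * σ (B 0) + (B.repr x 1 : ℝ) * σ (B 1) := fun x => by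
    conv_lhs => rw [← B.sum_repr x, Fin.sum_univ_two]
    simp
  set β : ℝ := ((starRingEnd ℂ) (σ (B 0)) * σ (B 1)).im with hβ
  have hdet : ∀ x y : 𝓞 K, ((starRingEnd ℂ) (σ x) * σ y).im = (B.det ![x, y] : ℤ) * β := by
    intro x y
    rw [hσB x, hσB y, im_conj_mul_of_combination, Module.Basis.det_apply, Matrix.det_fin_two]
    simp only [Module.Basis.toMatrix_apply, Matrix.cons_val_zero, Matrix.cons_val_one]
    push_cast
    ring
  refine ⟨4 * β ^ 2, ?_, fun J => ?_⟩
  · have hintg : IsIntegral ℤ α := by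
      refine IsIntegral.of_pow two_pos ?_
      rw [hα]
      exact IsIntegral.neg (isIntegral_natCast D)
    have h1 := hdet 1 ⟨α, hintg⟩
    have h2 : ((starRingEnd ℂ) (σ ((1 : 𝓞 K) : K)) * σ ((⟨α, hintg⟩ : 𝓞 K) : K)).im = (σ α).im := by
      rw [show ((1 : 𝓞 K) : K) = 1 from rfl, map_one, map_one, one_mul]
    rw [h2.symm.trans h1] at hσim
    set n := B.det ![1, ⟨α, hintg⟩]
    have hn : n ≠ 0 := fun h0 => by
      rw [h0] at hσim
      have hD' : (0 : ℝ) < D := by exact_mod_cast hD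
      norm_num at hσim
      linarith
    have hn1 : (1 : ℝ) ≤ (n : ℝ) ^ 2 := by
      have : 1 ≤ n ^ 2 := by
        have := sq_pos_of_ne_zero hn
        omega
      exact_mod_cast this
    rw [← hσim]
    nlinarith [sq_nonneg β]
  have hJ0 : (J : Ideal (𝓞 K)) ≠ ⊥ := nonZeroDivisors.coe_ne_zero J
  have hNJ : (0 : ℝ) < Ideal.absNorm (J : Ideal (𝓞 K)) := by
    exact_mod_cast Nat.pos_of_ne_zero (absNorm_nonZeroDivisors_ne_zero J)
  have hrankJ : Module.finrank ℤ (J : Ideal (𝓞 K)) = 2 :=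
    (Ideal.finrank_eq_finrank B _ hJ0).trans hrank
  let f : (J : Ideal (𝓞 K)) →+ ℂ :=
    { toFun := fun x => σ ((x : 𝓞 K) : K)
      map_zero' := by simp
      map_add' := fun x y => by simp }
  have hf : ∀ x, f x = σ ((x : 𝓞 K) : K) := fun x => rfl
  obtain ⟨w, hbij, h1, h2⟩ := exists_reduced_pair f
    (fun x => Ideal.absNorm (Ideal.span {(x : 𝓞 K)})) (fun x => hσ x) (by
      let BJ := Module.finBasisOfFinrankEq ℤ (J : Ideal (𝓞 K)) hrankJ
      refine ⟨(BJ 0, BJ 1), ?_⟩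
      have := ((LinearEquiv.finTwoArrow ℤ ℤ).symm.trans BJ.equivFun.symm).bijective
      convert this using 1
      funext p
      simp [Module.Basis.equivFun_symm_apply, Fin.sum_univ_two])
  set E : ℤ × ℤ ≃ (J : Ideal (𝓞 K)) := Equiv.ofBijective _ hbij with hE
  have hEa : ∀ p, E p = p.1 • w.1 + p.2 • w.2 := fun p => rfl
  have hfE : ∀ p, f (E p) = (p.1 : ℝ) * f w.1 + (p.2 : ℝ) * f w.2 := fun p => by
    rw [hEa, map_add, map_zsmul, map_zsmul]
    simp
  have hw1 : w.1 ≠ 0 := fun h => by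
    have : (1, 0) = (0 : ℤ × ℤ) := E.injective (by simp [hEa, h])
    simp at this
  have hw2 : w.2 ≠ 0 := fun h => by
    have : (0, 1) = (0 : ℤ × ℤ) := E.injective (by simp [hEa, h])
    simp at this
  have hle : ∀ x : (J : Ideal (𝓞 K)), x ≠ 0 → (Ideal.absNorm (J : Ideal (𝓞 K)) : ℝ) ≤
      Ideal.absNorm (Ideal.span {(x : 𝓞 K)}) := fun x hx => by
    have hdvd : Ideal.absNorm (J : Ideal (𝓞 K)) ∣ Ideal.absNorm (Ideal.span {(x : 𝓞 K)}) :=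
      Ideal.absNorm_dvd_absNorm_of_le ((Ideal.span_singleton_le_iff_mem _).2 x.2)
    have hpos : Ideal.absNorm (Ideal.span {(x : 𝓞 K)}) ≠ 0 := by
      rw [Ne, Ideal.absNorm_eq_zero_iff, Ideal.span_singleton_eq_bot]
      exact fun h => hx (Subtype.ext h)
    exact_mod_cast Nat.le_of_dvd (Nat.pos_of_ne_zero hpos) hdvd
  have hn1 := hσ (w.1 : 𝓞 K)
  have hn2 := hσ (w.2 : 𝓞 K)
  rw [← hf] at hn1 hn2
  set NJ : ℝ := ((Ideal.absNorm (J : Ideal (𝓞 K)) : ℕ) : ℝ) with hNJdef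
  set N1 : ℝ := ((Ideal.absNorm (Ideal.span {(w.1 : 𝓞 K)}) : ℕ) : ℝ) with hN1
  set N2 : ℝ := ((Ideal.absNorm (Ideal.span {(w.2 : 𝓞 K)}) : ℕ) : ℝ) with hN2
  set r : ℝ := 2 * ((starRingEnd ℂ) (f w.1) * f w.2).re with hr
  refine ⟨N1 / NJ, r / NJ, N2 / NJ, ⟨?_, ?_, ?_, ?_⟩, ?_, E, ?_, fun p => ?_⟩
  · exact (one_le_div hNJ).2 (hle _ hw1)
  · exact (one_le_div hNJ).2 (hle _ hw2)
  · rw [abs_div, abs_of_pos hNJ]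
    gcongr
  · rw [abs_div, abs_of_pos hNJ]
    gcongr
  · obtain ⟨T, hT⟩ : ∃ T : (ℤ × ℤ) ≃ₗ[ℤ] (J : Ideal (𝓞 K)), ∀ p, T p = p.1 • w.1 + p.2 • w.2 :=
      ⟨{ E with
          map_add' := fun p q => by
            change E (p + q) = E p + E q
            simp only [hEa, Prod.fst_add, Prod.snd_add, add_smul]
            abel
          map_smul' := fun n p => by
            change E (n • p) = n • E p
            simp only [hEa, Prod.smul_fst, Prod.smul_snd, smul_eq_mul, mul_smul, smul_add] },
        fun p => rfl⟩
    let BJ : Module.Basis (Fin 2) ℤ (J : Ideal (𝓞 K)) := Module.Basis.ofEquivFun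
      (T.symm.trans (LinearEquiv.finTwoArrow ℤ ℤ).symm)
    have hBJ : (Subtype.val ∘ BJ : Fin 2 → 𝓞 K) = ![(w.1 : 𝓞 K), (w.2 : 𝓞 K)] := by
      funext i
      fin_cases i <;> simp [BJ, Module.Basis.coe_ofEquivFun, hT]
    have h3 := Ideal.natAbs_det_basis_change B (J : Ideal (𝓞 K)) BJ
    rw [hBJ] at h3
    have h4 := hdet w.1 w.2
    have h5 : ((B.det ![(w.1 : 𝓞 K), (w.2 : 𝓞 K)] : ℤ) : ℝ) ^ 2 = NJ ^ 2 := by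
      rw [hNJdef, ← h3, Nat.cast_natAbs]
      simp
    have h6 : r ^ 2 / 4 + ((starRingEnd ℂ) (f w.1) * f w.2).im ^ 2 = N1 * N2 := by
      rw [← hn1, ← hn2, ← Complex.normSq_conj (f w.1), ← Complex.normSq_mul, Complex.normSq_apply,
        hr]
      ring
    rw [show ((starRingEnd ℂ) (f w.1) * f w.2).im = _ from h4, mul_pow _ β, h5] at h6
    field_simp
    linarith
  · rw [hEa]
    simp
  · have h7 := hσ (E p : 𝓞 K)
    rw [← hf, hfE, Complex.normSq_add_eq, Complex.normSq_mul, Complex.normSq_mul, hn1, hn2,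
      Complex.normSq_ofReal, Complex.normSq_ofReal] at h7
    have h8 : 2 * ((starRingEnd ℂ) ((p.1 : ℝ) * f w.1) * ((p.2 : ℝ) * f w.2)).re =
        p.1 * p.2 * r := by
      rw [hr]
      simp
      ring
    rw [h8] at h7
    rw [← h7]
    field_simp
    ring

end QuadraticField

section ClassTheta

variable {K : Type} [Field K] [NumberField K]

theorem exists_mul_eq_span_of_mem {I₀ : nonZeroDivisors (Ideal (𝓞 K))} {x : 𝓞 K}
    (hx : x ∈ (I₀ : Ideal (𝓞 K))) (hx0 : x ≠ 0) : ∃ I : nonZeroDivisors (Ideal (𝓞 K)),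
      ClassGroup.mk0 I = (ClassGroup.mk0 I₀)⁻¹ ∧ (I : Ideal (𝓞 K)) * I₀ = Ideal.span {x} := by
  obtain ⟨I, hI⟩ := Ideal.dvd_iff_le.2 ((Ideal.span_singleton_le_iff_mem _).2 hx)
  have hI0 : I ∈ nonZeroDivisors (Ideal (𝓞 K)) := by
    refine mem_nonZeroDivisors_of_ne_zero fun h => hx0 ?_
    rw [h, mul_zero] at hI
    exact Ideal.span_singleton_eq_bot.1 hI
  have hmul : I * (I₀ : Ideal (𝓞 K)) = Ideal.span {x} := by rw [mul_comm, hI]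
  exact ⟨⟨I, hI0⟩, ClassGroup.mk0_eq_mk0_inv_iff.2 ⟨x, hx0, hmul⟩, hmul⟩

theorem nonempty_units_equiv_fiber {I₀ : nonZeroDivisors (Ideal (𝓞 K))}
    {I : nonZeroDivisors (Ideal (𝓞 K))} (hI : ClassGroup.mk0 I = (ClassGroup.mk0 I₀)⁻¹) :
    Nonempty ((𝓞 K)ˣ ≃ {x : (I₀ : Ideal (𝓞 K)) //
      (I : Ideal (𝓞 K)) * I₀ = Ideal.span {(x : 𝓞 K)}}) := by
  obtain ⟨y, hy0, hy⟩ := ClassGroup.mk0_eq_mk0_inv_iff.1 hI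
  have hyI : y ∈ (I₀ : Ideal (𝓞 K)) := by
    have h1 : y ∈ (I : Ideal (𝓞 K)) * I₀ := by
      rw [hy]
      exact Ideal.mem_span_singleton_self y
    exact Ideal.mul_le_right h1
  have hex : ∀ u : (𝓞 K)ˣ, ∃ x : {x : (I₀ : Ideal (𝓞 K)) //
      (I : Ideal (𝓞 K)) * I₀ = Ideal.span {(x : 𝓞 K)}}, (x.1 : 𝓞 K) = u * y := fun u =>
    ⟨⟨⟨u * y, Ideal.mul_mem_left _ _ hyI⟩, by
      rw [hy]
      exact (Ideal.span_singleton_mul_left_unit u.isUnit y).symm⟩, rfl⟩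
  choose T hT using hex
  refine ⟨Equiv.ofBijective T ⟨fun u v huv => ?_, fun x => ?_⟩⟩
  · have h1 : (u : 𝓞 K) * y = v * y := by rw [← hT, ← hT, huv]
    exact Units.ext (mul_right_cancel₀ hy0 h1)
  · obtain ⟨u, hu⟩ := Ideal.span_singleton_eq_span_singleton.1 (hy.symm.trans x.2)
    refine ⟨u, Subtype.ext (Subtype.ext ?_)⟩
    rw [hT, mul_comm, hu]

/-- The ideals in the inverse class of `I₀` are the nonzero elements of `I₀` up to units. -/
theorem hasSum_class_of_hasSum_mem {I₀ : nonZeroDivisors (Ideal (𝓞 K))} {f : ℝ → ℝ} {S : ℝ}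
    (hf : ∀ y, 0 < f y)
    (h : HasSum (fun x : {x : (I₀ : Ideal (𝓞 K)) // (x : 𝓞 K) ≠ 0} =>
      f (Ideal.absNorm (Ideal.span {(x.1 : 𝓞 K)}) / Ideal.absNorm (I₀ : Ideal (𝓞 K)))) S) :
    0 < Nat.card (𝓞 K)ˣ ∧
    HasSum (fun I : {I : nonZeroDivisors (Ideal (𝓞 K)) //
      ClassGroup.mk0 I = (ClassGroup.mk0 I₀)⁻¹} => f (Ideal.absNorm (I.1 : Ideal (𝓞 K))))
      (S / Nat.card (𝓞 K)ˣ) := by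
  have hN0 : (Ideal.absNorm (I₀ : Ideal (𝓞 K)) : ℝ) ≠ 0 := by
    exact_mod_cast absNorm_nonZeroDivisors_ne_zero I₀
  obtain ⟨G, hG⟩ : ∃ G : {x : (I₀ : Ideal (𝓞 K)) // (x : 𝓞 K) ≠ 0} →
      {I : nonZeroDivisors (Ideal (𝓞 K)) // ClassGroup.mk0 I = (ClassGroup.mk0 I₀)⁻¹},
      ∀ x, ((G x).1 : Ideal (𝓞 K)) * I₀ = Ideal.span {(x.1 : 𝓞 K)} := by
    choose g hg1 hg2 using fun (x : {x : (I₀ : Ideal (𝓞 K)) // (x : 𝓞 K) ≠ 0}) =>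
      exists_mul_eq_span_of_mem (I₀ := I₀) x.1.2 x.2
    exact ⟨fun x => ⟨g x, hg1 x⟩, hg2⟩
  have hGiff : ∀ x I, G x = I ↔ (I.1 : Ideal (𝓞 K)) * I₀ = Ideal.span {(x.1 : 𝓞 K)} := by
    intro x I
    constructor
    · rintro rfl
      exact hG x
    · intro hI
      refine Subtype.ext (Subtype.ext ?_)
      refine mul_right_cancel₀ (nonZeroDivisors.coe_ne_zero I₀) ?_
      exact (hG x).trans hI.symm
  have hfib : ∀ I, Nonempty ((𝓞 K)ˣ ≃ G ⁻¹' {I}) := by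
    intro I
    obtain ⟨E⟩ := nonempty_units_equiv_fiber I.2
    have hne : ∀ x : {x : (I₀ : Ideal (𝓞 K)) // (I.1 : Ideal (𝓞 K)) * I₀ =
        Ideal.span {(x : 𝓞 K)}}, (x.1 : 𝓞 K) ≠ 0 := fun x h0 => by
      have hx := x.2
      rw [h0, Ideal.span_singleton_eq_bot.2 rfl] at hx
      rcases mul_eq_zero.1 hx with h1 | h1
      · exact nonZeroDivisors.coe_ne_zero I.1 h1
      · exact nonZeroDivisors.coe_ne_zero I₀ h1
    exact ⟨E.trans
      { toFun := fun x => ⟨⟨x.1, hne x⟩, (hGiff _ _).2 x.2⟩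
        invFun := fun x => ⟨x.1.1, (hGiff _ _).1 x.2⟩
        left_inv := fun x => rfl
        right_inv := fun x => rfl }⟩
  have hval : ∀ x : {x : (I₀ : Ideal (𝓞 K)) // (x : 𝓞 K) ≠ 0},
      f (Ideal.absNorm (Ideal.span {(x.1 : 𝓞 K)}) / Ideal.absNorm (I₀ : Ideal (𝓞 K))) =
        f (Ideal.absNorm ((G x).1 : Ideal (𝓞 K))) := by
    intro x
    rw [← hG x, map_mul, Nat.cast_mul, mul_div_cancel_right₀ _ hN0]
  replace h : HasSum (fun x => f (Ideal.absNorm ((G x).1 : Ideal (𝓞 K)))) S :=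
    h.congr_fun fun x => (hval x).symm
  have hcard : ∀ I, Nat.card (G ⁻¹' {I}) = Nat.card (𝓞 K)ˣ := fun I =>
    (Nat.card_congr (hfib I).some).symm
  have hconst : ∀ I (x : G ⁻¹' {I}), f (Ideal.absNorm ((G x.1).1 : Ideal (𝓞 K))) =
      f (Ideal.absNorm (I.1 : Ideal (𝓞 K))) := by
    rintro I ⟨x, hx⟩
    rw [Set.mem_preimage, Set.mem_singleton_iff] at hx
    rw [hx]
  have hw : 0 < Nat.card (𝓞 K)ˣ := by
    obtain ⟨x, hx, hx0⟩ := Submodule.exists_mem_ne_zero_of_ne_bot (nonZeroDivisors.coe_ne_zero I₀)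
    obtain ⟨I⟩ : Nonempty {I : nonZeroDivisors (Ideal (𝓞 K)) //
      ClassGroup.mk0 I = (ClassGroup.mk0 I₀)⁻¹} := ⟨G ⟨⟨x, hx⟩, hx0⟩⟩
    have h2 : Summable fun _ : G ⁻¹' {I} => f (Ideal.absNorm (I.1 : Ideal (𝓞 K))) :=
      (h.summable.subtype (G ⁻¹' {I})).congr fun x => hconst I x
    rcases finite_or_infinite (G ⁻¹' {I}) with h3 | h3
    · have : Finite (𝓞 K)ˣ := Finite.of_equiv _ (hfib I).some.symm
      exact Nat.card_pos
    · exact absurd ((summable_const_iff _).1 h2) (hf _).ne'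
  refine ⟨hw, ?_⟩
  have hw' : (Nat.card (𝓞 K)ˣ : ℝ) ≠ 0 := by exact_mod_cast hw.ne'
  refine ((h.tsum_fiberwise G).div_const (Nat.card (𝓞 K)ˣ : ℝ)).congr_fun fun I => ?_
  rw [tsum_congr (hconst I), tsum_const, hcard, nsmul_eq_mul, mul_div_cancel_left₀ _ hw']

theorem exists_class_theta (hK : Module.finrank ℚ K = 2) {D : ℕ} (hD : 0 < D) {α : K}
    (hα : α ^ 2 = -(D : K)) : ∃ V : ℝ, V ≤ 4 * D ∧ 0 < Nat.card (𝓞 K)ˣ ∧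
    ∀ c : ClassGroup (𝓞 K), ∃ A B C : ℝ, IsReducedForm A B C ∧ 4 * A * C - B ^ 2 = V ∧
      (∃ I : nonZeroDivisors (Ideal (𝓞 K)), ClassGroup.mk0 I = c ∧
        3 * (Ideal.absNorm (I : Ideal (𝓞 K)) : ℝ) ^ 2 ≤ V) ∧
      ∀ t : ℝ, 0 < t → HasSum (fun I : {I : nonZeroDivisors (Ideal (𝓞 K)) //
        ClassGroup.mk0 I = c} => Real.exp (-t * Ideal.absNorm (I.1 : Ideal (𝓞 K))))
        ((formTheta A B C t - 1) / Nat.card (𝓞 K)ˣ) := by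
  obtain ⟨V, hV, h⟩ := exists_disc hK hD hα
  have main : ∀ c : ClassGroup (𝓞 K), ∃ A B C : ℝ, IsReducedForm A B C ∧ 4 * A * C - B ^ 2 = V ∧
      (∃ I : nonZeroDivisors (Ideal (𝓞 K)), ClassGroup.mk0 I = c ∧
        3 * (Ideal.absNorm (I : Ideal (𝓞 K)) : ℝ) ^ 2 ≤ V) ∧
      ∀ t : ℝ, 0 < t → 0 < Nat.card (𝓞 K)ˣ ∧ HasSum (fun I : {I : nonZeroDivisors (Ideal (𝓞 K)) //
        ClassGroup.mk0 I = c} => Real.exp (-t * Ideal.absNorm (I.1 : Ideal (𝓞 K))))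
        ((formTheta A B C t - 1) / Nat.card (𝓞 K)ˣ) := by
    intro c
    obtain ⟨J, hJ⟩ := ClassGroup.mk0_surjective c⁻¹
    obtain ⟨A, B, C, hred, hdisc, e, he0, he⟩ := h J
    have hc : (ClassGroup.mk0 J)⁻¹ = c := by rw [hJ, inv_inv]
    have hN0 : (Ideal.absNorm (J : Ideal (𝓞 K)) : ℝ) ≠ 0 := by
      exact_mod_cast absNorm_nonZeroDivisors_ne_zero J
    have hex : ∀ p : ℤ × ℤ, p ≠ 0 → ∃ I : nonZeroDivisors (Ideal (𝓞 K)), ClassGroup.mk0 I = c ∧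
        (Ideal.absNorm (I : Ideal (𝓞 K)) : ℝ) = A * p.1 ^ 2 + B * p.1 * p.2 + C * p.2 ^ 2 := by
      intro p hp
      obtain ⟨I, hI, hI'⟩ := exists_mul_eq_span_of_mem (I₀ := J) (e p).2 (fun h0 => hp
        (e.injective (by rw [he0]; exact Subtype.ext h0)))
      refine ⟨I, hI.trans hc, ?_⟩
      have := he p
      rw [← hI', map_mul, Nat.cast_mul, mul_comm] at this
      exact mul_left_cancel₀ hN0 this
    refine ⟨A, B, C, hred, hdisc, ?_, fun t ht => ?_⟩
    · have h3 := hred.three_mul_le_disc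
      rw [hdisc] at h3
      have hA := hred.one_le_left
      have hC := hred.one_le_right
      rcases le_total A C with hle | hle
      · obtain ⟨I, hI, hI'⟩ := hex (1, 0) (by simp)
        refine ⟨I, hI, ?_⟩
        rw [hI']
        norm_num
        nlinarith
      · obtain ⟨I, hI, hI'⟩ := hex (0, 1) (by simp)
        refine ⟨I, hI, ?_⟩
        rw [hI']
        norm_num
        nlinarith
    · have h1 : HasSum (fun p : ℤ × ℤ =>
          Real.exp (-t * (A * p.1 ^ 2 + B * p.1 * p.2 + C * p.2 ^ 2))) (formTheta A B C t) :=
        (hred.summable_theta ht).hasSum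
      have h2 := (hasSum_ite_sub_hasSum h1 0)
      have h3 : HasSum (fun x : (J : Ideal (𝓞 K)) => if x = 0 then 0 else
          Real.exp (-t * (Ideal.absNorm (Ideal.span {(x : 𝓞 K)}) /
            Ideal.absNorm (J : Ideal (𝓞 K))))) (formTheta A B C t - 1) := by
        rw [← e.hasSum_iff]
        have h4 : formTheta A B C t - 1 = formTheta A B C t - Real.exp (-t *
            (A * ((0 : ℤ × ℤ).1 : ℝ) ^ 2 + B * ((0 : ℤ × ℤ).1 : ℝ) * ((0 : ℤ × ℤ).2 : ℝ) +
              C * ((0 : ℤ × ℤ).2 : ℝ) ^ 2)) := by simp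
        rw [h4]
        refine h2.congr_fun fun p => ?_
        rw [Function.comp_apply, he p, mul_div_cancel_left₀ _ hN0]
        have : e p = 0 ↔ p = 0 := by rw [← he0, e.injective.eq_iff]
        simp only [this]
      have h5 : HasSum (fun x : {x : (J : Ideal (𝓞 K)) // (x : 𝓞 K) ≠ 0} =>
          Real.exp (-t * (Ideal.absNorm (Ideal.span {((x : (J : Ideal (𝓞 K))) : 𝓞 K)}) /
            Ideal.absNorm (J : Ideal (𝓞 K))))) (formTheta A B C t - 1) := by
        have h6 := (hasSum_subtype_iff_of_support_subset (s := {x : (J : Ideal (𝓞 K)) | (x : 𝓞 K) ≠ 0})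
          (f := fun x : (J : Ideal (𝓞 K)) => if x = 0 then 0 else
          Real.exp (-t * (Ideal.absNorm (Ideal.span {(x : 𝓞 K)}) /
            Ideal.absNorm (J : Ideal (𝓞 K))))) (fun x hx h0 => hx (if_pos (Subtype.ext h0)))).2 h3
        refine h6.congr_fun fun x => ?_
        exact (if_neg fun h0 : x.1 = 0 => x.2 (congrArg Subtype.val h0)).symm
      have h7 := hasSum_class_of_hasSum_mem (f := fun y => Real.exp (-t * y))
        (fun y => Real.exp_pos _) h5
      rw [hc] at h7
      exact h7
  refine ⟨V, hV, ?_, fun c => ?_⟩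
  · obtain ⟨_, _, _, _, _, _, h1⟩ := main 1
    exact (h1 1 one_pos).1
  · obtain ⟨A, B, C, h1, h2, h3, h4⟩ := main c
    exact ⟨A, B, C, h1, h2, h3, fun t ht => (h4 t ht).2⟩

end ClassTheta

theorem IsReducedForm.continuousOn_formTheta {a b c : ℝ} (h : IsReducedForm a b c) :
    ContinuousOn (formTheta a b c) (Set.Ioi 0) := by
  intro t ht
  have ht' : 0 < t := ht
  have h1 : ContinuousOn (formTheta a b c) (Set.Ioi (t / 2)) := by
    refine continuousOn_tsum (u := fun p : ℤ × ℤ =>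
      Real.exp (-(t / 2) * (a * p.1 ^ 2 + b * p.1 * p.2 + c * p.2 ^ 2))) (fun p => ?_)
      (h.summable_theta (half_pos ht')) (fun p τ hτ => ?_)
    · fun_prop
    · rw [Real.norm_eq_abs, Real.abs_exp]
      have h2 := h.le_form p.1 p.2
      have h3 : 0 ≤ a * (p.1 : ℝ) ^ 2 + b * p.1 * p.2 + c * (p.2 : ℝ) ^ 2 :=
        le_trans (by positivity) h2
      have h4 : t / 2 < τ := hτ
      refine Real.exp_le_exp.2 ?_
      nlinarith
  exact (h1.continuousAt (Ioi_mem_nhds (half_lt_self ht'))).continuousWithinAt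

section CharTheta

theorem exists_charTheta : ∃ C : ℝ, 0 < C ∧ ∀ (K : Type) [Field K] [NumberField K],
    Module.finrank ℚ K = 2 → ∀ D : ℕ, 0 < D → (∃ α : K, α ^ 2 = -(D : K)) →
    (∀ c : ClassGroup (𝓞 K), ∃ I : nonZeroDivisors (Ideal (𝓞 K)), ClassGroup.mk0 I = c ∧
        3 * (Ideal.absNorm (I : Ideal (𝓞 K)) : ℝ) ^ 2 ≤ 4 * D) ∧
    ∀ χ : ClassGroup (𝓞 K) →* ℂ, ∃ (Θ : ℝ → ℂ) (c d : ℂ), IsThetaLike Θ c d ∧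
      (∀ t : ℝ, 0 < t → HasSum (fun I : nonZeroDivisors (Ideal (𝓞 K)) =>
        χ (ClassGroup.mk0 I) * (Real.exp (-(Ideal.absNorm (I : Ideal (𝓞 K)) : ℝ) * t) : ℂ)) (Θ t)) ∧
      (χ ≠ 1 → c = 0 ∧ d = 0) ∧
      (∀ t : ℝ, 0 < t → t ≤ 1 →
        ‖thetaRem Θ c d t‖ ≤ C * (classNumber K * (4 * D) ^ 4) * t) ∧
      (∀ t : ℝ, 1 < t → ‖thetaRem Θ c d t‖ ≤
        C * (classNumber K * (4 * D) ^ 4) * Real.exp (-(1 / 2) * t)) := by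
  obtain ⟨C₁, hC₁, hC₁'⟩ := exists_formTheta_sub_one_le
  obtain ⟨C₂, hC₂, hC₂'⟩ := exists_formTheta_sub_le (N := 2) (by norm_num)
  refine ⟨C₁ + C₂, by positivity, fun K _ _ hK D hD hα => ?_⟩
  obtain ⟨α, hα⟩ := hα
  obtain ⟨V, hV, hw, h⟩ := exists_class_theta hK hD hα
  choose A B C hred hdisc hmin hsum using h
  refine ⟨fun c => ?_, fun χ => ?_⟩
  · obtain ⟨I, hI, hI'⟩ := hmin c
    exact ⟨I, hI, hI'.trans hV⟩
  set w : ℝ := ((Nat.card (𝓞 K)ˣ : ℕ) : ℝ) with hwdef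
  have hw1 : 1 ≤ w := Nat.one_le_cast.2 hw
  have hw0 : 0 < w := by linarith
  have hV3 : 3 ≤ V := by
    have := (hred 1).three_le_disc
    rwa [hdisc] at this
  have hD1 : (1 : ℝ) ≤ (4 * D) ^ 4 := one_le_pow₀ (by linarith)
  set S : ℂ := ∑ c, χ c with hS
  set Θ : ℝ → ℂ := fun t => ∑ c, χ c * (((formTheta (A c) (B c) (C c) t - 1) / w : ℝ) : ℂ) with hΘ
  set e : ℂ := S * ((2 * Real.pi / √V / w : ℝ) : ℂ) with he
  set d : ℂ := S * ((1 / w : ℝ) : ℂ) with hd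
  have hcard : (classNumber K : ℝ) = (Finset.univ : Finset (ClassGroup (𝓞 K))).card := by
    rw [classNumber, Finset.card_univ]
  have hbound : ∀ (g : ClassGroup (𝓞 K) → ℝ) (b : ℝ), (∀ c, |g c| ≤ b) →
      ‖∑ c, χ c * ((g c / w : ℝ) : ℂ)‖ ≤ classNumber K * b := by
    intro g b hg
    rw [hcard, ← nsmul_eq_mul]
    refine (norm_sum_le _ _).trans (Finset.sum_le_card_nsmul _ _ _ fun c _ => ?_)
    rw [norm_mul, norm_classGroup_char, one_mul, Complex.norm_real, Real.norm_eq_abs, abs_div,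
      abs_of_pos hw0]
    exact (div_le_self (abs_nonneg _) hw1).trans (hg c)
  have htop : ∀ t : ℝ, 1 ≤ t → ‖Θ t‖ ≤ classNumber K * (C₁ * Real.exp (-(1 / 2) * t)) := by
    intro t ht
    refine hbound _ _ fun c => ?_
    have := hC₁' (hred c) ht
    rwa [show -t / 2 = -(1 / 2) * t by ring] at this
  have hdiff : ∀ t, Θ t - (e / t - d) =
      ∑ c, χ c * (((formTheta (A c) (B c) (C c) t - 2 * Real.pi / √V / t) / w : ℝ) : ℂ) := by
    intro t
    rw [hΘ, he, hd, hS]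
    simp only [Finset.sum_mul, Finset.sum_div, ← Finset.sum_sub_distrib]
    refine Finset.sum_congr rfl fun c _ => ?_
    push_cast
    ring
  have hbot : ∀ (C' : ℝ) (N : ℕ), (∀ {a b c : ℝ}, IsReducedForm a b c → ∀ {t : ℝ}, 0 < t → t ≤ 1 →
      |formTheta a b c t - 2 * Real.pi / √(4 * a * c - b ^ 2) / t| ≤
        C' * (4 * a * c - b ^ 2) ^ (2 * N) * t ^ (N - 1)) → ∀ t, 0 < t → t ≤ 1 →
      ‖Θ t - (e / t - d)‖ ≤ classNumber K * (C' * V ^ (2 * N) * t ^ (N - 1)) := by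
    intro C' N h t h0 h1
    rw [hdiff]
    refine hbound _ _ fun c => ?_
    have := h (hred c) h0 h1
    rwa [hdisc] at this
  refine ⟨Θ, e, d, ⟨?_, ⟨classNumber K * C₁, fun t ht => ?_⟩, fun N => ?_⟩, fun t ht => ?_,
    fun hχ => ?_, fun t h0 h1 => ?_, fun t ht => ?_⟩
  · refine continuousOn_finsetSum _ fun c _ => continuousOn_const.mul ?_
    exact Complex.continuous_ofReal.comp_continuousOn
      (((hred c).continuousOn_formTheta.sub continuousOn_const).div_const _)
  · rw [mul_assoc]
    exact htop t ht
  · obtain ⟨C', hC', h⟩ := exists_formTheta_sub_le (N := N + 1) (by omega)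
    refine ⟨classNumber K * (C' * V ^ (2 * (N + 1))), fun t h0 h1 => ?_⟩
    have := hbot C' (N + 1) h t h0 h1
    rw [Nat.add_sub_cancel] at this
    linarith
  · have h1 : ∀ c, HasSum (fun I : nonZeroDivisors (Ideal (𝓞 K)) =>
        if ClassGroup.mk0 I = c then χ c * (Real.exp (-(Ideal.absNorm (I : Ideal (𝓞 K)) : ℝ) * t) : ℂ)
          else 0) (χ c * (((formTheta (A c) (B c) (C c) t - 1) / w : ℝ) : ℂ)) := by
      intro c
      have h2 := ((Complex.hasSum_ofReal (f := fun I : {I : nonZeroDivisors (Ideal (𝓞 K)) //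
        ClassGroup.mk0 I = c} => Real.exp (-t * Ideal.absNorm (I.1 : Ideal (𝓞 K))))).2
          (hsum c t ht)).mul_left (χ c)
      refine ((hasSum_subtype_iff_indicator (s := {I | ClassGroup.mk0 I = c})
        (f := fun I : nonZeroDivisors (Ideal (𝓞 K)) =>
          χ c * (Real.exp (-t * Ideal.absNorm (I : Ideal (𝓞 K))) : ℂ))).1 h2).congr_fun fun I => ?_
      rw [Set.indicator_apply]
      simp only [Set.mem_ofPred_eq, neg_mul, mul_comm t]
    have h2 := hasSum_sum (s := Finset.univ) fun c _ => h1 c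
    refine h2.congr_fun fun I => ?_
    simp
  · have : S = 0 := sum_hom_units_eq_zero χ hχ
    simp [he, hd, this]
  · rw [thetaRem_of_le h0 h1]
    refine (hbot C₂ 2 hC₂' t h0 h1).trans ?_
    have h4 : V ^ 4 ≤ (4 * (D : ℝ)) ^ 4 := by gcongr
    have h5 : C₂ ≤ C₁ + C₂ := by linarith
    calc (classNumber K : ℝ) * (C₂ * V ^ (2 * 2) * t ^ (2 - 1))
        = C₂ * (classNumber K * V ^ 4) * t := by ring
      _ ≤ _ := by gcongr
  · rw [thetaRem_of_lt ht]
    refine (htop t ht.le).trans ?_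
    have h5 : C₁ ≤ C₁ + C₂ := by linarith
    calc (classNumber K : ℝ) * (C₁ * Real.exp (-(1 / 2) * t))
        = C₁ * (classNumber K * 1) * Real.exp (-(1 / 2) * t) := by ring
      _ ≤ _ := by gcongr

end CharTheta

theorem exists_classNumber_le {ε : ℝ} (hε : 0 < ε) : ∃ C : ℝ, 0 < C ∧
    ∀ (K : Type) [Field K] [NumberField K], Module.finrank ℚ K = 2 → ∀ D : ℕ, 0 < D →
      (∃ α : K, α ^ 2 = -(D : K)) → (classNumber K : ℝ) ≤ C * (D : ℝ) ^ ((1 + ε) / 2) := by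
  obtain ⟨_, _, hmain⟩ := exists_charTheta
  refine ⟨2 ^ (1 + ε) * Real.exp (4 * ∑' n : ℕ, (n : ℝ) ^ (-(1 + ε))), by positivity,
    fun K _ _ hK D hD hα => ?_⟩
  choose I hI hI' using (hmain K hK D hD hα).1
  have hinj : Function.Injective I := fun c d h => by rw [← hI c, h, hI d]
  have hD0 : (0 : ℝ) ≤ D := Nat.cast_nonneg D
  have hle : ∀ c, (Ideal.absNorm (I c : Ideal (𝓞 K)) : ℝ) ≤ 2 * √D := by
    intro c
    refine abs_le_of_sq_le_sq' ?_ (by positivity) |>.2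
    rw [mul_pow, Real.sq_sqrt hD0]
    nlinarith [hI' c, sq_nonneg (Ideal.absNorm (I c : Ideal (𝓞 K)) : ℝ)]
  obtain ⟨h1, h2, -⟩ := hasSum_idealTerm (K := K) hK 1 (s := ((1 + ε : ℝ) : ℂ))
    (by rw [Complex.ofReal_re]; linarith)
  rw [Complex.ofReal_re] at h2
  have h3 : (classNumber K : ℝ) * (2 * √D) ^ (-(1 + ε)) ≤
      Real.exp (4 * ∑' n : ℕ, (n : ℝ) ^ (-(1 + ε))) := by
    refine le_trans ?_ h2
    have h4 : ∑ c, ‖idealTerm (K := K) 1 ((1 + ε : ℝ) : ℂ) (I c)‖ ≤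
        ∑' J, ‖idealTerm (K := K) 1 ((1 + ε : ℝ) : ℂ) J‖ := by
      rw [← tsum_fintype (L := .unconditional _)]
      exact tsum_comp_le_tsum_of_inj h1 (fun _ => norm_nonneg _) hinj
    refine le_trans ?_ h4
    rw [classNumber, ← Finset.card_univ, ← nsmul_eq_mul]
    refine Finset.card_nsmul_le_sum _ _ _ fun c _ => ?_
    rw [norm_idealTerm, Complex.ofReal_re]
    have : (0 : ℝ) < Ideal.absNorm (I c : Ideal (𝓞 K)) := by
      exact_mod_cast Nat.pos_of_ne_zero (absNorm_nonZeroDivisors_ne_zero (I c))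
    exact Real.rpow_le_rpow_of_nonpos this (hle c) (by linarith)
  have hD1 : (0 : ℝ) < D := by exact_mod_cast hD
  have hpos : (0 : ℝ) < 2 * √D := by positivity
  rw [Real.rpow_neg hpos.le, ← div_eq_mul_inv, div_le_iff₀ (by positivity)] at h3
  refine h3.trans (le_of_eq ?_)
  rw [Real.mul_rpow zero_le_two (Real.sqrt_nonneg _), Real.sqrt_eq_rpow, ← Real.rpow_mul hD0]
  ring_nf

theorem summable_primePow_rpow {s : ℝ} (hs : 1 / 2 < s) :
    Summable fun n : ℕ => if IsPrimePow n ∧ ¬ n.Prime then (n : ℝ) ^ (-s) else 0 := by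
  set T : Set ℕ := {n | IsPrimePow n ∧ ¬ n.Prime} with hT
  have hex : ∀ n : T, ∃ q : ℕ × ℕ, 2 ≤ q.1 ∧ q.1 ^ (q.2 + 2) = (n : ℕ) := by
    rintro ⟨n, ⟨p, k, hp, hk, rfl⟩, hn⟩
    have hp' := hp.nat_prime
    refine ⟨(p, k - 2), hp'.two_le, ?_⟩
    have : k ≠ 1 := fun h => hn (by rw [h, pow_one]; exact hp')
    change p ^ (k - 2 + 2) = p ^ k
    congr 1
    omega
  choose q hq2 hq using hex
  have hinj : Function.Injective q := fun m n h => Subtype.ext (by rw [← hq m, h, hq n])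
  have h1 : Summable fun m : ℕ => (m : ℝ) ^ (-(2 * s)) :=
    Real.summable_nat_rpow.2 (by linarith)
  have h2 : Summable fun k : ℕ => ((2 : ℝ) ^ (-s)) ^ k :=
    summable_geometric_of_lt_one (by positivity)
      (Real.rpow_lt_one_of_one_lt_of_neg one_lt_two (by linarith))
  have h3 := h1.mul_of_nonneg h2 (fun m => by positivity) (fun k => by positivity)
  have h4 : Summable fun n : T => ((n : ℕ) : ℝ) ^ (-s) := by
    refine Summable.of_nonneg_of_le (fun n => by positivity) (fun n => ?_) (h3.comp_injective hinj)
    have hm : (2 : ℝ) ≤ (q n).1 := by exact_mod_cast hq2 n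
    have hm0 : (0 : ℝ) ≤ (q n).1 := by linarith
    simp only [Function.comp_apply]
    rw [← hq n, Nat.cast_pow, ← Real.rpow_natCast, ← Real.rpow_natCast, ← Real.rpow_mul hm0,
      ← Real.rpow_mul zero_le_two]
    have h5 : ((q n).1 : ℝ) ^ (((q n).2 + 2 : ℕ) * -s) =
        ((q n).1 : ℝ) ^ (-(2 * s)) * ((q n).1 : ℝ) ^ (-s * (q n).2) := by
      rw [← Real.rpow_add (by linarith)]
      push_cast
      ring_nf
    rw [h5]
    refine mul_le_mul_of_nonneg_left ?_ (by positivity)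
    refine Real.rpow_le_rpow_of_nonpos two_pos hm ?_
    have : (0 : ℝ) ≤ (q n).2 := Nat.cast_nonneg _
    nlinarith
  refine ((summable_subtype_iff_indicator (f := fun n : ℕ => (n : ℝ) ^ (-s))).1 h4).congr
    fun n => ?_
  rw [Set.indicator_apply]
  rfl

theorem exists_primePow_sum_le {α₁ α₂ η : ℝ} (hη : 0 < η) (hη' : η ≤ 1 / 2) {φ : ℝ → ℝ}
    (hφ : Continuous φ) (hs : Function.support φ ⊆ Set.Icc α₁ α₂) : ∃ C : ℝ, 0 ≤ C ∧
    ∀ (L : ℝ) (b : ℕ → ℂ), 0 < L → (∀ n, ‖b n‖ ≤ 2) → (∀ n, b n ≠ 0 → IsPrimePow n) →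
      ‖∑' n : ℕ, b n * ((φ (Real.log n / L) : ℝ) / (n : ℂ)) -
        ∑' n : ℕ, (if n.Prime then b n / n * ((φ (Real.log n / L) : ℝ) : ℂ) else 0)‖ ≤
        C * Real.exp (-((1 / 2 - η) * α₁ * L)) := by
  obtain ⟨B, hB⟩ := hφ.bounded_above_of_compact_support
    (HasCompactSupport.of_support_subset_isCompact isCompact_Icc hs)
  have hB0 : 0 ≤ B := (norm_nonneg _).trans (hB 0)
  have hsum := summable_primePow_rpow (s := 1 / 2 + η) (by linarith)
  refine ⟨2 * B * ∑' n : ℕ, if IsPrimePow n ∧ ¬ n.Prime then (n : ℝ) ^ (-(1 / 2 + η)) else 0,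
    mul_nonneg (by positivity) (tsum_nonneg fun n => by split_ifs <;> positivity),
    fun L b hL hb hpp => ?_⟩
  have hz : ∀ n : ℕ, n ≠ 0 → φ (Real.log n / L) ≠ 0 →
      Real.exp (α₁ * L) ≤ n ∧ (n : ℝ) ≤ Real.exp (α₂ * L) := by
    intro n hn hne
    have h1 := hs hne
    have hn' : (0 : ℝ) < n := by exact_mod_cast Nat.pos_of_ne_zero hn
    rw [Set.mem_Icc, le_div_iff₀ hL, div_le_iff₀ hL] at h1
    exact ⟨(Real.le_log_iff_exp_le hn').1 h1.1, (Real.log_le_iff_le_exp hn').1 h1.2⟩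
  have hfin : ∀ n ∉ Finset.range (⌊Real.exp (α₂ * L)⌋₊ + 1), φ (Real.log n / L) = 0 := by
    intro n hn
    by_contra hne
    rw [Finset.mem_range, not_lt] at hn
    have := Nat.le_floor (hz n (by omega) hne).2
    omega
  have hs1 : Summable fun n : ℕ => b n * ((φ (Real.log n / L) : ℝ) / (n : ℂ)) :=
    summable_of_ne_finset_zero (s := Finset.range (⌊Real.exp (α₂ * L)⌋₊ + 1)) fun n hn => by
      rw [hfin n hn]
      simp
  have hs2 : Summable fun n : ℕ =>
      if n.Prime then b n / n * ((φ (Real.log n / L) : ℝ) : ℂ) else 0 :=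
    summable_of_ne_finset_zero (s := Finset.range (⌊Real.exp (α₂ * L)⌋₊ + 1)) fun n hn => by
      rw [hfin n hn]
      simp
  rw [← hs1.tsum_sub hs2]
  set E : ℝ := Real.exp (-((1 / 2 - η) * α₁ * L)) with hE
  rw [mul_assoc, mul_comm _ E, ← mul_assoc]
  refine tsum_of_norm_bounded (hsum.hasSum.mul_left (2 * B * E)) fun n => ?_
  by_cases hn : n.Prime
  · rw [if_pos hn, if_neg (fun h => h.2 hn)]
    rw [show b n * ((φ (Real.log n / L) : ℝ) / (n : ℂ)) - b n / n * ((φ (Real.log n / L) : ℝ) : ℂ) = 0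
      by ring]
    simp
  rw [if_neg hn, sub_zero]
  by_cases hb0 : b n = 0
  · rw [hb0, zero_mul, norm_zero]
    split_ifs <;> positivity
  have hpn := hpp n hb0
  rw [if_pos ⟨hpn, hn⟩]
  have hn0 : n ≠ 0 := hpn.ne_zero
  have hn' : (0 : ℝ) < n := by exact_mod_cast Nat.pos_of_ne_zero hn0
  by_cases hφ0 : φ (Real.log n / L) = 0
  · rw [hφ0]
    simp only [Complex.ofReal_zero, zero_div, mul_zero, norm_zero]
    positivity
  have h1 := (hz n hn0 hφ0).1
  rw [norm_mul, norm_div, Complex.norm_natCast, Complex.norm_real]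
  have h2 : (n : ℝ)⁻¹ ≤ E * (n : ℝ) ^ (-(1 / 2 + η)) := by
    have h3 : (n : ℝ)⁻¹ = (n : ℝ) ^ (-(1 / 2 - η)) * (n : ℝ) ^ (-(1 / 2 + η)) := by
      rw [← Real.rpow_add hn', ← Real.rpow_neg_one]
      ring_nf
    rw [h3]
    gcongr
    calc (n : ℝ) ^ (-(1 / 2 - η)) ≤ (Real.exp (α₁ * L)) ^ (-(1 / 2 - η)) :=
          Real.rpow_le_rpow_of_nonpos (Real.exp_pos _) h1 (by linarith)
      _ = E := by
          rw [← Real.exp_mul, hE]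
          ring_nf
  rw [div_eq_mul_inv]
  calc ‖b n‖ * (‖φ (Real.log n / L)‖ * (n : ℝ)⁻¹)
      ≤ 2 * (B * (E * (n : ℝ) ^ (-(1 / 2 + η)))) := by
        gcongr
        · exact hb n
        · exact hB _
    _ = _ := by ring

open scoped ComplexOrder in
/-- The exponential of a function with alternating derivatives has alternating derivatives. -/
theorem iteratedDeriv_alternating_of_eventuallyEq_exp {g H : ℂ → ℂ} {x : ℂ} (hg : AnalyticAt ℂ g x)
    (hH : H =ᶠ[nhds x] fun s => Complex.exp (g s))
    (h : ∀ n, 0 ≤ (-1) ^ n * iteratedDeriv n g x) (n : ℕ) :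
    0 ≤ (-1) ^ n * iteratedDeriv n H x := by
  have hHan : AnalyticAt ℂ H x := hg.cexp.congr hH.symm
  have hderiv : deriv H =ᶠ[nhds x] deriv g * H := by
    filter_upwards [hH.eventuallyEq_nhds, hg.eventually_analyticAt] with y hy hgy
    rw [hy.deriv_eq, Pi.mul_apply, hy.eq_of_nhds, deriv_cexp hgy.differentiableAt, mul_comm]
  induction n using Nat.strong_induction_on with
  | _ n ih =>
    rcases n with _ | n
    · have h0 := h 0
      simp only [pow_zero, one_mul, iteratedDeriv_zero] at h0 ⊢
      have h5 : g x = ((g x).re : ℂ) := Complex.eq_re_of_ofReal_le (r := 0) (by simpa using h0)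
      rw [hH.eq_of_nhds, h5, ← Complex.ofReal_exp]
      exact_mod_cast (Real.exp_pos _).le
    · rw [iteratedDeriv_succ', hderiv.iteratedDeriv_eq,
        iteratedDeriv_mul hg.deriv.contDiffAt hHan.contDiffAt, Finset.mul_sum]
      refine Finset.sum_nonneg fun i hi => ?_
      rw [Finset.mem_range] at hi
      have h1 := h (i + 1)
      have h2 := ih (n - i) (by omega)
      rw [iteratedDeriv_succ'] at h1
      have h3 : ((-1 : ℂ)) ^ (n + 1) = (-1) ^ (i + 1) * (-1) ^ (n - i) := by
        rw [← pow_add]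
        congr 1
        omega
      rw [h3]
      have h4 : (0 : ℂ) ≤ (n.choose i : ℂ) := by exact_mod_cast Nat.zero_le _
      calc (0 : ℂ) ≤ (n.choose i : ℂ) * (((-1) ^ (i + 1) * iteratedDeriv i (deriv g) x) *
            ((-1) ^ (n - i) * iteratedDeriv (n - i) H x)) :=
            mul_nonneg h4 (mul_nonneg h1 h2)
        _ = _ := by ring

/-- The entire function equal to `(s - 1) * mellin Θ s / Γ(s)` for `Re s > 1`. -/
noncomputable def thetaEntire (Θ : ℝ → ℂ) (c d : ℂ) (s : ℂ) : ℂ :=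
  ((s - 1) * mellin (thetaRem Θ c d) s + c) * (Complex.Gamma s)⁻¹ -
    (s - 1) * d * (Complex.Gamma (s + 1))⁻¹

namespace IsThetaLike

variable {Θ : ℝ → ℂ} {c d : ℂ}

theorem differentiable_thetaEntire (h : IsThetaLike Θ c d) :
    Differentiable ℂ (thetaEntire Θ c d) := by
  have h1 := h.differentiable_mellin_thetaRem
  have h2 := Complex.differentiable_one_div_Gamma
  have h3 : Differentiable ℂ fun s : ℂ => (Complex.Gamma (s + 1))⁻¹ :=
    h2.comp (differentiable_id.add_const 1)
  unfold thetaEntire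
  fun_prop

theorem thetaEntire_eq (h : IsThetaLike Θ c d) {s : ℂ} (hs : 1 < s.re) :
    thetaEntire Θ c d s = (s - 1) * mellin Θ s * (Complex.Gamma s)⁻¹ := by
  have hs0 : s ≠ 0 := fun h0 => by
    rw [h0, Complex.zero_re] at hs
    linarith
  have hs1 : s - 1 ≠ 0 := fun h0 => by
    rw [sub_eq_zero.1 h0, Complex.one_re] at hs
    linarith
  have hG : Complex.Gamma s ≠ 0 := Complex.Gamma_ne_zero_of_re_pos (by linarith)
  rw [thetaEntire, h.mellin_eq hs, Complex.Gamma_add_one s hs0]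
  field_simp
  ring

theorem thetaEntire_neg_one : thetaEntire Θ c d (-1) = 0 := by
  have h1 : Complex.Gamma (-1) = 0 := by
    have := Complex.Gamma_neg_nat_eq_zero 1
    simpa using this
  rw [thetaEntire, h1, neg_add_cancel, Complex.Gamma_zero]
  simp

theorem eq_mellin_thetaRem_of_eq {F : ℂ → ℂ} (h : IsThetaLike Θ 0 0) (hF : Differentiable ℂ F)
    (hFΘ : ∀ s : ℂ, 1 < s.re → F s = mellin Θ s * (Complex.Gamma s)⁻¹) (s : ℂ) :
    F s = mellin (thetaRem Θ 0 0) s * (Complex.Gamma s)⁻¹ := by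
  have h1 := h.differentiable_mellin_thetaRem.mul Complex.differentiable_one_div_Gamma
  have h2 : F =ᶠ[nhds 2] (mellin (thetaRem Θ 0 0) * fun s => (Complex.Gamma s)⁻¹) := by
    filter_upwards [(isOpen_lt continuous_const Complex.continuous_re).mem_nhds
      (show (1 : ℝ) < (2 : ℂ).re by norm_num)] with z hz
    rw [hFΘ z hz, h.mellin_eq hz]
    simp
  exact congrFun (AnalyticOnNhd.eq_of_eventuallyEq
    (fun z _ => hF.analyticAt z) (fun z _ => h1.analyticAt z) h2) s

end IsThetaLike

section MellinLink

variable {K : Type} [Field K] [NumberField K]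

theorem countable_nonZeroDivisors_ideal (hK : Module.finrank ℚ K = 2) :
    Countable (nonZeroDivisors (Ideal (𝓞 K))) := by
  have h := (hasSum_idealTerm (K := K) hK 1 (s := 2) (by norm_num)).1.countable_support
  rw [Function.support_eq_univ, Set.countable_univ_iff] at h
  · exact h
  · intro I
    rw [norm_idealTerm]
    have : (0 : ℝ) < Ideal.absNorm (I : Ideal (𝓞 K)) := by
      exact_mod_cast Nat.pos_of_ne_zero (absNorm_nonZeroDivisors_ne_zero I)
    positivity

/-- The Mellin transform of the theta series is `Γ` times the class group `L`-function. -/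
theorem mellin_charTheta (hK : Module.finrank ℚ K = 2) (χ : ClassGroup (𝓞 K) →* ℂ) {Θ : ℝ → ℂ}
    (hΘ : ∀ t : ℝ, 0 < t → HasSum (fun I : nonZeroDivisors (Ideal (𝓞 K)) =>
      χ (ClassGroup.mk0 I) * (Real.exp (-(Ideal.absNorm (I : Ideal (𝓞 K)) : ℝ) * t) : ℂ)) (Θ t))
    {s : ℂ} (hs : 1 < s.re) :
    mellin Θ s = Complex.Gamma s * Complex.exp (∑' n : ℕ, logCoeff χ n * (n : ℂ) ^ (-s)) := by
  have := countable_nonZeroDivisors_ideal hK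
  obtain ⟨h1, -, h3⟩ := hasSum_idealTerm hK χ hs
  have hpos : ∀ I : nonZeroDivisors (Ideal (𝓞 K)), (0 : ℝ) < Ideal.absNorm (I : Ideal (𝓞 K)) :=
    fun I => by exact_mod_cast Nat.pos_of_ne_zero (absNorm_nonZeroDivisors_ne_zero I)
  have h := hasSum_mellin (a := fun I : nonZeroDivisors (Ideal (𝓞 K)) => χ (ClassGroup.mk0 I))
    (p := fun I => (Ideal.absNorm (I : Ideal (𝓞 K)) : ℝ)) (F := Θ) (s := s)
    (fun I => Or.inr (hpos I)) (by linarith) (fun t ht => hΘ t ht) (h1.congr fun I => by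
      rw [norm_idealTerm, norm_classGroup_char, Real.rpow_neg (hpos I).le, one_div])
  refine h.unique ((h3.mul_left (Complex.Gamma s)).congr_fun fun I => ?_)
  change _ = Complex.Gamma s * (χ (ClassGroup.mk0 I) *
    (Ideal.absNorm (I : Ideal (𝓞 K)) : ℂ) ^ (-s))
  rw [Complex.cpow_neg, Complex.ofReal_natCast]
  ring

end MellinLink

/-- The class group `L`-functions grow at most polynomially in the discriminant. -/
theorem exists_isStripBounded : ∃ A : ℝ, 0 < A ∧ ∀ (K : Type) [Field K] [NumberField K],
    Module.finrank ℚ K = 2 → ∀ D : ℕ, 0 < D → (∃ α : K, α ^ 2 = -(D : K)) →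
    ∀ χ : ClassGroup (𝓞 K) →* ℂ, χ ≠ 1 → ∀ F : ℂ → ℂ, Differentiable ℂ F →
      (∀ s : ℂ, 1 < s.re → F s = Complex.exp (∑' n : ℕ, logCoeff χ n * (n : ℂ) ^ (-s))) →
      IsStripBounded F (A * (Real.log D + 1)) := by
  obtain ⟨C₁, hC₁, hΘ⟩ := exists_charTheta
  obtain ⟨C₂, hC₂, hM⟩ := exists_norm_mellin_le
  obtain ⟨C₃, hC₃, hΓ⟩ := exists_norm_one_div_Gamma_le
  obtain ⟨C₄, hC₄, hh⟩ := exists_classNumber_le (ε := 1) one_pos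
  set Z : ℝ := 2 * ∑' n : ℕ, (n : ℝ) ^ (-(5 / 4) : ℝ) with hZ
  have hZ0 : 0 ≤ Z := by positivity
  set W : ℝ := C₂ * (C₁ * (C₄ * 256)) with hW
  have hW0 : 0 < W := by positivity
  refine ⟨Z + C₃ + |Real.log W| + 5, by positivity, fun K _ _ hK D hD hα χ hχ F hF hFs => ?_⟩
  set A : ℝ := Z + C₃ + |Real.log W| + 5 with hA
  have hlogD : 0 ≤ Real.log D := Real.log_natCast_nonneg D
  have hA0 : 0 ≤ A := by positivity
  have hlog : ∀ s : ℂ, 5 / 4 ≤ s.re → ‖∑' n : ℕ, logCoeff χ n * (n : ℂ) ^ (-s)‖ ≤ Z := by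
    intro s hs
    refine (summable_logCoeff hK χ (by linarith)).2.trans ?_
    rw [hZ]
    refine mul_le_mul_of_nonneg_left ?_ (by norm_num)
    have hsum : ∀ σ : ℝ, 1 < σ → Summable fun n : ℕ => (n : ℝ) ^ (-σ) := fun σ hσ =>
      Real.summable_nat_rpow.2 (by linarith)
    refine (hsum _ (by linarith)).tsum_le_tsum (fun n => ?_) (hsum (5 / 4) (by norm_num))
    rcases n.eq_zero_or_pos with rfl | hn
    · rw [Nat.cast_zero, Real.zero_rpow (by linarith), Real.zero_rpow (by norm_num)]
    · exact Real.rpow_le_rpow_of_exponent_le (by exact_mod_cast hn) (by linarith)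
  have hZA : Z ≤ A * (Real.log D + 1) := by
    have : Z ≤ A := by rw [hA]; linarith [abs_nonneg (Real.log W)]
    nlinarith
  have hle : ∀ t : ℝ, A * (Real.log D + 1) ≤ A * (Real.log D + 1) * (1 + |t|) := fun t =>
    le_mul_of_one_le_right (by positivity) (by linarith [abs_nonneg t])
  have hbig : ∀ s : ℂ, 5 / 4 ≤ s.re → |Real.log ‖F s‖| ≤ Z := fun s hs => by
    rw [hFs s (by linarith), Complex.norm_exp, Real.log_exp]
    exact (Complex.abs_re_le_norm _).trans (hlog s hs)
  refine ⟨hF, by positivity, fun s hs1 hs2 => ?_, fun t => ?_⟩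
  · rcases le_or_gt (5 / 4) s.re with hs | hs
    · exact ((le_abs_self _).trans (hbig s hs)).trans (hZA.trans (hle _))
    · obtain ⟨Θ, c, d, hT, hsum, hcd, hb1, hb2⟩ := (hΘ K hK D hD hα).2 χ
      obtain ⟨rfl, rfl⟩ := hcd hχ
      have hFm := hT.eq_mellin_thetaRem_of_eq hF (fun z hz => by
        rw [mellin_charTheta hK χ hsum hz, hFs z hz]
        have := Complex.Gamma_ne_zero_of_re_pos (s := z) (by linarith)
        field_simp) s
      have hD1 : (1 : ℝ) ≤ D := by exact_mod_cast hD
      have hh1 : (classNumber K : ℝ) ≤ C₄ * D := by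
        have := hh K hK D hD hα
        norm_num at this
        exact this
      have hn : ‖F s‖ ≤ W * (D : ℝ) ^ 5 * Real.exp (C₃ * (1 + |s.im|)) := by
        rw [hFm, norm_mul]
        refine mul_le_mul ((hM _ _ hb1 hb2 s hs1 hs.le).trans ?_) (hΓ s hs1 hs.le)
          (norm_nonneg _) (by positivity)
        calc C₂ * (C₁ * (classNumber K * (4 * D) ^ 4))
            ≤ C₂ * (C₁ * ((C₄ * D) * (4 * D) ^ 4)) := by gcongr
          _ = W * (D : ℝ) ^ 5 := by rw [hW]; ring
      rcases eq_or_ne (F s) 0 with h0 | h0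
      · rw [h0, norm_zero, Real.log_zero]
        positivity
      · have hl := Real.log_le_log (norm_pos_iff.2 h0) hn
        rw [Real.log_mul (by positivity) (by positivity), Real.log_mul (by positivity)
          (by positivity), Real.log_exp, Real.log_pow] at hl
        refine hl.trans ?_
        have h5 := le_abs_self (Real.log W)
        have h6 := abs_nonneg s.im
        have h7 : A * (Real.log D + 1) * (1 + |s.im|) = A * (1 + |s.im|) +
          A * Real.log D * (1 + |s.im|) := by ring
        have h8 : A * Real.log D ≤ A * Real.log D * (1 + |s.im|) :=
          le_mul_of_one_le_right (by positivity) (by linarith)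
        have h9 : 5 * Real.log D ≤ A * Real.log D := by
          refine mul_le_mul_of_nonneg_right ?_ hlogD
          rw [hA]
          linarith [abs_nonneg (Real.log W)]
        have h10 : Real.log W + C₃ * (1 + |s.im|) ≤ A * (1 + |s.im|) := by
          rw [hA]
          nlinarith [abs_nonneg (Real.log W)]
        push_cast
        linarith
  · have h2 : (2 + (t : ℂ) * Complex.I).re = 2 := by simp
    constructor
    · rw [hFs _ (by rw [h2]; norm_num)]
      exact Complex.exp_ne_zero _
    · have := neg_le_of_abs_le (hbig (2 + (t : ℂ) * Complex.I) (by rw [h2]; norm_num))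
      linarith

open scoped ComplexOrder in
/-- An entire function vanishing somewhere to the left of `2` cannot be the exponential of a Dirichlet
series with bounded nonnegative coefficients. -/
theorem Differentiable.ne_zero_of_eq_exp_LSeries {H : ℂ → ℂ} (hH : Differentiable ℂ H) {c : ℕ → ℂ}
    (hc : 0 ≤ c) (hcb : ∃ B, ∀ n ≠ 0, ‖c n‖ ≤ B)
    (hHc : ∀ s : ℂ, 1 < s.re → H s = Complex.exp (LSeries c s)) : H (-1) ≠ 0 := by
  intro h0
  have habs : LSeries.abscissaOfAbsConv c < ((2 : ℝ) : EReal) :=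
    (LSeries.abscissaOfAbsConv_le_of_le_const hcb).trans_lt (by
      exact_mod_cast (by norm_num : (1 : ℝ) < 2))
  have hev : H =ᶠ[nhds ((2 : ℝ) : ℂ)] fun s => Complex.exp (LSeries c s) := by
    filter_upwards [(isOpen_lt continuous_const Complex.continuous_re).mem_nhds
      (show (1 : ℝ) < ((2 : ℝ) : ℂ).re by norm_num)] with z hz using hHc z hz
  have han : AnalyticAt ℂ (LSeries c) ((2 : ℝ) : ℂ) :=
    LSeries_analyticOnNhd c _ (by simpa using habs)
  have halt := iteratedDeriv_alternating_of_eventuallyEq_exp han hev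
    (LSeries.iteratedDeriv_alternating hc habs)
  have h1 := halt 0
  rw [pow_zero, one_mul, iteratedDeriv_zero] at h1
  have h2 : H ((2 : ℝ) : ℂ) ≤ H (-1) :=
    hH.apply_le_of_iteratedDeriv_alternating (fun n _ => halt n) (by
      rw [show (-1 : ℂ) = ((-1 : ℝ) : ℂ) by norm_num]
      exact_mod_cast (by norm_num : (-1 : ℝ) ≤ 2))
  rw [h0] at h2
  have h3 := le_antisymm h2 h1
  rw [hev.eq_of_nhds] at h3
  exact Complex.exp_ne_zero _ h3

theorem Differentiable.dslope_complex {F : ℂ → ℂ} (hF : Differentiable ℂ F) (a : ℂ) :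
    Differentiable ℂ (dslope F a) := by
  rw [← differentiableOn_univ] at hF ⊢
  exact (Complex.differentiableOn_dslope Filter.univ_mem).2 hF

open scoped ComplexOrder in
/-- A Landau type argument: an entire `F` whose logarithm is dominated by that of an entire function
with a simple zero cancelled at `1` and a trivial zero at `-1` does not vanish on `Re s = 1`. -/
theorem ne_zero_of_dominated {E F : ℂ → ℂ} (hE : Differentiable ℂ E) (hF : Differentiable ℂ F)
    {a : ℕ → ℝ} {b : ℕ → ℂ} (hab : ∀ n, ‖b n‖ ≤ a n) {B : ℝ} (ha : ∀ n, a n ≤ B) (ha0 : a 0 = 0)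
    (hEa : ∀ s : ℂ, 1 < s.re →
      E s = (s - 1) * Complex.exp (∑' n : ℕ, (a n : ℂ) * (n : ℂ) ^ (-s)))
    (hFb : ∀ s : ℂ, 1 < s.re → F s = Complex.exp (∑' n : ℕ, b n * (n : ℂ) ^ (-s)))
    (hE1 : E (-1) = 0) (t : ℝ) : F (1 + t * Complex.I) ≠ 0 := by
  intro h0
  have hsum : ∀ (f : ℕ → ℂ), (∀ n, ‖f n‖ ≤ a n) → ∀ s : ℂ, 1 < s.re →
      Summable fun n : ℕ => f n * (n : ℂ) ^ (-s) := fun f hf s hs => by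
    have h1 : Summable fun n : ℕ => B * (n : ℝ) ^ (-s.re) :=
      (Real.summable_nat_rpow.2 (by linarith)).mul_left B
    refine h1.of_norm_bounded fun n => ?_
    rw [norm_mul]
    rcases n.eq_zero_or_pos with rfl | hn
    · have : f 0 = 0 := norm_le_zero_iff.1 ((hf 0).trans ha0.le)
      rw [this, norm_zero, zero_mul]
      have : 0 ≤ B := (ha0 ▸ ha 0)
      positivity
    · rw [Complex.norm_natCast_cpow_of_pos hn, Complex.neg_re]
      exact mul_le_mul_of_nonneg_right ((hf n).trans (ha n)) (by positivity)
  set β : ℕ → ℂ := fun n => b n * (n : ℂ) ^ (-(t * Complex.I)) with hβ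
  have hβa : ∀ n, ‖β n‖ ≤ a n := fun n => by
    rw [hβ, norm_mul]
    rcases n.eq_zero_or_pos with rfl | hn
    · have : b 0 = 0 := norm_le_zero_iff.1 ((hab 0).trans ha0.le)
      rw [this, norm_zero, zero_mul, ha0]
    · rw [Complex.norm_natCast_cpow_of_pos hn]
      simpa using hab n
  set G : ℂ → ℂ := dslope (fun s => F (s + t * Complex.I)) 1 with hG
  have hGd : Differentiable ℂ G :=
    Differentiable.dslope_complex (hF.comp (differentiable_id.add_const _)) 1
  have hGs : ∀ s : ℂ, 1 < s.re →
      G s = (s - 1)⁻¹ * Complex.exp (∑' n : ℕ, β n * (n : ℂ) ^ (-s)) := fun s hs => by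
    have hs1 : s ≠ 1 := fun h => by rw [h, Complex.one_re] at hs; linarith
    rw [hG, dslope_of_ne _ hs1, slope_def_field, h0, sub_zero, div_eq_inv_mul,
      hFb _ (by simpa using hs)]
    congr 2
    refine tsum_congr fun n => ?_
    rcases n.eq_zero_or_pos with rfl | hn
    · have : b 0 = 0 := norm_le_zero_iff.1 ((hab 0).trans ha0.le)
      rw [hβ]
      simp only [this, zero_mul]
    · rw [hβ, neg_add_rev, Complex.cpow_add _ _ (by exact_mod_cast hn.ne')]
      ring
  set G' : ℂ → ℂ := fun s => (starRingEnd ℂ) (G ((starRingEnd ℂ) s)) with hG'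
  have hGd' : Differentiable ℂ G' := fun s => by
    have := (hGd ((starRingEnd ℂ) s)).conj_conj
    simpa [Function.comp_def] using this
  have hGs' : ∀ s : ℂ, 1 < s.re →
      G' s = (s - 1)⁻¹ * Complex.exp (∑' n : ℕ, (starRingEnd ℂ) (β n) * (n : ℂ) ^ (-s)) :=
    fun s hs => by
      rw [hG']
      simp only
      rw [hGs _ (by simpa using hs), map_mul, map_inv₀, map_sub, map_one, Complex.conj_conj,
        ← Complex.exp_conj, Complex.conj_tsum]
      congr 2
      refine tsum_congr fun n => ?_
      have h1 := Complex.cpow_conj (n : ℂ) (-(starRingEnd ℂ) s) (by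
        rw [Complex.natCast_arg]
        exact Real.pi_pos.ne)
      rw [map_neg, Complex.conj_conj, Complex.conj_natCast] at h1
      rw [map_mul, ← h1]
  set c : ℕ → ℂ := fun n => 2 * (a n : ℂ) + β n + (starRingEnd ℂ) (β n) with hc
  have hcr : ∀ n, c n = ((2 * a n + 2 * (β n).re : ℝ) : ℂ) := fun n => by
    rw [hc]
    simp only
    rw [add_assoc, Complex.add_conj]
    push_cast
    ring
  have hre : ∀ n, |(β n).re| ≤ a n := fun n => (Complex.abs_re_le_norm _).trans (hβa n)
  refine Differentiable.ne_zero_of_eq_exp_LSeries (H := fun s => E s ^ 2 * G s * G' s)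
    (((hE.pow 2).mul hGd).mul hGd') (c := c) (fun n => ?_) ⟨4 * B, fun n _ => ?_⟩
    (fun s hs => ?_) ?_
  · rw [hcr n]
    have := neg_le_of_abs_le (hre n)
    exact Complex.zero_le_real.2 (by linarith)
  · rw [hcr n, Complex.norm_real, Real.norm_eq_abs, abs_le]
    have := abs_le.1 (hre n)
    constructor <;> linarith [ha n]
  · have hs1 : s - 1 ≠ 0 := fun h => by
      rw [sub_eq_zero.1 h, Complex.one_re] at hs
      linarith
    have e1 := hsum (fun n => (a n : ℂ)) (fun n => by
      rw [Complex.norm_real, Real.norm_eq_abs, abs_of_nonneg ((norm_nonneg _).trans (hab n))]) s hs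
    have e2 := hsum β hβa s hs
    have e3 := hsum (fun n => (starRingEnd ℂ) (β n)) (fun n => by
      rw [RCLike.norm_conj]; exact hβa n) s hs
    have hL : LSeries c s = 2 * (∑' n : ℕ, (a n : ℂ) * (n : ℂ) ^ (-s)) +
        (∑' n : ℕ, β n * (n : ℂ) ^ (-s)) +
        ∑' n : ℕ, (starRingEnd ℂ) (β n) * (n : ℂ) ^ (-s) := by
      rw [LSeries, ← tsum_mul_left, ← (e1.mul_left 2).tsum_add e2,
        ← ((e1.mul_left 2).add e2).tsum_add e3]
      refine tsum_congr fun n => ?_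
      rcases n.eq_zero_or_pos with rfl | hn
      · have : β 0 = 0 := norm_le_zero_iff.1 ((hβa 0).trans ha0.le)
        simp [this, ha0]
      · rw [LSeries.term_of_ne_zero hn.ne', hc, Complex.cpow_neg]
        ring
    rw [hL, hEa s hs, hGs s hs, hGs' s hs, Complex.exp_add, Complex.exp_add, two_mul,
      Complex.exp_add]
    field_simp
  · simp only [hE1]
    ring

section ClassGroupL

variable {K : Type} [Field K] [NumberField K]

theorem exists_logCoeff_one (hK : Module.finrank ℚ K = 2) (χ : ClassGroup (𝓞 K) →* ℂ) :
    ∃ a : ℕ → ℝ, (∀ n, logCoeff (K := K) 1 n = a n) ∧ ∀ n, ‖logCoeff χ n‖ ≤ a n := by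
  refine ⟨fun n => ∑' q : (fun q : {p : Ideal (𝓞 K) // Prime p} × ℕ =>
    Ideal.absNorm q.1.1 ^ (q.2 + 1)) ⁻¹' {n}, 1 / ((q.1.2 : ℝ) + 1), fun n => ?_, fun n => ?_⟩
  · rw [logCoeff, Complex.ofReal_tsum]
    refine tsum_congr fun q => ?_
    rw [MonoidHom.one_apply, one_pow]
    push_cast
    rfl
  · refine (norm_tsum_le_tsum_norm (summable_logCoeff_fiber hK χ n).1).trans (le_of_eq ?_)
    refine tsum_congr fun q => ?_
    rw [norm_div, norm_pow, norm_classGroup_char, one_pow]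
    congr 1
    exact_mod_cast Complex.norm_natCast (q.1.2 + 1)

theorem hasLogSeries_logCoeff (hK : Module.finrank ℚ K = 2) {D : ℕ} (hD : 0 < D)
    (hα : ∃ α : K, α ^ 2 = -(D : K)) (χ : ClassGroup (𝓞 K) →* ℂ) {F : ℂ → ℂ}
    (hF : Differentiable ℂ F)
    (hFs : ∀ s : ℂ, 1 < s.re → F s = Complex.exp (∑' n : ℕ, logCoeff χ n * (n : ℂ) ^ (-s))) :
    HasLogSeries F (logCoeff χ) := by
  refine ⟨logCoeff_zero χ, fun s hs => (summable_logCoeff hK χ hs).1, fun s hs => ?_,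
    fun s hs => by rw [hFs s hs, Complex.norm_exp, Real.log_exp]⟩
  rcases hs.lt_or_eq with hs | hs
  · rw [hFs s hs]
    exact Complex.exp_ne_zero _
  · obtain ⟨C, -, hΘ⟩ := exists_charTheta
    obtain ⟨Θ, c, d, hT, hsum, -⟩ := (hΘ K hK D hD hα).2 1
    obtain ⟨a, ha, hab⟩ := exists_logCoeff_one hK χ
    have ha0 : a 0 = 0 := by
      have := ha 0
      rw [logCoeff_zero] at this
      exact_mod_cast this.symm
    have ha2 : ∀ n, a n ≤ 2 := fun n => by
      have := (summable_logCoeff_fiber (K := K) hK 1 n).2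
      rw [ha n, Complex.norm_real, Real.norm_eq_abs] at this
      exact (le_abs_self _).trans this
    have h := ne_zero_of_dominated hT.differentiable_thetaEntire hF hab ha2 ha0
      (fun z hz => by
        rw [hT.thetaEntire_eq hz, mellin_charTheta hK 1 hsum hz]
        have := Complex.Gamma_ne_zero_of_re_pos (s := z) (by linarith)
        simp only [ha]
        field_simp) hFs IsThetaLike.thetaEntire_neg_one s.im
    rwa [show (1 : ℂ) + s.im * Complex.I = s by
      conv_rhs => rw [← Complex.re_add_im s, ← hs]
      simp] at h

end ClassGroupL

/-- The substitution `t = x ^ u` in the Mellin transform of `PhiLog φ x`. -/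
theorem mellin_PhiLog (φ : ℝ → ℝ) {x : ℝ} (hx : 0 < Real.log x) (s : ℂ) :
    mellin (PhiLog φ x) s = logMellin (fun u => ((φ u / u : ℝ) : ℂ)) (Real.log x) s := by
  set L := Real.log x with hL
  have himg : (fun u : ℝ => Real.exp (L * u)) '' Set.univ = Set.Ioi 0 := by
    rw [Set.image_univ]
    ext t
    constructor
    · rintro ⟨u, rfl⟩
      exact Real.exp_pos _
    · intro ht
      refine ⟨Real.log t / L, ?_⟩
      simp only
      rw [mul_div_cancel₀ _ hx.ne', Real.exp_log ht]
  have hderiv : ∀ u ∈ (Set.univ : Set ℝ), HasDerivWithinAt (fun u : ℝ => Real.exp (L * u))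
      (L * Real.exp (L * u)) Set.univ u := fun u _ => by
    have h := ((hasDerivAt_id u).const_mul L).exp
    simp only [id_eq, mul_one] at h
    rw [mul_comm L]
    exact h.hasDerivWithinAt
  have hinj : Set.InjOn (fun u : ℝ => Real.exp (L * u)) Set.univ := fun u _ v _ h =>
    mul_left_cancel₀ hx.ne' (Real.exp_injective h)
  rw [mellin, ← himg, MeasureTheory.integral_image_eq_integral_abs_deriv_smul MeasurableSet.univ
    hderiv hinj, MeasureTheory.Measure.restrict_univ, logMellin]
  congr 1
  ext u
  have he := Real.exp_pos (L * u)
  rw [abs_of_pos (mul_pos hx he), PhiLog, Real.log_exp, ← hL, mul_div_cancel_left₀ _ hx.ne',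
    Complex.cpow_def_of_ne_zero (by exact_mod_cast he.ne'), ← Complex.ofReal_log he.le,
    Real.log_exp, Complex.real_smul, smul_eq_mul]
  rcases eq_or_ne u 0 with rfl | hu
  · simp
  · have hLc : (L : ℂ) ≠ 0 := by exact_mod_cast hx.ne'
    have huc : (u : ℂ) ≠ 0 := by exact_mod_cast hu
    have hec : Complex.exp (L * u) ≠ 0 := Complex.exp_ne_zero _
    push_cast
    field_simp

theorem contDiff_div_self_of_support {φ : ℝ → ℝ} {α₁ α₂ : ℝ} (h1 : 0 < α₁)
    (hφ : ContDiff ℝ (⊤ : ℕ∞) φ) (hφs : Function.support φ ⊆ Set.Icc α₁ α₂) :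
    ContDiff ℝ (⊤ : ℕ∞) (fun u => ((φ u / u : ℝ) : ℂ)) ∧
      tsupport (fun u => ((φ u / u : ℝ) : ℂ)) ⊆ Set.Icc α₁ α₂ := by
  constructor
  · refine Complex.ofRealCLM.contDiff.comp ?_
    rw [contDiff_iff_contDiffAt]
    intro u
    rcases eq_or_ne u 0 with rfl | hu
    · have h : (fun u => φ u / u) =ᶠ[nhds 0] fun _ => 0 := by
        filter_upwards [Iio_mem_nhds h1] with u hu
        have : φ u = 0 := by
          by_contra h
          exact (hφs h).1.not_gt hu
        rw [this, zero_div]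
      exact contDiffAt_const.congr_of_eventuallyEq h
    · exact hφ.contDiffAt.div contDiffAt_id hu
  · refine closure_minimal (fun u hu => hφs fun h => hu ?_) isClosed_Icc
    simp only [h, zero_div, Complex.ofReal_zero]

theorem analyticOrderNatAt_eq_of_eventually {F g : ℂ → ℂ} {ρ : ℂ} {k : ℕ} (hF : AnalyticAt ℂ F ρ)
    (hg : AnalyticAt ℂ g ρ) (hg0 : g ρ ≠ 0) (h : ∀ᶠ s in nhds ρ, F s = (s - ρ) ^ k * g s) :
    analyticOrderNatAt F ρ = k := by
  have h1 : analyticOrderAt F ρ = k := hF.analyticOrderAt_eq_natCast.2 ⟨g, hg, hg0, h⟩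
  rw [analyticOrderNatAt, h1, ENat.toNat_natCast]

theorem mul_exp_neg_le_inv {κ : ℝ} (hκ : 0 < κ) (L : ℝ) : L * Real.exp (-(κ * L)) ≤ κ⁻¹ := by
  have h := Real.add_one_le_exp (κ * L)
  rw [Real.exp_neg, ← div_eq_mul_inv, div_le_iff₀ (Real.exp_pos _), inv_mul_eq_div, le_div_iff₀ hκ]
  linarith

theorem cube_mul_exp_neg_le {κ : ℝ} (hκ : 0 < κ) {L : ℝ} (hL : 0 ≤ L) :
    L ^ 3 * Real.exp (-(κ * L)) ≤ 27 * (κ⁻¹) ^ 3 := by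
  have h := mul_exp_neg_le_inv (show 0 < κ / 3 by positivity) L
  calc L ^ 3 * Real.exp (-(κ * L)) = (L * Real.exp (-(κ / 3 * L))) ^ 3 := by
        rw [mul_pow, ← Real.exp_nat_mul]
        congr 2
        push_cast
        ring
    _ ≤ ((κ / 3)⁻¹) ^ 3 := by gcongr
    _ = _ := by
        rw [inv_div]
        ring

/-- Both error terms are negligible against `1 / (h L)` when `h` is at most about `√D` and
`log D < (2 α₁ - α₂) L`. -/
theorem error_terms_le {α₁ δ L ℓ h A B H : ℝ} (h1 : 0 < α₁) (h1' : α₁ ≤ 1) (hδ : 0 < δ)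
    (hL : 1 ≤ L) (hℓL : ℓ < (α₁ - δ) * L) (hA : 0 ≤ A) (hB : 0 ≤ B) (hH : 0 ≤ H)
    (hh : 0 < h) (hhH : h ≤ H * Real.exp ((1 + δ / α₁) / 2 * ℓ)) {η : ℝ}
    (hη : η * α₁ ≤ δ ^ 2 / (4 * α₁)) :
    A * L * Real.exp (-(3 / 4 * α₁ * L)) * (ℓ + 1) + B * Real.exp (-((1 / 2 - η) * α₁ * L)) ≤
      (54 * A * H * ((α₁ / 4)⁻¹) ^ 3 + B * H * (δ ^ 2 / (4 * α₁))⁻¹) / (h * L) := by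
  set κ := δ ^ 2 / (4 * α₁) with hκ
  have hκ0 : 0 < κ := by positivity
  have hexp : (1 + δ / α₁) / 2 * ℓ ≤ (α₁ / 2 - 2 * κ) * L := by
    calc (1 + δ / α₁) / 2 * ℓ ≤ (1 + δ / α₁) / 2 * ((α₁ - δ) * L) := by gcongr
      _ = _ := by
        rw [hκ]
        field_simp
        ring
  have hh2 : h ≤ H * Real.exp ((α₁ / 2 - 2 * κ) * L) :=
    hhH.trans (by gcongr)
  have hh3 : h ≤ H * Real.exp (α₁ / 2 * L) := hh2.trans (by gcongr; linarith)
  have hℓ1 : ℓ + 1 ≤ 2 * L := by nlinarith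
  rw [le_div_iff₀ (by positivity), add_mul]
  refine add_le_add ?_ ?_
  · calc A * L * Real.exp (-(3 / 4 * α₁ * L)) * (ℓ + 1) * (h * L)
        ≤ A * L * Real.exp (-(3 / 4 * α₁ * L)) * (2 * L) * (H * Real.exp (α₁ / 2 * L) * L) := by
          gcongr
      _ = 2 * A * H * (L ^ 3 * (Real.exp (-(3 / 4 * α₁ * L)) * Real.exp (α₁ / 2 * L))) := by ring
      _ = 2 * A * H * (L ^ 3 * Real.exp (-(α₁ / 4 * L))) := by
          rw [← Real.exp_add]
          congr 4
          ring
      _ ≤ 2 * A * H * (27 * ((α₁ / 4)⁻¹) ^ 3) := by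
          exact mul_le_mul_of_nonneg_left
            (cube_mul_exp_neg_le (κ := α₁ / 4) (L := L) (by positivity) (by linarith)) (by positivity)
      _ = _ := by ring
  · calc B * Real.exp (-((1 / 2 - η) * α₁ * L)) * (h * L)
        ≤ B * Real.exp (-((α₁ / 2 - κ) * L)) * (H * Real.exp ((α₁ / 2 - 2 * κ) * L) * L) := by
          gcongr
          linarith
      _ = B * H * (L * (Real.exp (-((α₁ / 2 - κ) * L)) * Real.exp ((α₁ / 2 - 2 * κ) * L))) := by
          ring
      _ = B * H * (L * Real.exp (-(κ * L))) := by
          rw [← Real.exp_add]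
          congr 4
          ring
      _ ≤ B * H * κ⁻¹ := by
          gcongr
          exact mul_exp_neg_le_inv hκ0 L

theorem explicit_formula_in_log_scale
    (α₁ α₂ : ℝ) (h1 : 0 < α₁) (h12 : α₁ < α₂) (h2 : α₂ ≤ 1)
    (φ : ℝ → ℝ) (hφ : ContDiff ℝ (⊤ : ℕ∞) φ) (hφs : Function.support φ ⊆ Set.Icc α₁ α₂) :
    ∃ C : ℝ, ∀ (D : ℕ), Nat.Prime D → 3 < D → D % 4 = 3 →
    ∀ (K : Type) [Field K] [NumberField K], Module.finrank ℚ K = 2 →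
      (∃ α : K, α ^ 2 = -(D : K)) →
    ∀ x : ℝ, 3 ≤ x → Real.log D / Real.log x < 2 * α₁ - α₂ →
    ∀ χ : ClassGroup (𝓞 K) →* ℂ, χ ≠ 1 →
    ∀ F : ℂ → ℂ, Differentiable ℂ F →
      (∀ s : ℂ, 1 < s.re → F s = ∑' n : ℕ, lambdaChi K χ n / (n : ℂ) ^ s) →
    ∀ m : ℂ → ℕ,
      (∀ ρ : ℂ, F ρ = 0 → 0 < ρ.re → ρ.re < 1 →
        ∃ g : ℂ → ℂ, AnalyticAt ℂ g ρ ∧ g ρ ≠ 0 ∧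
          ∀ᶠ s in nhds ρ, F s = (s - ρ) ^ (m ρ) * g s) →
    Summable (fun ρ : {ρ : ℂ // F ρ = 0 ∧ 0 < ρ.re ∧ ρ.re < 1} =>
        (m (ρ : ℂ) : ℝ) * ‖mellin (PhiLog φ x) (ρ : ℂ)‖) ∧
      ‖(∑' p : ℕ, if p.Prime then
            lambdaChi K χ p / p * ((φ (Real.log p / Real.log x) : ℝ) : ℂ) else 0) +
          ∑' ρ : {ρ : ℂ // F ρ = 0 ∧ 0 < ρ.re ∧ ρ.re < 1},
            (m (ρ : ℂ) : ℂ) * mellin (PhiLog φ x) (ρ : ℂ)‖ ≤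
        C / (NumberField.classNumber K * Real.log x) := by
  obtain ⟨hg, hgs⟩ := contDiff_div_self_of_support h1 hφ hφs
  set g : ℝ → ℂ := fun u => ((φ u / u : ℝ) : ℂ) with hgdef
  set δ : ℝ := α₂ - α₁ with hδ
  have hδ0 : 0 < δ := sub_pos.2 h12
  set η : ℝ := min (1 / 2) (δ ^ 2 / (4 * α₁) / α₁) with hη
  have hη0 : 0 < η := by positivity
  have hηα : η * α₁ ≤ δ ^ 2 / (4 * α₁) := by
    rw [← le_div_iff₀ h1]
    exact min_le_right _ _
  obtain ⟨C₁, hC₁, hformula⟩ := exists_explicit_formula_le h1 h2 hg hgs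
  obtain ⟨C₂, hC₂, hprime⟩ := exists_primePow_sum_le hη0 (min_le_left _ _) hφ.continuous hφs
  obtain ⟨A, hA, hbounded⟩ := exists_isStripBounded
  obtain ⟨H, hH, hclass⟩ := exists_classNumber_le (ε := δ / α₁) (by positivity)
  refine ⟨54 * (C₁ * A) * H * ((α₁ / 4)⁻¹) ^ 3 + C₂ * H * (δ ^ 2 / (4 * α₁))⁻¹,
    fun D _ hD3 _ K _ _ hK hα x hx hθ χ hχ F hF hFs m hm => ?_⟩
  have hD : 0 < D := by omega
  have hL1 : 1 ≤ Real.log x := by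
    rw [Real.le_log_iff_exp_le (by linarith)]
    linarith [Real.exp_one_lt_d9]
  set L := Real.log x with hL
  have hL0 : 0 < L := by linarith
  have hFs' : ∀ s : ℂ, 1 < s.re →
      F s = Complex.exp (∑' n : ℕ, logCoeff χ n * (n : ℂ) ^ (-s)) := fun s hs => by
    rw [hFs s hs, tsum_lambdaChi hK χ hs]
  have hlogs := hasLogSeries_logCoeff hK hD hα χ hF hFs'
  obtain ⟨hsum, hle⟩ := hformula L _ F _ hL1 (hbounded K hK D hD hα χ hχ F hF hFs') hlogs
  have hmρ : ∀ ρ : {ρ : ℂ // F ρ = 0 ∧ 0 < ρ.re ∧ ρ.re < 1}, analyticOrderNatAt F ρ = m ρ := by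
    rintro ⟨ρ, h0, hr0, hr1⟩
    obtain ⟨G, hG, hG0, hFG⟩ := hm ρ h0 hr0 hr1
    exact analyticOrderNatAt_eq_of_eventually (hF.analyticAt ρ) hG hG0 hFG
  simp only [mellin_PhiLog φ hL0, ← hgdef, ← hL]
  simp only [hmρ] at hsum hle
  refine ⟨hsum, ?_⟩
  have hφ0 : φ 0 = 0 := by
    by_contra h
    exact (hφs h).1.not_gt h1
  have hterm : ∀ n : ℕ, logCoeff χ n * ((Real.log n / L : ℝ) * g (Real.log n / L) / n) =
      logCoeff χ n * ((φ (Real.log n / L) : ℝ) / (n : ℂ)) := fun n => by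
    rcases eq_or_ne (Real.log n / L) 0 with h0 | h0
    · rw [h0, hφ0]
      simp
    · rw [hgdef]
      simp only
      rw [← Complex.ofReal_mul, mul_div_cancel₀ _ h0]
  rw [tsum_congr hterm] at hle
  have hp := hprime L (logCoeff χ) hL0 (fun n => (summable_logCoeff_fiber hK χ n).2)
    (fun n => isPrimePow_of_logCoeff_ne_zero hK χ)
  have hpterm : ∀ p : ℕ, (if p.Prime then
      logCoeff χ p / p * ((φ (Real.log p / L) : ℝ) : ℂ) else 0) =
      if p.Prime then lambdaChi K χ p / p * ((φ (Real.log p / L) : ℝ) : ℂ) else 0 := fun p => by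
    split_ifs with h
    · rw [logCoeff_prime χ h]
    · rfl
  rw [tsum_congr hpterm] at hp
  have hD0 : (0 : ℝ) < D := by exact_mod_cast hD
  have hfinal := error_terms_le (ℓ := Real.log D) (A := C₁ * A) (B := C₂) h1 (by linarith) hδ0 hL1
    (by
      rw [div_lt_iff₀ hL0] at hθ
      rw [hδ]
      linarith) (by positivity) hC₂ hH.le
    (h := classNumber K) (by exact_mod_cast classNumber_pos K) (by
      have := hclass K hK D hD hα
      rwa [Real.rpow_def_of_pos hD0, mul_comm (Real.log D)] at this) hηα
  refine le_trans ?_ hfinal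
  set S := ∑' n : ℕ, logCoeff χ n * ((φ (Real.log n / L) : ℝ) / (n : ℂ))
  set P := ∑' p : ℕ, if p.Prime then
    lambdaChi K χ p / p * ((φ (Real.log p / L) : ℝ) : ℂ) else 0
  set Z := ∑' ρ : {ρ : ℂ // F ρ = 0 ∧ 0 < ρ.re ∧ ρ.re < 1}, (m (ρ : ℂ) : ℂ) * logMellin g L ρ
  calc ‖P + Z‖ = ‖(S + Z) - (S - P)‖ := by
        congr 1
        ring
    _ ≤ ‖S + Z‖ + ‖S - P‖ := norm_sub_le _ _
    _ ≤ C₁ * L * Real.exp (-(3 / 4 * α₁ * L)) * (A * (Real.log D + 1)) +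
        C₂ * Real.exp (-((1 / 2 - η) * α₁ * L)) := add_le_add hle hp
    _ = _ := by ring
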